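/- Let M ⊂ ℂ³ be a smooth pseudoconvex real hypersurface, p ∈ M, and let L be a smooth CR vector field along M with L(p) ≠ 0. Then the commutator type and the Levi-form type of L at p coincide: t_L(M,p) = c_L(M,p). -/

import Mathlib

open Topology

/-- ℂⁿ as a Pi type. -/
abbrev Cn (n : ℕ) := Fin n → ℂ

/-- The Wirtinger derivative `∂f/∂z_j` of a (real-)smooth function `f : ℂⁿ → ℂ`. -/
noncomputable def wz {n : ℕ} (j : Fin n) (f : Cn n → ℂ) (x : Cn n) : ℂ :=
  (fderiv ℝ f x (Pi.single j 1) - Complex.I * fderiv ℝ f x (Pi.single j Complex.I)) / 2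

/-- The Wirtinger derivative `∂f/∂z̄_j` of a (real-)smooth function `f : ℂⁿ → ℂ`. -/
noncomputable def wzb {n : ℕ} (j : Fin n) (f : Cn n → ℂ) (x : Cn n) : ℂ :=
  (fderiv ℝ f x (Pi.single j 1) + Complex.I * fderiv ℝ f x (Pi.single j Complex.I)) / 2

/-- The complexification of a real-valued function on ℂⁿ. -/
def cx {n : ℕ} (ρ : Cn n → ℝ) : Cn n → ℂ := fun x => (ρ x : ℂ)

/-- A complex vector field of mixed type `(1,0) + (0,1)` on ℂⁿ:
`W = Σ_j hol_j ∂/∂z_j + Σ_j anti_j ∂/∂z̄_j`. -/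
structure CVF (n : ℕ) where
  hol : Fin n → Cn n → ℂ
  anti : Fin n → Cn n → ℂ

/-- Action of a mixed-type complex vector field on functions, as a derivation. -/
noncomputable def CVF.act {n : ℕ} (W : CVF n) (f : Cn n → ℂ) : Cn n → ℂ :=
  fun x => (∑ j, W.hol j x * wz j f x) + (∑ j, W.anti j x * wzb j f x)

/-- Lie bracket of two mixed-type complex vector fields (with smooth coefficients the
commutator `[V,W]` of the first–order operators is again first order with these
coefficients). -/
noncomputable def CVF.bracket {n : ℕ} (V W : CVF n) : CVF n where
  hol := fun j x => V.act (W.hol j) x - W.act (V.hol j) x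
  anti := fun j x => V.act (W.anti j) x - W.act (V.anti j) x

/-- The `(1,0)` vector field `L = Σ_j a_j ∂/∂z_j`. -/
def LVF {n : ℕ} (a : Fin n → Cn n → ℂ) : CVF n := ⟨a, fun _ _ => 0⟩

/-- The conjugate `(0,1)` vector field `L̄ = Σ_j ā_j ∂/∂z̄_j`. -/
def LbarVF {n : ℕ} (a : Fin n → Cn n → ℂ) : CVF n :=
  ⟨fun _ _ => 0, fun j x => starRingEnd ℂ (a j x)⟩

/-- `a` is a smooth CR vector field along `M = {ρ = 0}`: smooth coefficients annihilating
`ρ` in the `(1,0)` directions, i.e. `Σ_j a_j ∂ρ/∂z_j = 0` on `M`. -/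
def IsCRField {n : ℕ} (ρ : Cn n → ℝ) (M : Set (Cn n)) (a : Fin n → Cn n → ℂ) : Prop :=
  (∀ j, ContDiff ℝ (⊤ : ℕ∞) (a j)) ∧ ∀ x ∈ M, ∑ j, a j x * wz j (cx ρ) x = 0

/-- Membership in the module `𝓜₁(L)` generated over smooth functions by `L` and `L̄`. -/
def InM1 {n : ℕ} (a : Fin n → Cn n → ℂ) (W : CVF n) : Prop :=
  ∃ c₁ c₂ : Cn n → ℂ, ContDiff ℝ (⊤ : ℕ∞) c₁ ∧ ContDiff ℝ (⊤ : ℕ∞) c₂ ∧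
    (∀ j x, W.hol j x = c₁ x * a j x) ∧ (∀ j x, W.anti j x = c₂ x * starRingEnd ℂ (a j x))

/-- `ν_L(f)(p)`: the smallest `m` such that `Y_m(⋯(Y_1 f)⋯)(p) ≠ 0` for some
`Y₁, …, Y_m ∈ 𝓜₁(L)`; `⊤` if no such `m` exists. -/
noncomputable def nuL {n : ℕ} (a : Fin n → Cn n → ℂ) (f : Cn n → ℂ) (p : Cn n) : ℕ∞ :=
  sInf {m : ℕ∞ | ∃ Ws : List (CVF n), (Ws.length : ℕ∞) = m ∧ (∀ W ∈ Ws, InM1 a W) ∧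
    (Ws.foldl (fun g W => W.act g) f) p ≠ 0}

/-- The coefficient `∂²ρ/∂z_j ∂z̄_l` of the Levi form. -/
noncomputable def leviCoeff {n : ℕ} (ρ : Cn n → ℝ) (j l : Fin n) (x : Cn n) : ℂ :=
  wz j (wzb l (cx ρ)) x

/-- The Levi form `λ(X,Y) = Σ_{j,l} (∂²ρ/∂z_j∂z̄_l) ξ_j η̄_l` of the fields with
coefficients `ξ`, `η`, as a function on ℂⁿ. -/
noncomputable def levi {n : ℕ} (ρ : Cn n → ℝ) (ξ η : Fin n → Cn n → ℂ) (x : Cn n) : ℂ :=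
  ∑ j, ∑ l, leviCoeff ρ j l x * ξ j x * starRingEnd ℂ (η l x)

/-- `M = {ρ = 0}` is pseudoconvex: the Levi form is positive semi-definite on the
CR directions at every point of `M`. -/
def Pseudoconvex {n : ℕ} (ρ : Cn n → ℝ) (M : Set (Cn n)) : Prop :=
  ∀ x ∈ M, ∀ ξ : Fin n → ℂ, (∑ j, ξ j * wz j (cx ρ) x) = 0 →
    0 ≤ (∑ j, ∑ l, leviCoeff ρ j l x * ξ j * starRingEnd ℂ (ξ l)).re

/-- Iterated commutators of length `μ` of elements of `𝓜₁(L)`: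
`[Y_μ, [Y_{μ-1}, ⋯ [Y₂, Y₁]⋯]]` with each `Y_i ∈ 𝓜₁(L)`. -/
inductive IsCommOf {n : ℕ} (a : Fin n → Cn n → ℂ) : ℕ → CVF n → Prop
  | one (W : CVF n) : InM1 a W → IsCommOf a 1 W
  | succ {μ : ℕ} (V W : CVF n) : InM1 a V → IsCommOf a μ W → IsCommOf a (μ + 1) (V.bracket W)

/-- The pairing `⟨∂ρ, G⟩(p)` of a mixed-type field with the `(1,0)` form `∂ρ`. -/
noncomputable def pairDRho {n : ℕ} (ρ : Cn n → ℝ) (G : CVF n) (p : Cn n) : ℂ :=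
  ∑ j, G.hol j p * wz j (cx ρ) p

/-- The commutator type `t_L(M,p)`: the smallest `m` such that `⟨∂ρ, G⟩(p) ≠ 0` for some
iterated commutator `G` of length (at most) `m` of elements of `𝓜₁(L)`; `⊤` if none. -/
noncomputable def tType {n : ℕ} (ρ : Cn n → ℝ) (a : Fin n → Cn n → ℂ) (p : Cn n) : ℕ∞ :=
  sInf {m : ℕ∞ | ∃ μ : ℕ, (μ : ℕ∞) = m ∧ ∃ G : CVF n, IsCommOf a μ G ∧ pairDRho ρ G p ≠ 0}

/-- The Levi-form type `c_L(M,p) = 2 + ν_L(λ(L,L))(p)`. -/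
noncomputable def cType {n : ℕ} (ρ : Cn n → ℝ) (a : Fin n → Cn n → ℂ) (p : Cn n) : ℕ∞ :=
  2 + nuL a (levi ρ a a) p

/-- The star algebra of smooth complex functions on `ℂⁿ`. -/
noncomputable def smoothAlg (n : ℕ) : StarSubalgebra ℂ (Cn n → ℂ) where
  carrier := {f | ContDiff ℝ (⊤ : ℕ∞) f}
  mul_mem' {f g} hf hg := by
    have hf' : ContDiff ℝ (⊤ : ℕ∞) f := hf
    exact hf'.mul hg
  one_mem' := (contDiff_const : ContDiff ℝ (⊤ : ℕ∞) fun _ : Cn n => (1 : ℂ))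
  add_mem' {f g} hf hg := by
    have hf' : ContDiff ℝ (⊤ : ℕ∞) f := hf
    exact hf'.add hg
  zero_mem' := (contDiff_const : ContDiff ℝ (⊤ : ℕ∞) fun _ : Cn n => (0 : ℂ))
  algebraMap_mem' c := (contDiff_const : ContDiff ℝ (⊤ : ℕ∞) fun _ : Cn n => c)
  star_mem' {f} hf := by
    have hf' : ContDiff ℝ (⊤ : ℕ∞) f := hf
    exact Complex.conjCLE.contDiff.comp hf'

/-- Smooth complex functions on `ℂⁿ`. -/
def SF (n : ℕ) := ↥(smoothAlg n)

/-- A smooth function as an element of the algebra. -/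
def SF.of {n : ℕ} (f : Cn n → ℂ) (hf : ContDiff ℝ (⊤ : ℕ∞) f) : SF n := ⟨f, hf⟩

noncomputable instance (n : ℕ) : CommRing (SF n) := inferInstanceAs (CommRing ↥(smoothAlg n))
noncomputable instance (n : ℕ) : Algebra ℂ (SF n) := inferInstanceAs (Algebra ℂ ↥(smoothAlg n))
noncomputable instance (n : ℕ) : StarRing (SF n) := inferInstanceAs (StarRing ↥(smoothAlg n))
instance (n : ℕ) : StarModule ℂ (SF n) := inferInstanceAs (StarModule ℂ ↥(smoothAlg n))

@[ext] theorem SF.ext {n : ℕ} {f g : SF n} (h : ∀ x, f.1 x = g.1 x) : f = g :=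
  Subtype.ext (funext h)

/-- Evaluation of smooth functions at a point. -/
def evAt {n : ℕ} (x : Cn n) : SF n →⋆ₐ[ℂ] ℂ where
  toFun f := f.1 x
  map_one' := rfl
  map_mul' _ _ := rfl
  map_zero' := rfl
  map_add' _ _ := rfl
  commutes' _ := rfl
  map_star' _ := rfl

@[simp] theorem SF.zero_coe {n : ℕ} (x : Cn n) : (0 : SF n).1 x = 0 := rfl

@[simp] theorem SF.one_coe {n : ℕ} (x : Cn n) : (1 : SF n).1 x = 1 := rfl

theorem evAt_apply {n : ℕ} (x : Cn n) (f : SF n) : evAt x f = f.1 x := rfl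

theorem SF.smooth {n : ℕ} (f : SF n) : ContDiff ℝ (⊤ : ℕ∞) f.1 := f.2

theorem SF.differentiableAt {n : ℕ} (f : SF n) (x : Cn n) : DifferentiableAt ℝ f.1 x :=
  f.smooth.differentiable (by simp) x

/-- The Wirtinger derivatives, indexed uniformly. -/
noncomputable def wirt {n : ℕ} : Fin n ⊕ Fin n → (Cn n → ℂ) → Cn n → ℂ := Sum.elim wz wzb

/-- The sign with which `I` enters a Wirtinger derivative. -/
def wsgn {n : ℕ} : Fin n ⊕ Fin n → ℂ := Sum.elim (fun _ => -1) (fun _ => 1)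

def widx {n : ℕ} : Fin n ⊕ Fin n → Fin n := Sum.elim id id

theorem wirt_eq {n : ℕ} (d : Fin n ⊕ Fin n) (f : Cn n → ℂ) (x : Cn n) :
    wirt d f x = (fderiv ℝ f x (Pi.single (widx d) 1)
      + wsgn d * Complex.I * fderiv ℝ f x (Pi.single (widx d) Complex.I)) / 2 := by
  rcases d with j | j <;> simp [wirt, wz, wzb, wsgn, widx, sub_eq_add_neg]

theorem contDiff_wirt {n : ℕ} (d : Fin n ⊕ Fin n) {f : Cn n → ℂ}
    (hf : ContDiff ℝ (⊤ : ℕ∞) f) : ContDiff ℝ (⊤ : ℕ∞) (wirt d f) := by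
  have h : ContDiff ℝ (⊤ : ℕ∞) (fderiv ℝ f) := hf.fderiv_right (by norm_cast)
  have h' : ∀ v : Cn n, ContDiff ℝ (⊤ : ℕ∞) (fun x => fderiv ℝ f x v) :=
    fun v => h.clm_apply contDiff_const
  have : wirt d f = fun x => (fderiv ℝ f x (Pi.single (widx d) 1)
      + wsgn d * Complex.I * fderiv ℝ f x (Pi.single (widx d) Complex.I)) / 2 := by
    funext x; exact wirt_eq d f x
  rw [this]
  exact ((h' _).add (contDiff_const.mul (h' _))).div_const 2

/-- The Wirtinger derivatives as derivations of the algebra of smooth functions. -/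
noncomputable def wD {n : ℕ} (d : Fin n ⊕ Fin n) : Derivation ℂ (SF n) (SF n) :=
  Derivation.mk'
    { toFun := fun f => ⟨wirt d f.1, contDiff_wirt d f.2⟩
      map_add' := fun f g => by
        ext x
        have h := fderiv_add (f.differentiableAt x) (g.differentiableAt x)
        change wirt d (f.1 + g.1) x = wirt d f.1 x + wirt d g.1 x
        simp only [wirt_eq, h, _root_.add_apply]
        ring
      map_smul' := fun c f => by
        ext x
        have h := fderiv_const_smul (f.differentiableAt x) c
        change wirt d (c • f.1) x = c * wirt d f.1 x
        simp only [wirt_eq, h, _root_.smul_apply, smul_eq_mul]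
        ring }
    (fun f g => by
      ext x
      have h := fderiv_mul (f.differentiableAt x) (g.differentiableAt x)
      change wirt d (f.1 * g.1) x = f.1 x * wirt d g.1 x + g.1 x * wirt d f.1 x
      simp only [wirt_eq, h, _root_.add_apply, _root_.smul_apply,
        smul_eq_mul]
      ring)

theorem wD_coe {n : ℕ} (d : Fin n ⊕ Fin n) (f : SF n) : (wD d f).1 = wirt d f.1 := rfl

theorem wD_star {n : ℕ} (d : Fin n ⊕ Fin n) (f : SF n) : wD d (star f) = star (wD d.swap f) := by
  ext x
  have h : fderiv ℝ (star f).1 x = (Complex.conjCLE : ℂ →L[ℝ] ℂ).comp (fderiv ℝ f.1 x) :=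
    ((Complex.conjCLE : ℂ →L[ℝ] ℂ).hasFDerivAt.comp x
      (f.differentiableAt x).hasFDerivAt).fderiv
  change wirt d (star f).1 x = starRingEnd ℂ (wirt d.swap f.1 x)
  rw [wirt_eq, wirt_eq, h]
  have h2 : starRingEnd ℂ 2 = 2 := map_ofNat _ 2
  rcases d with j | j <;> simp [wsgn, widx, h2]

theorem wD_comm {n : ℕ} (d e : Fin n ⊕ Fin n) (f : SF n) : wD d (wD e f) = wD e (wD d f) := by
  ext x
  have hs : IsSymmSndFDerivAt ℝ f.1 x := f.smooth.contDiffAt.isSymmSndFDerivAt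
    (by
    rw [minSmoothness_of_isRCLikeNormedField]
    exact WithTop.coe_le_coe.2 le_top)
  have hd : DifferentiableAt ℝ (fderiv ℝ f.1) x :=
    (f.smooth.fderiv_right (m := (⊤ : ℕ∞)) (by norm_cast)).differentiable (by simp) x
  have h1 : ∀ v w, fderiv ℝ (fun y => fderiv ℝ f.1 y v) x w
      = fderiv ℝ (fderiv ℝ f.1) x w v := fun v w => by
    rw [fderiv_clm_apply hd (differentiableAt_const v)]; simp
  have h2 : ∀ v, DifferentiableAt ℝ (fun y => fderiv ℝ f.1 y v) x := fun v =>
    hd.clm_apply (differentiableAt_const v)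
  have key : ∀ (e : Fin n ⊕ Fin n) (w : Cn n), fderiv ℝ (wirt e f.1) x w
      = (fderiv ℝ (fderiv ℝ f.1) x w (Pi.single (widx e) 1)
        + wsgn e * Complex.I * fderiv ℝ (fderiv ℝ f.1) x w
            (Pi.single (widx e) Complex.I)) / 2 := by
    intro e w
    have h3 : wirt e f.1 = fun x => (2 : ℂ)⁻¹ * (fderiv ℝ f.1 x (Pi.single (widx e) 1)
      + wsgn e * Complex.I * fderiv ℝ f.1 x (Pi.single (widx e) Complex.I)) := by
      funext x; rw [wirt_eq]; ring
    have h4 := ((((h2 (Pi.single (widx e) 1)).hasFDerivAt.add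
      ((h2 (Pi.single (widx e) Complex.I)).hasFDerivAt.const_mul (wsgn e * Complex.I))).const_mul
      (2 : ℂ)⁻¹)).fderiv
    change fderiv ℝ (fun x => (2 : ℂ)⁻¹ * (fderiv ℝ f.1 x (Pi.single (widx e) 1)
      + wsgn e * Complex.I * fderiv ℝ f.1 x (Pi.single (widx e) Complex.I))) x = _ at h4
    rw [h3, h4]
    simp only [_root_.smul_apply, _root_.add_apply, h1, smul_eq_mul]
    ring
  change wirt d (wirt e f.1) x = wirt e (wirt d f.1) x
  rw [wirt_eq, wirt_eq]
  simp only [key]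
  have hs' : ∀ v w, fderiv ℝ (fderiv ℝ f.1) x v w = fderiv ℝ (fderiv ℝ f.1) x w v := hs
  rw [hs' (Pi.single (widx d) 1) (Pi.single (widx e) 1),
    hs' (Pi.single (widx d) 1) (Pi.single (widx e) Complex.I),
    hs' (Pi.single (widx d) Complex.I) (Pi.single (widx e) 1),
    hs' (Pi.single (widx d) Complex.I) (Pi.single (widx e) Complex.I)]
  ring

/-- The coordinate functions `z_j` and `z̄_j`. -/
noncomputable def coord {n : ℕ} : Fin n ⊕ Fin n → SF n :=
  Sum.elim (fun j => SF.of (fun x => x j) (contDiff_apply ℝ ℂ j))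
    (fun j => star (SF.of (fun x => x j) (contDiff_apply ℝ ℂ j)))

theorem star_coord {n : ℕ} (d : Fin n ⊕ Fin n) : star (coord d) = coord d.swap := by
  rcases d with j | j
  · rfl
  · exact star_star _

theorem wD_coord {n : ℕ} (d e : Fin n ⊕ Fin n) : wD d (coord e) = if d = e then 1 else 0 := by
  have key : ∀ (d : Fin n ⊕ Fin n) (j : Fin n),
      wD d (coord (Sum.inl j)) = if d = Sum.inl j then 1 else 0 := by
    intro d j
    ext x
    have h : fderiv ℝ (fun x : Cn n => x j) x = ContinuousLinearMap.proj j :=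
      (ContinuousLinearMap.proj (R := ℝ) (φ := fun _ : Fin n => ℂ) j).hasFDerivAt.fderiv
    change wirt d (fun x : Cn n => x j) x = _
    rw [wirt_eq, h]
    rcases d with i | i
    · by_cases hij : i = j
      · subst hij; simp [wsgn, widx]
      · have : j ≠ i := fun h => hij h.symm
        simp [wsgn, widx, hij, this]
    · by_cases hij : j = i <;> simp [wsgn, widx, hij]
  rcases e with j | j
  · exact key d j
  · have : (coord (Sum.inr j) : SF n) = star (coord (Sum.inl j)) := rfl
    rw [this, wD_star, key]
    rcases d with i | i <;> simp [apply_ite star]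

theorem fderiv_eq_sum_wirt {n : ℕ} (f : Cn n → ℂ) (x v : Cn n) :
    fderiv ℝ f x v = ∑ j, (v j * wz j f x + starRingEnd ℂ (v j) * wzb j f x) := by
  have hv : v = ∑ j, ((v j).re • (Pi.single j 1 : Cn n)
      + (v j).im • (Pi.single j Complex.I : Cn n)) := by
    funext i
    simp [Finset.sum_apply, Pi.single_apply, Finset.sum_add_distrib]
  conv_lhs => rw [hv]
  rw [map_sum]
  refine Finset.sum_congr rfl fun j _ => ?_
  rw [map_add, map_smul, map_smul, wz, wzb]
  set p := fderiv ℝ f x (Pi.single j 1)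
  set q := fderiv ℝ f x (Pi.single j Complex.I)
  have h1 : v j = (v j).re + (v j).im * Complex.I := (Complex.re_add_im _).symm
  have h2 : starRingEnd ℂ (v j) = (v j).re - (v j).im * Complex.I := by
    conv_lhs => rw [h1]
    simp only [map_add, map_mul, Complex.conj_ofReal, Complex.conj_I]
    ring
  rw [h2, Complex.real_smul, Complex.real_smul]
  conv_rhs => rw [h1]
  simp only [Complex.add_re, Complex.ofReal_re, Complex.mul_re, Complex.I_re, mul_zero,
    Complex.ofReal_im, Complex.I_im, mul_one, sub_self, add_zero, Complex.add_im, Complex.mul_im,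
    zero_add]
  linear_combination (v j).im * q * Complex.I_sq

/-- Tuples of smooth functions together with their conjugates. -/
noncomputable def ext2 {n m : ℕ} (Φ : Fin n → SF m) : Fin n ⊕ Fin n → SF m :=
  Sum.elim Φ (fun i => star (Φ i))

/-- The map `ℂᵐ → ℂⁿ` with given components. -/
def toMap {n m : ℕ} (Φ : Fin n → SF m) (x : Cn m) : Cn n := fun i => (Φ i).1 x

theorem contDiff_toMap {n m : ℕ} (Φ : Fin n → SF m) : ContDiff ℝ (⊤ : ℕ∞) (toMap Φ) :=
  contDiff_pi.2 fun i => (Φ i).smooth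

/-- Pull back of smooth functions. -/
def pull {n m : ℕ} (Φ : Fin n → SF m) : SF n →⋆ₐ[ℂ] SF m where
  toFun f := SF.of (f.1 ∘ toMap Φ) (f.smooth.comp (contDiff_toMap Φ))
  map_one' := rfl
  map_mul' _ _ := rfl
  map_zero' := rfl
  map_add' _ _ := rfl
  commutes' _ := rfl
  map_star' _ := rfl

theorem pull_coe {n m : ℕ} (Φ : Fin n → SF m) (f : SF n) (x : Cn m) :
    (pull Φ f).1 x = f.1 (toMap Φ x) := rfl

theorem pull_coord {n m : ℕ} (Φ : Fin n → SF m) (e : Fin n ⊕ Fin n) :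
    pull Φ (coord e) = ext2 Φ e := by
  rcases e with j | j <;> rfl

theorem wD_pull {n m : ℕ} (Φ : Fin n → SF m) (f : SF n) (d : Fin m ⊕ Fin m) :
    wD d (pull Φ f) = ∑ e, pull Φ (wD e f) * wD d (ext2 Φ e) := by
  ext x
  have hΦ : DifferentiableAt ℝ (toMap Φ) x := (contDiff_toMap Φ).differentiable (by simp) x
  have h1 : fderiv ℝ (f.1 ∘ toMap Φ) x = (fderiv ℝ f.1 (toMap Φ x)).comp (fderiv ℝ (toMap Φ) x) :=
    fderiv_comp x (f.differentiableAt _) hΦ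
  have h2 : ∀ v i, fderiv ℝ (toMap Φ) x v i = fderiv ℝ (Φ i).1 x v := by
    intro v i
    have : fderiv ℝ (toMap Φ) x = ContinuousLinearMap.pi fun i => fderiv ℝ (Φ i).1 x :=
      fderiv_pi fun i => (Φ i).differentiableAt x
    rw [this]; rfl
  have h3 : ∀ v, fderiv ℝ (f.1 ∘ toMap Φ) x v = ∑ i, (fderiv ℝ (Φ i).1 x v *
      wz i f.1 (toMap Φ x) + starRingEnd ℂ (fderiv ℝ (Φ i).1 x v) * wzb i f.1 (toMap Φ x)) := by
    intro v
    rw [h1, ContinuousLinearMap.comp_apply, fderiv_eq_sum_wirt]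
    simp only [h2]
  have h4 : ∀ i, wirt d (star (Φ i)).1 x = (starRingEnd ℂ (fderiv ℝ (Φ i).1 x
        (Pi.single (widx d) 1)) + wsgn d * Complex.I * starRingEnd ℂ (fderiv ℝ (Φ i).1 x
        (Pi.single (widx d) Complex.I))) / 2 := by
    intro i
    have h : fderiv ℝ (star (Φ i)).1 x
        = (Complex.conjCLE : ℂ →L[ℝ] ℂ).comp (fderiv ℝ (Φ i).1 x) :=
      ((Complex.conjCLE : ℂ →L[ℝ] ℂ).hasFDerivAt.comp x
        ((Φ i).differentiableAt x).hasFDerivAt).fderiv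
    rw [wirt_eq, h]; rfl
  have h5 : (∑ e, pull Φ (wD e f) * wD d (ext2 Φ e) : SF m).1 x
      = ∑ e, (wD e f).1 (toMap Φ x) * wirt d (ext2 Φ e).1 x := by
    rw [← evAt_apply, map_sum]; rfl
  rw [h5, Fintype.sum_sum_type]
  change wirt d (f.1 ∘ toMap Φ) x = _
  rw [wirt_eq, h3, h3]
  simp only [ext2, Sum.elim_inl, Sum.elim_inr, h4, wD_coe]
  simp only [wirt_eq d]
  rw [Finset.mul_sum, ← Finset.sum_add_distrib, ← Finset.sum_add_distrib, Finset.sum_div]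
  refine Finset.sum_congr rfl fun i _ => ?_
  simp only [wirt, Sum.elim_inl, Sum.elim_inr]
  ring

/-- Smooth complex vector fields of mixed type. -/
abbrev VF (n : ℕ) := Fin n ⊕ Fin n → SF n

/-- The derivation defined by a vector field. -/
noncomputable def VF.act {n : ℕ} (V : VF n) : Derivation ℂ (SF n) (SF n) := ∑ d, V d • wD d

theorem VF.act_apply {n : ℕ} (V : VF n) (f : SF n) : V.act f = ∑ d, V d * wD d f := by
  rw [VF.act, ← Derivation.coeFnAddMonoidHom_apply, map_sum, Finset.sum_apply]
  rfl

/-- The Lie bracket of vector fields. -/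
noncomputable def VF.brk {n : ℕ} (V W : VF n) : VF n := fun d => V.act (W d) - W.act (V d)

theorem VF.act_brk {n : ℕ} (V W : VF n) (f : SF n) :
    (V.brk W).act f = V.act (W.act f) - W.act (V.act f) := by
  have h : ∀ V W : VF n, V.act (W.act f)
      = ∑ e, V.act (W e) * wD e f + ∑ d, ∑ e, V d * W e * wD d (wD e f) := by
    intro V W
    rw [W.act_apply f, map_sum, Finset.sum_comm, ← Finset.sum_add_distrib]
    refine Finset.sum_congr rfl fun e _ => ?_
    rw [Derivation.leibniz, V.act_apply (wD e f), smul_eq_mul, smul_eq_mul, Finset.mul_sum]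
    rw [add_comm, mul_comm]
    congr 1
    exact Finset.sum_congr rfl fun d _ => by ring
  rw [h, h, VF.act_apply, Finset.sum_comm (s := Finset.univ) (f := fun d e => W d * V e * _)]
  simp only [brk, sub_mul, Finset.sum_sub_distrib]
  have : ∀ d e, W e * V d * wD e (wD d f) = V d * W e * wD d (wD e f) := fun d e => by
    rw [wD_comm]; ring
  simp only [this]
  ring

theorem VF.act_add {n : ℕ} (V W : VF n) (f : SF n) : VF.act (V + W) f = V.act f + W.act f := by
  simp only [VF.act_apply, Pi.add_apply, add_mul, Finset.sum_add_distrib]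

theorem VF.act_smul {n : ℕ} (c : SF n) (W : VF n) (f : SF n) :
    VF.act (c • W) f = c * W.act f := by
  simp only [VF.act_apply, Pi.smul_apply, smul_eq_mul, mul_assoc, Finset.mul_sum]

/-- The underlying pair of coefficient functions. -/
def VF.toC {n : ℕ} (V : VF n) : CVF n :=
  ⟨fun j => (V (Sum.inl j)).1, fun j => (V (Sum.inr j)).1⟩

theorem VF.toC_act {n : ℕ} (V : VF n) (f : SF n) : V.toC.act f.1 = (V.act f).1 := by
  funext x
  rw [← evAt_apply, VF.act_apply, map_sum, Fintype.sum_sum_type]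
  simp only [map_mul]
  rfl

theorem VF.toC_brk {n : ℕ} (V W : VF n) : V.toC.bracket W.toC = (V.brk W).toC := by
  simp only [CVF.bracket]
  have h1 : ∀ V W : VF n, ∀ j, V.toC.act (W.toC.hol j) = (V.act (W (Sum.inl j))).1 :=
    fun V W j => V.toC_act _
  have h2 : ∀ V W : VF n, ∀ j, V.toC.act (W.toC.anti j) = (V.act (W (Sum.inr j))).1 :=
    fun V W j => V.toC_act _
  simp only [h1, h2]
  rfl

/-- The field `Σ a_j ∂/∂z_j`. -/
noncomputable def holField {n : ℕ} (a : Fin n → SF n) : VF n := Sum.elim a 0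

/-- The field `Σ ā_j ∂/∂z̄_j`. -/
noncomputable def antiField {n : ℕ} (a : Fin n → SF n) : VF n := Sum.elim 0 (fun j => star (a j))

/-- The field `c₁ L + c₂ L̄`. -/
noncomputable def combField {n : ℕ} (a : Fin n → SF n) (c₁ c₂ : SF n) : VF n :=
  c₁ • holField a + c₂ • antiField a

theorem inM1_iff {n : ℕ} (a : Fin n → SF n) (W : CVF n) :
    InM1 (fun j => (a j).1) W ↔ ∃ c₁ c₂, W = (combField a c₁ c₂).toC := by
  have h : ∀ c₁ c₂ : SF n, (combField a c₁ c₂).toC = ⟨fun j x => c₁.1 x * (a j).1 x,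
      fun j x => c₂.1 x * starRingEnd ℂ ((a j).1 x)⟩ := by
    intro c₁ c₂
    rw [VF.toC]
    congr 1 <;> funext j x
    · simp only [combField, holField, antiField, Pi.add_apply, Pi.smul_apply, Sum.elim_inl,
        smul_eq_mul, Pi.zero_apply, mul_zero, add_zero]
      rfl
    · simp only [combField, holField, antiField, Pi.add_apply, Pi.smul_apply, Sum.elim_inr,
        smul_eq_mul, Pi.zero_apply, mul_zero, zero_add]
      rfl
  constructor
  · rintro ⟨c₁, c₂, h₁, h₂, h₃, h₄⟩
    refine ⟨.of c₁ h₁, .of c₂ h₂, ?_⟩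
    rw [h]
    rcases W with ⟨u, v⟩
    congr 1
    · funext j x; exact h₃ j x
    · funext j x; exact h₄ j x
  · rintro ⟨c₁, c₂, rfl⟩
    rw [h]
    exact ⟨c₁.1, c₂.1, c₁.2, c₂.2, fun _ _ => rfl, fun _ _ => rfl⟩

/-- Iterated commutators of fields `c₁ L + c₂ L̄`. -/
inductive IsBrk {n : ℕ} (a : Fin n → SF n) : ℕ → VF n → Prop
  | one (c₁ c₂ : SF n) : IsBrk a 1 (combField a c₁ c₂)
  | succ {μ : ℕ} (c₁ c₂ : SF n) (W : VF n) :
    IsBrk a μ W → IsBrk a (μ + 1) ((combField a c₁ c₂).brk W)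

theorem isCommOf_iff {n : ℕ} (a : Fin n → SF n) (μ : ℕ) (G : CVF n) :
    IsCommOf (fun j => (a j).1) μ G ↔ ∃ V, IsBrk a μ V ∧ G = V.toC := by
  constructor
  · intro h
    induction h with
    | one W hW =>
      obtain ⟨c₁, c₂, rfl⟩ := (inM1_iff a W).1 hW
      exact ⟨_, .one c₁ c₂, rfl⟩
    | succ V W hV _ ih =>
      obtain ⟨c₁, c₂, rfl⟩ := (inM1_iff a V).1 hV
      obtain ⟨X, hX, rfl⟩ := ih
      exact ⟨_, .succ c₁ c₂ X hX, VF.toC_brk _ _⟩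
  · rintro ⟨V, hV, rfl⟩
    induction hV with
    | one c₁ c₂ => exact .one _ ((inM1_iff a _).2 ⟨c₁, c₂, rfl⟩)
    | succ c₁ c₂ W _ ih =>
      rw [← VF.toC_brk]
      exact .succ _ _ ((inM1_iff a _).2 ⟨c₁, c₂, rfl⟩) ih

noncomputable def VF.holPart {n : ℕ} (V : VF n) : VF n := Sum.elim (fun j => V (Sum.inl j)) 0

noncomputable def VF.antiPart {n : ℕ} (V : VF n) : VF n := Sum.elim 0 (fun j => V (Sum.inr j))

/-- All commutators of length less than `N` pair to zero with `∂r` at `p`. -/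
def CommVanish {n : ℕ} (r : SF n) (a : Fin n → SF n) (p : Cn n) (N : ℕ) : Prop :=
  ∀ μ < N, ∀ V, IsBrk a μ V → evAt p (V.holPart.act r) = 0

/-- The Levi form of `L` with itself. -/
noncomputable def leviF {n : ℕ} (r : SF n) (a : Fin n → SF n) : SF n :=
  ∑ j, ∑ l, wD (Sum.inl j) (wD (Sum.inr l) r) * a j * star (a l)

/-- Iterated derivatives along fields `c₁ L + c₂ L̄`. -/
noncomputable def actWord {n : ℕ} (a : Fin n → SF n) (cs : List (SF n × SF n)) (f : SF n) :
    SF n := cs.foldl (fun g c => (combField a c.1 c.2).act g) f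

/-- All derivatives of the Levi form of order less than `N - 2` vanish at `p`. -/
def LeviVanish {n : ℕ} (r : SF n) (a : Fin n → SF n) (p : Cn n) (N : ℕ) : Prop :=
  ∀ cs : List (SF n × SF n), cs.length + 2 < N → evAt p (actWord a cs (leviF r a)) = 0

theorem le_tType_iff {n : ℕ} (ρ : Cn n → ℝ) (r : SF n) (hr : r.1 = cx ρ) (a : Fin n → SF n)
    (p : Cn n) (N : ℕ) : (N : ℕ∞) ≤ tType ρ (fun j => (a j).1) p ↔ CommVanish r a p N := by
  have hp : ∀ V : VF n, pairDRho ρ V.toC p = evAt p (V.holPart.act r) := by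
    intro V
    rw [VF.act_apply, map_sum, Fintype.sum_sum_type]
    simp only [VF.holPart, Sum.elim_inl, Sum.elim_inr, Pi.zero_apply, zero_mul, map_zero,
      Finset.sum_const_zero, add_zero, map_mul, pairDRho, ← hr]
    rfl
  rw [tType, le_sInf_iff]
  constructor
  · intro h μ hμ V hV
    by_contra hne
    have := h μ ⟨μ, rfl, V.toC, (isCommOf_iff a μ _).2 ⟨V, hV, rfl⟩, by rwa [hp]⟩
    exact absurd (ENat.natCast_le_natCast.1 this) (by omega)
  · rintro h _ ⟨μ, rfl, G, hG, hne⟩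
    obtain ⟨V, hV, rfl⟩ := (isCommOf_iff a μ G).1 hG
    by_contra hlt
    rw [hp] at hne
    exact hne (h μ (by simpa using hlt) V hV)

theorem actWord_coe {n : ℕ} (a : Fin n → SF n) (cs : List (SF n × SF n)) (f : SF n) :
    (actWord a cs f).1 = (cs.map fun c => (combField a c.1 c.2).toC).foldl
      (fun g W => W.act g) f.1 := by
  induction cs generalizing f with
  | nil => rfl
  | cons c cs ih =>
    simp only [actWord, List.foldl_cons, List.map_cons] at ih ⊢
    rw [ih, VF.toC_act]

theorem le_cType_iff {n : ℕ} (ρ : Cn n → ℝ) (r : SF n) (hr : r.1 = cx ρ) (a : Fin n → SF n)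
    (p : Cn n) (N : ℕ) : (N : ℕ∞) ≤ cType ρ (fun j => (a j).1) p ↔ LeviVanish r a p N := by
  have hl : (leviF r a).1 = levi ρ (fun j => (a j).1) (fun j => (a j).1) := by
    funext x
    rw [← evAt_apply, leviF, map_sum]
    simp only [map_sum, map_mul, levi, leviCoeff, ← hr]
    rfl
  rw [cType, nuL, ← hl]
  constructor
  · intro h cs hcs
    by_contra hne
    have h1 : sInf {m : ℕ∞ | ∃ Ws : List (CVF n), (Ws.length : ℕ∞) = m ∧
        (∀ W ∈ Ws, InM1 (fun j => (a j).1) W) ∧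
        (Ws.foldl (fun g W => W.act g) (leviF r a).1) p ≠ 0} ≤ (cs.length : ℕ∞) := by
      refine sInf_le ⟨cs.map fun c => (combField a c.1 c.2).toC, by simp, ?_, ?_⟩
      · intro W hW
        obtain ⟨c, -, rfl⟩ := List.mem_map.1 hW
        exact (inM1_iff a _).2 ⟨_, _, rfl⟩
      · rw [← actWord_coe]; exact hne
    have h2 := h.trans (add_le_add_right h1 2)
    have h3 : (N : ℕ∞) ≤ ((2 + cs.length : ℕ) : ℕ∞) := by push_cast; exact h2
    exact absurd (ENat.natCast_le_natCast.1 h3) (by omega)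
  · intro h
    by_cases hN : N ≤ 2
    · exact le_trans (by exact_mod_cast hN) le_self_add
    obtain ⟨m, rfl⟩ : ∃ m, N = 2 + m := ⟨N - 2, by omega⟩
    push_cast
    refine add_le_add_right (le_sInf ?_) 2
    rintro _ ⟨Ws, rfl, hW, hne⟩
    have : ∃ cs : List (SF n × SF n), Ws = cs.map fun c => (combField a c.1 c.2).toC := by
      clear hne
      induction Ws with
      | nil => exact ⟨[], rfl⟩
      | cons W Ws ih =>
        obtain ⟨c₁, c₂, rfl⟩ := (inM1_iff a W).1 (hW _ (by simp))
        obtain ⟨cs, rfl⟩ := ih fun W hW' => hW _ (by simp [hW'])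
        exact ⟨(c₁, c₂) :: cs, rfl⟩
    obtain ⟨cs, rfl⟩ := this
    rw [← actWord_coe] at hne
    by_contra hlt
    refine hne (h cs ?_)
    have : cs.length < m := by simpa using hlt
    omega

theorem VF.act_pull {n m : ℕ} (Φ : Fin n → SF m) (V : VF m) (f : SF n) :
    V.act (pull Φ f) = ∑ e, pull Φ (wD e f) * V.act (ext2 Φ e) := by
  simp only [VF.act_apply, wD_pull, Finset.mul_sum]
  rw [Finset.sum_comm]
  exact Finset.sum_congr rfl fun _ _ => Finset.sum_congr rfl fun _ _ => by ring

theorem VF.act_coord {n : ℕ} (V : VF n) (d : Fin n ⊕ Fin n) : V.act (coord d) = V d := by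
  simp [VF.act_apply, wD_coord]

/-- Mutually inverse holomorphic changes of coordinates of `ℂⁿ`. -/
structure Bihol {n : ℕ} (Φ Ψ : Fin n → SF n) : Prop where
  hol : ∀ i j, wD (Sum.inr j) (Φ i) = 0
  hol' : ∀ i j, wD (Sum.inr j) (Ψ i) = 0
  inv : ∀ i, pull Φ (Ψ i) = coord (Sum.inl i)
  inv' : ∀ i, pull Ψ (Φ i) = coord (Sum.inl i)

theorem Bihol.symm {n : ℕ} {Φ Ψ : Fin n → SF n} (h : Bihol Φ Ψ) : Bihol Ψ Φ :=
  ⟨h.hol', h.hol, h.inv', h.inv⟩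

theorem Bihol.toMap_toMap {n : ℕ} {Φ Ψ : Fin n → SF n} (h : Bihol Φ Ψ) (x : Cn n) :
    toMap Ψ (toMap Φ x) = x := by
  funext i
  exact congrArg (fun f : SF n => f.1 x) (h.inv i)

theorem Bihol.pull_pull {n : ℕ} {Φ Ψ : Fin n → SF n} (h : Bihol Φ Ψ) (f : SF n) :
    pull Φ (pull Ψ f) = f := by
  ext x
  rw [pull_coe, pull_coe, h.toMap_toMap]

/-- The transform of a vector field under a change of coordinates. -/
noncomputable def VF.transf {n : ℕ} (Φ Ψ : Fin n → SF n) (V : VF n) : VF n :=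
  fun d => pull Φ (V.act (ext2 Ψ d))

theorem Bihol.transf_act {n : ℕ} {Φ Ψ : Fin n → SF n} (h : Bihol Φ Ψ) (V : VF n) (f : SF n) :
    (V.transf Φ Ψ).act (pull Φ f) = pull Φ (V.act f) := by
  conv_rhs => rw [← h.symm.pull_pull f, VF.act_pull, map_sum]
  rw [VF.act_apply]
  exact Finset.sum_congr rfl fun d _ => by rw [map_mul, h.pull_pull, VF.transf, mul_comm]

theorem Bihol.transf_brk {n : ℕ} {Φ Ψ : Fin n → SF n} (h : Bihol Φ Ψ) (V W : VF n) :
    (V.brk W).transf Φ Ψ = (V.transf Φ Ψ).brk (W.transf Φ Ψ) := by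
  funext d
  change pull Φ ((V.brk W).act (ext2 Ψ d)) = (V.transf Φ Ψ).act (pull Φ (W.act (ext2 Ψ d)))
    - (W.transf Φ Ψ).act (pull Φ (V.act (ext2 Ψ d)))
  rw [h.transf_act, h.transf_act, VF.act_brk, map_sub]

theorem holField_act {n : ℕ} (a : Fin n → SF n) (f : SF n) :
    (holField a).act f = ∑ j, a j * wD (Sum.inl j) f := by
  simp [VF.act_apply, holField]

theorem antiField_act {n : ℕ} (a : Fin n → SF n) (f : SF n) :
    (antiField a).act f = ∑ j, star (a j) * wD (Sum.inr j) f := by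
  simp [VF.act_apply, antiField]

theorem antiField_act_star {n : ℕ} (a : Fin n → SF n) (f : SF n) :
    (antiField a).act (star f) = star ((holField a).act f) := by
  simp [antiField_act, holField_act, star_sum, wD_star]

theorem holField_act_star {n : ℕ} (a : Fin n → SF n) (f : SF n) :
    (holField a).act (star f) = star ((antiField a).act f) := by
  simp [antiField_act, holField_act, star_sum, wD_star]

theorem combField_act {n : ℕ} (a : Fin n → SF n) (c₁ c₂ f : SF n) :
    (combField a c₁ c₂).act f = c₁ * (holField a).act f + c₂ * (antiField a).act f := by
  rw [combField, VF.act_add, VF.act_smul, VF.act_smul]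

/-- The transform of a `(1,0)` field under a change of coordinates. -/
noncomputable def transfHol {n : ℕ} (Φ Ψ : Fin n → SF n) (a : Fin n → SF n) : Fin n → SF n :=
  fun j => pull Φ ((holField a).act (Ψ j))

theorem Bihol.transf_combField {n : ℕ} {Φ Ψ : Fin n → SF n} (h : Bihol Φ Ψ) (a : Fin n → SF n)
    (c₁ c₂ : SF n) : (combField a c₁ c₂).transf Φ Ψ
      = combField (transfHol Φ Ψ a) (pull Φ c₁) (pull Φ c₂) := by
  have h0 : ∀ j, (antiField a).act (Ψ j) = 0 := fun j => by simp [antiField_act, h.hol']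
  funext d
  rw [VF.transf, combField_act]
  rcases d with j | j
  · rw [ext2, Sum.elim_inl, h0]
    simp [combField, holField, antiField, transfHol]
  · rw [ext2, Sum.elim_inr, antiField_act_star, holField_act_star, h0]
    simp [combField, holField, antiField, transfHol, map_star]

theorem Bihol.transf_holField {n : ℕ} {Φ Ψ : Fin n → SF n} (h : Bihol Φ Ψ) (a : Fin n → SF n) :
    (holField a).transf Φ Ψ = holField (transfHol Φ Ψ a) := by
  have := h.transf_combField a 1 0
  simpa [combField] using this

theorem Bihol.transf_antiField {n : ℕ} {Φ Ψ : Fin n → SF n} (h : Bihol Φ Ψ) (a : Fin n → SF n) :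
    (antiField a).transf Φ Ψ = antiField (transfHol Φ Ψ a) := by
  have := h.transf_combField a 0 1
  simpa [combField] using this

theorem Bihol.transf_holPart {n : ℕ} {Φ Ψ : Fin n → SF n} (h : Bihol Φ Ψ) (V : VF n) :
    (V.transf Φ Ψ).holPart = V.holPart.transf Φ Ψ := by
  funext d
  rcases d with j | j
  · simp [VF.transf, VF.holPart, ext2, VF.act_apply, h.hol']
  · simp [VF.transf, VF.holPart, ext2, VF.act_apply, wD_star, h.hol']

theorem Bihol.transf_antiPart {n : ℕ} {Φ Ψ : Fin n → SF n} (h : Bihol Φ Ψ) (V : VF n) :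
    (V.transf Φ Ψ).antiPart = V.antiPart.transf Φ Ψ := by
  funext d
  rcases d with j | j
  · simp [VF.transf, VF.antiPart, ext2, VF.act_apply, h.hol']
  · simp [VF.transf, VF.antiPart, ext2, VF.act_apply, wD_star, h.hol']

theorem leviF_eq {n : ℕ} (r : SF n) (a : Fin n → SF n) :
    leviF r a = (holField a).act ((antiField a).act r)
      - ((holField a).brk (antiField a)).antiPart.act r := by
  have h1 : ((holField a).brk (antiField a)).antiPart.act r
      = ∑ l, (holField a).act (star (a l)) * wD (Sum.inr l) r := by
    simp [VF.act_apply, VF.antiPart, VF.brk, holField, antiField]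
  rw [h1, antiField_act, map_sum, ← Finset.sum_sub_distrib, leviF, Finset.sum_comm]
  refine Finset.sum_congr rfl fun l _ => ?_
  rw [Derivation.leibniz, holField_act a (wD (Sum.inr l) r), smul_eq_mul, smul_eq_mul,
    Finset.mul_sum, mul_comm (wD (Sum.inr l) r), add_sub_cancel_right]
  exact Finset.sum_congr rfl fun _ _ => by ring

theorem Bihol.pull_leviF {n : ℕ} {Φ Ψ : Fin n → SF n} (h : Bihol Φ Ψ) (r : SF n)
    (a : Fin n → SF n) : leviF (pull Φ r) (transfHol Φ Ψ a) = pull Φ (leviF r a) := by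
  rw [leviF_eq, leviF_eq, ← h.transf_holField, ← h.transf_antiField, ← h.transf_brk,
    h.transf_antiPart, h.transf_act, h.transf_act, h.transf_act, map_sub]

theorem Bihol.isBrk_transf {n : ℕ} {Φ Ψ : Fin n → SF n} (h : Bihol Φ Ψ) {a : Fin n → SF n} {μ : ℕ}
    {V : VF n} (hV : IsBrk a μ V) : IsBrk (transfHol Φ Ψ a) μ (V.transf Φ Ψ) := by
  induction hV with
  | one c₁ c₂ => rw [h.transf_combField]; exact .one _ _
  | succ c₁ c₂ W _ ih => rw [h.transf_brk, h.transf_combField]; exact .succ _ _ _ ih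

theorem Bihol.transfHol_transfHol {n : ℕ} {Φ Ψ : Fin n → SF n} (h : Bihol Φ Ψ)
    (a : Fin n → SF n) : transfHol Ψ Φ (transfHol Φ Ψ a) = a := by
  funext j
  rw [transfHol, ← h.transf_holField, ← h.pull_pull (Φ j), h.inv', h.transf_act,
    h.symm.pull_pull, VF.act_coord]
  rfl

theorem Bihol.commVanish_of_pull {n : ℕ} {Φ Ψ : Fin n → SF n} (h : Bihol Φ Ψ) {r : SF n}
    {a : Fin n → SF n} {q : Cn n} {N : ℕ}
    (hv : CommVanish (pull Φ r) (transfHol Φ Ψ a) q N) : CommVanish r a (toMap Φ q) N := by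
  intro μ hμ V hV
  have := hv μ hμ _ (h.isBrk_transf hV)
  rwa [h.transf_holPart, h.transf_act] at this

theorem Bihol.commVanish_iff {n : ℕ} {Φ Ψ : Fin n → SF n} (h : Bihol Φ Ψ) (r : SF n)
    (a : Fin n → SF n) (q : Cn n) (N : ℕ) :
    CommVanish (pull Φ r) (transfHol Φ Ψ a) q N ↔ CommVanish r a (toMap Φ q) N := by
  refine ⟨h.commVanish_of_pull, fun hv => ?_⟩
  rw [← h.toMap_toMap q]
  apply h.symm.commVanish_of_pull
  rwa [h.symm.pull_pull, h.transfHol_transfHol]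

theorem Bihol.pull_actWord {n : ℕ} {Φ Ψ : Fin n → SF n} (h : Bihol Φ Ψ) (a : Fin n → SF n)
    (cs : List (SF n × SF n)) (f : SF n) : pull Φ (actWord a cs f) =
      actWord (transfHol Φ Ψ a) (cs.map fun c => (pull Φ c.1, pull Φ c.2)) (pull Φ f) := by
  induction cs generalizing f with
  | nil => rfl
  | cons c cs ih =>
    simp only [actWord, List.foldl_cons, List.map_cons] at ih ⊢
    rw [ih, ← h.transf_combField, h.transf_act]

theorem Bihol.leviVanish_of_pull {n : ℕ} {Φ Ψ : Fin n → SF n} (h : Bihol Φ Ψ) {r : SF n}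
    {a : Fin n → SF n} {q : Cn n} {N : ℕ}
    (hv : LeviVanish (pull Φ r) (transfHol Φ Ψ a) q N) : LeviVanish r a (toMap Φ q) N := by
  intro cs hcs
  have := hv (cs.map fun c => (pull Φ c.1, pull Φ c.2)) (by simpa using hcs)
  rwa [h.pull_leviF, ← h.pull_actWord] at this

theorem Bihol.leviVanish_iff {n : ℕ} {Φ Ψ : Fin n → SF n} (h : Bihol Φ Ψ) (r : SF n)
    (a : Fin n → SF n) (q : Cn n) (N : ℕ) :
    LeviVanish (pull Φ r) (transfHol Φ Ψ a) q N ↔ LeviVanish r a (toMap Φ q) N := by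
  refine ⟨h.leviVanish_of_pull, fun hv => ?_⟩
  rw [← h.toMap_toMap q]
  apply h.symm.leviVanish_of_pull
  rwa [h.symm.pull_pull, h.transfHol_transfHol]

/-- The Levi form of `r` at `x` on a constant vector. -/
noncomputable def leviAt {n : ℕ} (r : SF n) (x : Cn n) (ξ : Fin n → ℂ) : ℂ :=
  ∑ j, ∑ l, evAt x (wD (Sum.inl j) (wD (Sum.inr l) r)) * ξ j * starRingEnd ℂ (ξ l)

/-- The holomorphic differential of a map with components `Φ`, applied to a vector. -/
noncomputable def jac {n m : ℕ} (Φ : Fin n → SF m) (x : Cn m) (ξ : Fin m → ℂ) : Fin n → ℂ :=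
  fun i => ∑ j, ξ j * evAt x (wD (Sum.inl j) (Φ i))

theorem leviAt_pull {n m : ℕ} {Φ : Fin n → SF m} (h : ∀ i j, wD (Sum.inr j) (Φ i) = 0) (r : SF n)
    (x : Cn m) (ξ : Fin m → ℂ) :
    leviAt (pull Φ r) x ξ = leviAt r (toMap Φ x) (jac Φ x ξ) := by
  have h1 : ∀ (l : Fin m) (f : SF n), wD (Sum.inr l) (pull Φ f)
      = ∑ i, pull Φ (wD (Sum.inr i) f) * star (wD (Sum.inl l) (Φ i)) := by
    intro l f
    rw [wD_pull, Fintype.sum_sum_type]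
    simp [ext2, h, wD_star]
  have h2 : ∀ (l : Fin m) (f : SF n), wD (Sum.inl l) (pull Φ f)
      = ∑ i, pull Φ (wD (Sum.inl i) f) * wD (Sum.inl l) (Φ i) := by
    intro l f
    rw [wD_pull, Fintype.sum_sum_type]
    simp [ext2, h, wD_star]
  have h3 : ∀ (j l : Fin m) i, wD (Sum.inl j) (star (wD (Sum.inl l) (Φ i))) = 0 := by
    intro j l i
    rw [wD_star, Sum.swap_inl, wD_comm, h]; simp
  have h4 : ∀ j l, evAt x (wD (Sum.inl j) (wD (Sum.inr l) (pull Φ r))) = ∑ k, ∑ i,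
      evAt (toMap Φ x) (wD (Sum.inl k) (wD (Sum.inr i) r)) * evAt x (wD (Sum.inl j) (Φ k)) *
        starRingEnd ℂ (evAt x (wD (Sum.inl l) (Φ i))) := by
    intro j l
    rw [h1, map_sum, map_sum, Finset.sum_comm]
    refine Finset.sum_congr rfl fun i _ => ?_
    rw [Derivation.leibniz, h3, h2, smul_zero, zero_add, smul_eq_mul, map_mul, map_sum, mul_comm,
      Finset.sum_mul]
    refine Finset.sum_congr rfl fun k _ => ?_
    rw [map_mul, map_star]
    rfl
  simp only [leviAt, h4, jac, map_sum, map_mul, Finset.mul_sum, Finset.sum_mul]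
  have e1 : ∀ (g : Fin m → Fin m → Fin n → Fin n → ℂ), ∑ j, ∑ l, ∑ k, ∑ i, g j l k i
      = ∑ k, ∑ i, ∑ l, ∑ j, g j l k i := by
    intro g
    calc _ = ∑ l, ∑ j, ∑ k, ∑ i, g j l k i := Finset.sum_comm
      _ = ∑ l, ∑ k, ∑ i, ∑ j, g j l k i := Finset.sum_congr rfl fun l _ => by
        rw [Finset.sum_comm]
        exact Finset.sum_congr rfl fun k _ => Finset.sum_comm
      _ = _ := by
        rw [Finset.sum_comm]
        exact Finset.sum_congr rfl fun k _ => Finset.sum_comm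
  rw [e1]
  refine Finset.sum_congr rfl fun k _ => Finset.sum_congr rfl fun i _ => ?_
  refine Finset.sum_congr rfl fun l _ => Finset.sum_congr rfl fun j _ => ?_
  ring

theorem sum_wD_pull {n m : ℕ} {Φ : Fin n → SF m} (h : ∀ i j, wD (Sum.inr j) (Φ i) = 0) (r : SF n)
    (x : Cn m) (ξ : Fin m → ℂ) : ∑ j, ξ j * evAt x (wD (Sum.inl j) (pull Φ r))
      = ∑ i, jac Φ x ξ i * evAt (toMap Φ x) (wD (Sum.inl i) r) := by
  have h2 : ∀ (l : Fin m), evAt x (wD (Sum.inl l) (pull Φ r))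
      = ∑ i, evAt (toMap Φ x) (wD (Sum.inl i) r) * evAt x (wD (Sum.inl l) (Φ i)) := by
    intro l
    rw [wD_pull, Fintype.sum_sum_type, map_add, map_sum]
    simp only [ext2, Sum.elim_inl, Sum.elim_inr, wD_star, Sum.swap_inl, h, star_zero, mul_zero,
      Finset.sum_const_zero, map_zero, add_zero, map_mul]
    rfl
  simp only [h2, jac, Finset.mul_sum, Finset.sum_mul]
  rw [Finset.sum_comm]
  exact Finset.sum_congr rfl fun _ _ => Finset.sum_congr rfl fun _ _ => by ring

open MvPolynomial in
theorem derivation_aeval {σ A : Type*} [Fintype σ] [CommRing A] [Algebra ℂ A]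
    (D : Derivation ℂ A A) (g : σ → A) (P : MvPolynomial σ ℂ) :
    D (aeval g P) = ∑ s, aeval g (pderiv s P) * D (g s) := by
  classical
  induction P using MvPolynomial.induction_on with
  | C c => simp
  | add p q hp hq => simp only [map_add, hp, hq, add_mul, Finset.sum_add_distrib]
  | mul_X p i hp =>
    rw [map_mul, Derivation.leibniz, hp, aeval_X, smul_eq_mul, smul_eq_mul, Finset.mul_sum]
    simp only [Derivation.leibniz, smul_eq_mul, pderiv_X, map_add, map_mul, aeval_X, add_mul,
      Finset.sum_add_distrib]
    congr 1
    · rw [Finset.sum_eq_single i]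
      · simp
      · intro b _ hb; simp [hb.symm]
      · simp
    · exact Finset.sum_congr rfl fun s _ => by ring

open MvPolynomial in
/-- Weighted homogeneity, with the weight allowed to be any integer. -/
def ZHom {σ : Type*} (w : σ → ℕ) (P : MvPolynomial σ ℂ) (k : ℤ) : Prop :=
  IsWeightedHomogeneous (fun i => (w i : ℤ)) P k

namespace ZHom

open MvPolynomial

variable {σ : Type*} {w : σ → ℕ} {P Q : MvPolynomial σ ℂ} {k l : ℤ}

theorem zero : ZHom w 0 k := isWeightedHomogeneous_zero _ _ _

theorem C (c : ℂ) : ZHom w (MvPolynomial.C c) 0 := isWeightedHomogeneous_C _ _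

theorem X (i : σ) : ZHom w (MvPolynomial.X i) (w i) := isWeightedHomogeneous_X ℂ _ i

theorem add (hP : ZHom w P k) (hQ : ZHom w Q k) : ZHom w (P + Q) k :=
  IsWeightedHomogeneous.add hP hQ

theorem sub (hP : ZHom w P k) (hQ : ZHom w Q k) : ZHom w (P - Q) k :=
  IsWeightedHomogeneous.sub hP hQ

theorem sum {ι : Type*} {s : Finset ι} {f : ι → MvPolynomial σ ℂ} (h : ∀ i ∈ s, ZHom w (f i) k) :
    ZHom w (∑ i ∈ s, f i) k := IsWeightedHomogeneous.sum _ _ _ h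

theorem mul (hP : ZHom w P k) (hQ : ZHom w Q l) : ZHom w (P * Q) (k + l) :=
  IsWeightedHomogeneous.mul hP hQ

theorem mul' {m : ℤ} (hP : ZHom w P k) (hQ : ZHom w Q l) (hm : k + l = m) : ZHom w (P * Q) m :=
  hm ▸ hP.mul hQ

theorem pow (hP : ZHom w P k) (n : ℕ) : ZHom w (P ^ n) (n * k) := by
  have := IsWeightedHomogeneous.pow hP n
  rwa [nsmul_eq_mul] at this

theorem C_mul (c : ℂ) (hP : ZHom w P k) : ZHom w (MvPolynomial.C c * P) k :=
  (C c).mul' hP (zero_add k)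

theorem smul (c : ℂ) (hP : ZHom w P k) : ZHom w (c • P) k := by
  rw [MvPolynomial.smul_eq_C_mul]; exact hP.C_mul c

theorem pderiv (hP : ZHom w P k) (i : σ) : ZHom w (MvPolynomial.pderiv i P) (k - w i) :=
  IsWeightedHomogeneous.pderiv hP (sub_add_cancel _ _)

theorem weight_cast (d : σ →₀ ℕ) :
    Finsupp.weight (fun i => (w i : ℤ)) d = ((Finsupp.weight w d : ℕ) : ℤ) := by
  simp [Finsupp.weight_apply, Finsupp.sum]

theorem eq_zero_of_neg (hP : ZHom w P k) (hk : k < 0) : P = 0 := by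
  ext d
  by_contra h
  have := hP h
  rw [weight_cast] at this
  omega

theorem euler [Fintype σ] (hP : ZHom w P k) :
    ∑ i, (w i : ℂ) • (MvPolynomial.X i * MvPolynomial.pderiv i P) = (k : ℂ) • P := by
  by_cases hk : k < 0
  · simp [hP.eq_zero_of_neg hk]
  obtain ⟨n, rfl⟩ : ∃ n : ℕ, k = n := ⟨k.toNat, by omega⟩
  have h : IsWeightedHomogeneous w P n := by
    intro d hd
    have := hP hd
    rw [weight_cast] at this
    exact_mod_cast this
  have := h.sum_weight_X_mul_pderiv
  simpa [Nat.cast_smul_eq_nsmul] using this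

theorem eq_zero_of_pderiv [Fintype σ] (hP : ZHom w P k) (hk : k ≠ 0)
    (h : ∀ i, MvPolynomial.pderiv i P = 0) : P = 0 := by
  have := hP.euler
  simp only [h, mul_zero, smul_zero, Finset.sum_const_zero] at this
  exact (smul_eq_zero.1 this.symm).resolve_left (by exact_mod_cast hk)

theorem eq_C (hP : ZHom w P 0) (hw : ∀ i, 0 < w i) :
    P = MvPolynomial.C (constantCoeff P) := by
  classical
  ext d
  rw [coeff_C, constantCoeff_eq]
  split_ifs with hd
  · rw [hd]
  · by_contra h
    have := hP h
    rw [weight_cast] at this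
    have h0 : Finsupp.weight w d = 0 := by exact_mod_cast this
    apply hd
    ext i
    rw [Finsupp.weight_apply, Finsupp.sum, Finset.sum_eq_zero_iff] at h0
    by_contra hi
    have h1 := h0 i (Finsupp.mem_support_iff.2 (fun h => hi (by simp [h])))
    have := hw i
    simp only [smul_eq_mul, mul_eq_zero] at h1
    rcases h1 with h1 | h1
    · exact hi (by simp [h1])
    · omega

theorem constantCoeff_eq_zero (hP : ZHom w P k) (hk : k ≠ 0) : constantCoeff P = 0 := by
  rw [constantCoeff_eq]
  by_contra h
  have := hP h
  simp at this
  exact hk this.symm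

end ZHom

/-- Iterated Wirtinger derivatives. -/
noncomputable def wDs {n : ℕ} (l : List (Fin n ⊕ Fin n)) (f : SF n) : SF n :=
  l.foldl (fun g d => wD d g) f

theorem wDs_add {n : ℕ} (l : List (Fin n ⊕ Fin n)) (f g : SF n) :
    wDs l (f + g) = wDs l f + wDs l g := by
  induction l generalizing f g with
  | nil => rfl
  | cons d l ih => simp only [wDs, List.foldl_cons, map_add] at ih ⊢; exact ih _ _

theorem wDs_smul {n : ℕ} (l : List (Fin n ⊕ Fin n)) (c : ℂ) (f : SF n) :
    wDs l (c • f) = c • wDs l f := by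
  induction l generalizing f with
  | nil => rfl
  | cons d l ih => simp only [wDs, List.foldl_cons, Derivation.map_smul] at ih ⊢; exact ih _

/-- The weight of a Wirtinger derivative. -/
def dwt {n : ℕ} (ω : Fin n → ℕ) (d : Fin n ⊕ Fin n) : ℤ := ω (widx d)

/-- The functions vanishing to weighted order at least `k` at the origin. -/
noncomputable def fil {n : ℕ} (ω : Fin n → ℕ) (k : ℤ) : Submodule ℂ (SF n) where
  carrier := {f | ∀ l : List (Fin n ⊕ Fin n), (l.map (dwt ω)).sum < k → evAt 0 (wDs l f) = 0}
  add_mem' hf hg l hl := by rw [wDs_add, map_add, hf l hl, hg l hl, add_zero]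
  zero_mem' l _ := by
    have := wDs_smul l 0 0
    rw [zero_smul, zero_smul] at this
    rw [this, map_zero]
  smul_mem' c f hf l hl := by rw [wDs_smul, map_smul, hf l hl, smul_zero]

section fil

variable {n : ℕ} {ω : Fin n → ℕ} {f g : SF n} {k l : ℤ}

theorem mem_fil_of_nonpos (hk : k ≤ 0) (f : SF n) : f ∈ fil ω k := by
  intro l hl
  have : 0 ≤ (l.map (dwt ω)).sum := List.sum_nonneg fun x hx => by
    obtain ⟨d, -, rfl⟩ := List.mem_map.1 hx
    exact Int.natCast_nonneg _
  omega

theorem fil_mono (h : l ≤ k) (hf : f ∈ fil ω k) : f ∈ fil ω l := fun m hm => hf m (hm.trans_le h)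

theorem wD_mem_fil (d : Fin n ⊕ Fin n) (hf : f ∈ fil ω k) : wD d f ∈ fil ω (k - dwt ω d) := by
  intro l hl
  exact hf (d :: l) (by simp only [List.map_cons, List.sum_cons]; omega)

theorem mem_fil_iff : f ∈ fil ω k ↔
    (0 < k → evAt 0 f = 0) ∧ ∀ d, wD d f ∈ fil ω (k - dwt ω d) := by
  refine ⟨fun h => ⟨fun hk => h [] (by simpa using hk), fun d => wD_mem_fil d h⟩, fun h l hl => ?_⟩
  cases l with
  | nil => exact h.1 (by simpa using hl)
  | cons d l =>
    exact h.2 d l (by simp only [List.map_cons, List.sum_cons] at hl; omega)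

theorem evAt_eq_zero_of_mem (hf : f ∈ fil ω k) (hk : 0 < k) : evAt 0 f = 0 := (mem_fil_iff.1 hf).1 hk

theorem mul_mem_fil (hf : f ∈ fil ω k) (hg : g ∈ fil ω l) : f * g ∈ fil ω (k + l) := by
  intro m
  induction m generalizing f g k l with
  | nil =>
    intro hm
    change evAt 0 (f * g) = 0
    rw [map_mul]
    by_cases hk : 0 < k
    · rw [evAt_eq_zero_of_mem hf hk, zero_mul]
    · rw [evAt_eq_zero_of_mem hg (by simp at hm; omega), mul_zero]
  | cons d m ih =>
    intro hm
    simp only [List.map_cons, List.sum_cons] at hm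
    change evAt 0 (wDs m (wD d (f * g))) = 0
    rw [Derivation.leibniz, wDs_add, map_add, smul_eq_mul, smul_eq_mul,
      ih hf (wD_mem_fil d hg) (by omega), ih hg (wD_mem_fil d hf) (by omega), add_zero]

theorem mul_mem_fil' {m : ℤ} (hf : f ∈ fil ω k) (hg : g ∈ fil ω l) (h : m ≤ k + l) :
    f * g ∈ fil ω m := fil_mono h (mul_mem_fil hf hg)

theorem dwt_swap (d : Fin n ⊕ Fin n) : dwt ω d.swap = dwt ω d := by rcases d with j | j <;> rfl

theorem star_mem_fil (hf : f ∈ fil ω k) : star f ∈ fil ω k := by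
  intro m
  induction m generalizing f k with
  | nil =>
    intro hm
    change evAt 0 (star f) = 0
    rw [map_star, evAt_eq_zero_of_mem hf (by simpa using hm), star_zero]
  | cons d m ih =>
    intro hm
    simp only [List.map_cons, List.sum_cons] at hm
    change evAt 0 (wDs m (wD d (star f))) = 0
    rw [wD_star]
    exact ih (wD_mem_fil d.swap hf) (by rw [dwt_swap]; omega)

theorem fil_mono_weight {ω' : Fin n → ℕ} (h : ∀ i, ω i ≤ ω' i) (hf : f ∈ fil ω k) :
    f ∈ fil ω' k := by
  intro m hm
  refine hf m (lt_of_le_of_lt ?_ hm)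
  refine List.sum_le_sum fun d _ => ?_
  exact Int.ofNat_le.2 (h (widx d))

theorem pull_mem_fil {Φ : Fin n → SF n} (h0 : ∀ i, evAt 0 (Φ i) = 0)
    (hΦ : ∀ d e, wD d (ext2 Φ e) ∈ fil ω (dwt ω e - dwt ω d)) (hf : f ∈ fil ω k) :
    pull Φ f ∈ fil ω k := by
  have h00 : toMap Φ 0 = 0 := funext h0
  have key : ∀ (m : List (Fin n ⊕ Fin n)) (f g : SF n) (k l : ℤ), f ∈ fil ω k → g ∈ fil ω l →
      (m.map (dwt ω)).sum < k + l → evAt 0 (wDs m (pull Φ f * g)) = 0 := by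
    intro m
    induction m with
    | nil =>
      intro f g k l hf hg hm
      change evAt 0 (pull Φ f * g) = 0
      rw [map_mul]
      by_cases hk : 0 < k
      · rw [evAt_apply, pull_coe, h00, ← evAt_apply, evAt_eq_zero_of_mem hf hk, zero_mul]
      · rw [evAt_eq_zero_of_mem hg (by simp at hm; omega), mul_zero]
    | cons d m ih =>
      intro f g k l hf hg hm
      simp only [List.map_cons, List.sum_cons] at hm
      change evAt 0 (wDs m (wD d (pull Φ f * g))) = 0
      have hsum : ∀ (s : Finset (Fin n ⊕ Fin n)) (F : Fin n ⊕ Fin n → SF n),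
          wDs m (∑ e ∈ s, F e) = ∑ e ∈ s, wDs m (F e) := by
        intro s F
        exact map_sum (⟨⟨wDs m, by simpa using wDs_smul m 0 0⟩, wDs_add m⟩ : SF n →+ SF n) F s
      rw [Derivation.leibniz, wDs_add, map_add, smul_eq_mul, smul_eq_mul,
        ih f _ k _ hf (wD_mem_fil d hg) (by omega), wD_pull, Finset.mul_sum, hsum, map_sum, zero_add]
      refine Finset.sum_eq_zero fun e _ => ?_
      have : g * (pull Φ (wD e f) * wD d (ext2 Φ e)) = pull Φ (wD e f) * (g * wD d (ext2 Φ e)) := by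
        ring
      rw [this]
      exact ih _ _ _ _ (wD_mem_fil e hf) (mul_mem_fil hg (hΦ d e)) (by omega)
  intro m hm
  have := key m f 1 k 0 hf (mem_fil_of_nonpos le_rfl 1) (by omega)
  rwa [mul_one] at this

end fil

/-- Vector fields of weighted order at least `ν`. -/
def VF.HasOrder {n : ℕ} (ω : Fin n → ℕ) (V : VF n) (ν : ℤ) : Prop :=
  ∀ d, V d ∈ fil ω (dwt ω d + ν)

section order

variable {n : ℕ} {ω : Fin n → ℕ} {V W : VF n} {ν μ k : ℤ} {f : SF n}

theorem VF.HasOrder.act_mem (hV : V.HasOrder ω ν) (hf : f ∈ fil ω k) :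
    V.act f ∈ fil ω (k + ν) := by
  rw [VF.act_apply]
  exact Submodule.sum_mem _ fun d _ => mul_mem_fil' (hV d) (wD_mem_fil d hf) (by omega)

theorem VF.HasOrder.brk (hV : V.HasOrder ω ν) (hW : W.HasOrder ω μ) :
    (V.brk W).HasOrder ω (ν + μ) := fun d =>
  Submodule.sub_mem _ (fil_mono (by omega) (hV.act_mem (hW d)))
    (fil_mono (by omega) (hW.act_mem (hV d)))

theorem VF.HasOrder.holPart (hV : V.HasOrder ω ν) : V.holPart.HasOrder ω ν := by
  rintro (j | j)
  · exact hV (Sum.inl j)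
  · exact Submodule.zero_mem _

theorem hasOrder_combField {a : Fin n → SF n} (ha : ∀ j, a j ∈ fil ω (ω j - 1)) (c₁ c₂ : SF n) :
    (combField a c₁ c₂).HasOrder ω (-1) := by
  rintro (j | j)
  · refine Submodule.add_mem _ ?_ ?_
    · exact mul_mem_fil' (mem_fil_of_nonpos le_rfl c₁) (ha j) (by simp [dwt, widx])
    · simp [antiField]
  · refine Submodule.add_mem _ ?_ ?_
    · simp [holField]
    · exact mul_mem_fil' (mem_fil_of_nonpos le_rfl c₂) (star_mem_fil (ha j))
        (by simp [dwt, widx])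

theorem hasOrder_of_isBrk {a : Fin n → SF n} (ha : ∀ j, a j ∈ fil ω (ω j - 1)) {μ : ℕ} {V : VF n}
    (hV : IsBrk a μ V) : V.HasOrder ω (-μ) := by
  induction hV with
  | one c₁ c₂ => simpa using hasOrder_combField ha c₁ c₂
  | succ c₁ c₂ W _ ih =>
    have := (hasOrder_combField ha c₁ c₂).brk ih
    convert this using 1
    push_cast; ring

theorem commVanish_of_mem {a : Fin n → SF n} (ha : ∀ j, a j ∈ fil ω (ω j - 1)) {r : SF n} {N : ℕ}
    (hr : r ∈ fil ω N) : CommVanish r a 0 N := by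
  intro μ hμ V hV
  exact evAt_eq_zero_of_mem ((hasOrder_of_isBrk ha hV).holPart.act_mem hr) (by omega)

theorem leviF_mem {a : Fin n → SF n} (ha : ∀ j, a j ∈ fil ω (ω j - 1)) {r : SF n}
    (hr : r ∈ fil ω k) : leviF r a ∈ fil ω (k - 2) := by
  refine Submodule.sum_mem _ fun j _ => Submodule.sum_mem _ fun l _ => ?_
  refine mul_mem_fil' (mul_mem_fil (wD_mem_fil _ (wD_mem_fil _ hr)) (ha j))
    (star_mem_fil (ha l)) ?_
  simp [dwt, widx]; omega

theorem actWord_mem {a : Fin n → SF n} (ha : ∀ j, a j ∈ fil ω (ω j - 1))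
    (cs : List (SF n × SF n)) (hf : f ∈ fil ω k) : actWord a cs f ∈ fil ω (k - cs.length) := by
  induction cs generalizing f k with
  | nil => simpa [actWord] using hf
  | cons c cs ih =>
    have := ih ((hasOrder_combField ha c.1 c.2).act_mem hf)
    refine fil_mono (le_of_eq ?_) this
    simp; ring

theorem leviVanish_of_mem {a : Fin n → SF n} (ha : ∀ j, a j ∈ fil ω (ω j - 1)) {r : SF n} {N : ℕ}
    (hr : r ∈ fil ω N) : LeviVanish r a 0 N := fun cs hcs =>
  evAt_eq_zero_of_mem (actWord_mem ha cs (leviF_mem ha hr)) (by omega)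

end order

namespace Model

open MvPolynomial

/-- Polynomials in `z, w` and `Y_0, …, Y_k`. -/
abbrev SR (k : ℕ) := MvPolynomial (Fin 2 ⊕ Fin (k + 1)) ℂ

/-- Polynomials in `z₁, z₂` and their conjugates. -/
abbrev R2 := MvPolynomial (Fin 2 ⊕ Fin 2) ℂ

/-- The weights of `z, w, Y_j`. -/
def sw (k : ℕ) : Fin 2 ⊕ Fin (k + 1) → ℕ := Sum.elim (fun _ => 1) (fun _ => k + 2)

/-- The weights of `z₁, z₂` and their conjugates. -/
def w2 (k : ℕ) : Fin 2 ⊕ Fin 2 → ℕ := Sum.elim ![1, k + 2] ![1, k + 2]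

variable {k : ℕ}

/-- The variable `z`. -/
noncomputable def Z : SR k := X (Sum.inl 0)
/-- The variable `w`. -/
noncomputable def Wv : SR k := X (Sum.inl 1)
/-- The variable `Y_j`. -/
noncomputable def Y (j : Fin (k + 1)) : SR k := X (Sum.inr j)
/-- The monomial `z^{j+1} w^{k+1-j}`. -/
noncomputable def q (j : Fin (k + 1)) : SR k := Z ^ (j.1 + 1) * Wv ^ (k + 1 - j.1)

theorem zhom_Z : ZHom (sw k) Z 1 := ZHom.X (w := sw k) (Sum.inl 0)
theorem zhom_Wv : ZHom (sw k) Wv 1 := ZHom.X (w := sw k) (Sum.inl 1)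
theorem zhom_Y (j : Fin (k + 1)) : ZHom (sw k) (Y j) (k + 2) := by
  have := ZHom.X (w := sw k) (Sum.inr j)
  simpa [sw, Y] using this

theorem zhom_mono (i l : ℕ) : ZHom (sw k) ((Z : SR k) ^ i * Wv ^ l) (i + l) := by
  have := (zhom_Z (k := k).pow i).mul (zhom_Wv (k := k).pow l)
  simpa using this

theorem zhom_q (j : Fin (k + 1)) : ZHom (sw k) (q j) (k + 2) := by
  have := zhom_mono (k := k) (j.1 + 1) (k + 1 - j.1)
  have h : ((j.1 + 1 : ℕ) : ℤ) + ((k + 1 - j.1 : ℕ) : ℤ) = k + 2 := by omega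
  rwa [h] at this

/-- The model holomorphic field. -/
noncomputable def L : Derivation ℂ (SR k) (SR k) :=
  mkDerivation ℂ (Sum.elim ![1, 0] fun j : Fin (k + 1) =>
    C ((j.1 : ℂ) + 1) * (Z ^ j.1 * Wv ^ (k + 1 - j.1)))

/-- The model antiholomorphic field. -/
noncomputable def Lb : Derivation ℂ (SR k) (SR k) := pderiv (Sum.inl 1)

@[simp] theorem L_Z : L (Z : SR k) = 1 := by simp [L, Z]
@[simp] theorem L_Wv : L (Wv : SR k) = 0 := by simp [L, Wv]
@[simp] theorem L_Y (j : Fin (k + 1)) :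
    L (Y j) = C ((j.1 : ℂ) + 1) * (Z ^ j.1 * Wv ^ (k + 1 - j.1)) := by simp [L, Y]
@[simp] theorem Lb_Z : Lb (Z : SR k) = 0 := by simp [Lb, Z, pderiv_X]
@[simp] theorem Lb_Wv : Lb (Wv : SR k) = 1 := by simp [Lb, Wv]
@[simp] theorem Lb_Y (j : Fin (k + 1)) : Lb (Y j) = 0 := by simp [Lb, Y, pderiv_X]

theorem L_C (c : ℂ) : L (C c : SR k) = 0 := by simp [L]
theorem Lb_C (c : ℂ) : Lb (C c : SR k) = 0 := by simp [Lb]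

theorem L_mono (i l : ℕ) : L ((Z : SR k) ^ i * Wv ^ l) = C (i : ℂ) * (Z ^ (i - 1) * Wv ^ l) := by
  rw [Derivation.leibniz, Derivation.leibniz_pow, Derivation.leibniz_pow]
  simp [nsmul_eq_mul]; ring

theorem Lb_mono (i l : ℕ) : Lb ((Z : SR k) ^ i * Wv ^ l) = C (l : ℂ) * (Z ^ i * Wv ^ (l - 1)) := by
  rw [Derivation.leibniz, Derivation.leibniz_pow, Derivation.leibniz_pow]
  simp [nsmul_eq_mul]; ring

theorem L_apply (p : SR k) : L p = pderiv (Sum.inl 0) p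
    + ∑ j : Fin (k + 1), C ((j.1 : ℂ) + 1) * (Z ^ j.1 * Wv ^ (k + 1 - j.1)) * pderiv (Sum.inr j) p := by
  have h := derivation_aeval (L : Derivation ℂ (SR k) (SR k)) X p
  simp only [aeval_X_left, AlgHom.id_apply, Fintype.sum_sum_type, Fin.sum_univ_two] at h
  rw [h]
  change _ * L Z + _ * L Wv + ∑ j, _ * L (Y j) = _
  simp only [L_Z, L_Wv, L_Y, mul_one, mul_zero, add_zero]
  congr 1
  exact Finset.sum_congr rfl fun j _ => mul_comm _ _

theorem zhom_L {p : SR k} {n : ℤ} (hp : ZHom (sw k) p n) : ZHom (sw k) (L p) (n - 1) := by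
  rw [L_apply]
  refine ZHom.add (by simpa [sw] using hp.pderiv (Sum.inl 0)) (ZHom.sum fun j _ => ?_)
  refine ((zhom_mono j.1 (k + 1 - j.1)).C_mul _).mul' (hp.pderiv (Sum.inr j)) ?_
  simp [sw]; omega

theorem zhom_Lb {p : SR k} {n : ℤ} (hp : ZHom (sw k) p n) : ZHom (sw k) (Lb p) (n - 1) := by
  have := hp.pderiv (Sum.inl 1)
  simpa [sw, Lb] using this

theorem pderiv_pderiv_comm {σ : Type*} (i j : σ) (p : MvPolynomial σ ℂ) :
    pderiv i (pderiv j p) = pderiv j (pderiv i p) := by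
  classical
  have : ⁅(pderiv i : Derivation ℂ (MvPolynomial σ ℂ) (MvPolynomial σ ℂ)),
      (pderiv j : Derivation ℂ (MvPolynomial σ ℂ) (MvPolynomial σ ℂ))⁆ = 0 := by
    refine derivation_ext fun s => ?_
    rw [Derivation.commutator_apply, pderiv_X, pderiv_X, Pi.single_apply, Pi.single_apply]
    split_ifs <;> simp
  have h := congrArg (fun D => D p) this
  simpa [Derivation.commutator_apply, sub_eq_zero] using h

theorem L_pderiv_Y (j : Fin (k + 1)) (p : SR k) :
    L (pderiv (Sum.inr j) p) = pderiv (Sum.inr j) (L p) := by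
  have : ⁅(L : Derivation ℂ (SR k) (SR k)), (pderiv (Sum.inr j) : Derivation ℂ (SR k) (SR k))⁆ = 0 := by
    refine derivation_ext fun i => ?_
    rw [Derivation.commutator_apply, _root_.Derivation.zero_apply]
    rcases i with i | i
    · fin_cases i
      · change L (pderiv (Sum.inr j) (X _)) - pderiv (Sum.inr j) (L Z) = 0
        rw [pderiv_X]; simp
      · change L (pderiv (Sum.inr j) (X _)) - pderiv (Sum.inr j) (L Wv) = 0
        rw [pderiv_X]; simp
    · change L (pderiv (Sum.inr j) (X _)) - pderiv (Sum.inr j) (L (Y i)) = 0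
      rw [pderiv_X, L_Y]
      have h : L (Pi.single (M := fun _ => SR k) (Sum.inr j : Fin 2 ⊕ Fin (k + 1)) 1 (Sum.inr i)) = 0 := by
        rw [Pi.single_apply]; split_ifs <;> simp
      rw [h]
      simp [Derivation.leibniz, Derivation.leibniz_pow, Z, Wv, pderiv_X]
  have h := congrArg (fun D => D p) this
  simpa [Derivation.commutator_apply, sub_eq_zero] using h

theorem Lb_pderiv (i : Fin 2 ⊕ Fin (k + 1)) (p : SR k) :
    Lb (pderiv i p) = pderiv i (Lb p) :=
  pderiv_pderiv_comm _ _ _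

/-- The coefficients of the iterated brackets of the model fields. -/
noncomputable def u (i l : ℕ) (j : Fin (k + 1)) : SR k :=
  C (((j.1 + 1) * (k + 1 - j.1) * (j.1.descFactorial i) * ((k - j.1).descFactorial l) : ℕ) : ℂ)
    * (Z ^ (j.1 - i) * Wv ^ (k - j.1 - l))

theorem L_u (i l : ℕ) (j : Fin (k + 1)) : L (u i l j) = u (i + 1) l j := by
  rw [u, Derivation.leibniz, L_C, L_mono, smul_zero, add_zero, smul_eq_mul, ← mul_assoc, ← C_mul,
    u, Nat.descFactorial_succ, Nat.sub_sub]
  congr 2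
  push_cast; ring

theorem Lb_u (i l : ℕ) (j : Fin (k + 1)) : Lb (u i l j) = u i (l + 1) j := by
  rw [u, Derivation.leibniz, Lb_C, Lb_mono, smul_zero, add_zero, smul_eq_mul, ← mul_assoc, ← C_mul,
    u, Nat.descFactorial_succ, Nat.sub_sub (k - j.1)]
  congr 2
  push_cast; ring

theorem u_eq_zero {i l : ℕ} (h : k < i + l) (j : Fin (k + 1)) : u i l j = 0 := by
  have : j.1.descFactorial i = 0 ∨ (k - j.1).descFactorial l = 0 := by
    simp only [Nat.descFactorial_eq_zero_iff_lt]; omega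
  rcases this with h | h <;> simp [u, h]

theorem u_top {j₀ : Fin (k + 1)} {j : Fin (k + 1)} (h : j ≠ j₀) : u j₀.1 (k - j₀.1) j = 0 := by
  have h' : j.1 ≠ j₀.1 := fun e => h (Fin.ext e)
  have : j.1.descFactorial j₀.1 = 0 ∨ (k - j.1).descFactorial (k - j₀.1) = 0 := by
    simp only [Nat.descFactorial_eq_zero_iff_lt]; omega
  rcases this with h | h <;> simp [u, h]

/-- The nonzero constant `u j (k - j) j`. -/
noncomputable def cu (j : Fin (k + 1)) : ℂ :=
  (((j.1 + 1) * (k + 1 - j.1) * (j.1.descFactorial j.1) * ((k - j.1).descFactorial (k - j.1)) : ℕ) : ℂ)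

theorem u_diag (j : Fin (k + 1)) : u j.1 (k - j.1) j = C (cu j) := by
  simp [u, cu]

theorem cu_ne_zero (j : Fin (k + 1)) : cu j ≠ 0 := by
  rw [cu, Nat.cast_ne_zero]
  have := j.2
  simp only [Nat.descFactorial_self]
  have h1 := Nat.factorial_pos j.1
  have h2 := Nat.factorial_pos (k - j.1)
  have h3 : 0 < k + 1 - j.1 := by omega
  positivity

theorem zhom_u (i l : ℕ) (j : Fin (k + 1)) : ZHom (sw k) (u i l j) (k - i - l) := by
  by_cases h : i ≤ j.1 ∧ l ≤ k - j.1
  · have := (zhom_mono (k := k) (j.1 - i) (k - j.1 - l)).C_mul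
      (((j.1 + 1) * (k + 1 - j.1) * (j.1.descFactorial i) * ((k - j.1).descFactorial l) : ℕ) : ℂ)
    have e : ((j.1 - i : ℕ) : ℤ) + ((k - j.1 - l : ℕ) : ℤ) = k - i - l := by omega
    rwa [e] at this
  · have : j.1.descFactorial i = 0 ∨ (k - j.1).descFactorial l = 0 := by
      simp only [Nat.descFactorial_eq_zero_iff_lt]; omega
    have : u i l j = 0 := by rcases this with h | h <;> simp [u, h]
    rw [this]; exact ZHom.zero

theorem Lb_LY (j : Fin (k + 1)) :
    Lb (C ((j.1 : ℂ) + 1) * (Z ^ j.1 * Wv ^ (k + 1 - j.1)) : SR k) = u 0 0 j := by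
  rw [Derivation.leibniz, Lb_C, Lb_mono, smul_zero, add_zero, smul_eq_mul, ← mul_assoc, ← C_mul, u]
  have : k + 1 - j.1 - 1 = k - j.1 := by omega
  simp [this]

theorem Lb_L_sub (p : SR k) : Lb (L p) - L (Lb p) = ∑ j, u 0 0 j * pderiv (Sum.inr j) p := by
  rw [L_apply, L_apply, map_add, map_sum, Lb_pderiv, add_sub_add_left_eq_sub,
    ← Finset.sum_sub_distrib]
  refine Finset.sum_congr rfl fun j _ => ?_
  rw [Derivation.leibniz, Lb_LY, Lb_pderiv, smul_eq_mul, smul_eq_mul]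
  ring

theorem u_pderiv_eq_zero {p : SR k} (h1 : L p = 0) (h2 : Lb p = 0) (i l : ℕ) :
    ∑ j, u i l j * pderiv (Sum.inr j) p = 0 := by
  have hL : ∀ j, L (pderiv (Sum.inr j) p) = 0 := fun j => by rw [L_pderiv_Y, h1, map_zero]
  have hLb : ∀ j, Lb (pderiv (Sum.inr j) p) = 0 := fun j => by rw [Lb_pderiv, h2, map_zero]
  induction i with
  | zero =>
    induction l with
    | zero => rw [← Lb_L_sub, h1, h2, map_zero, map_zero, sub_zero]
    | succ l ih =>
      have := congrArg Lb ih
      simpa [Derivation.leibniz, hLb, Lb_u, mul_comm] using this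
  | succ i ih =>
    have := congrArg L ih
    simpa [Derivation.leibniz, hL, L_u, mul_comm] using this

theorem pderiv_Y_eq_zero {p : SR k} (h1 : L p = 0) (h2 : Lb p = 0) (j : Fin (k + 1)) :
    pderiv (Sum.inr j) p = 0 := by
  have := u_pderiv_eq_zero h1 h2 j.1 (k - j.1)
  rw [Finset.sum_eq_single j (fun b _ hb => by rw [u_top hb, zero_mul]) (by simp), u_diag] at this
  exact (mul_eq_zero.1 this).resolve_left (by simpa using cu_ne_zero j)

theorem eq_zero_of_L {p : SR k} {n : ℤ} (hp : ZHom (sw k) p n) (hn : n ≠ 0) (h1 : L p = 0)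
    (h2 : Lb p = 0) : p = 0 := by
  refine hp.eq_zero_of_pderiv hn ?_
  have hY := pderiv_Y_eq_zero h1 h2
  rintro (i | j)
  · fin_cases i
    · have := L_apply p
      simp only [hY, mul_zero, Finset.sum_const_zero, add_zero, h1] at this
      exact this.symm
    · exact h2
  · exact hY j

/-- Words in the model fields. -/
noncomputable def word (v : List Bool) (p : SR k) : SR k :=
  v.foldr (fun b g => if b then L g else Lb g) p

theorem eq_zero_of_word (n : ℕ) {p : SR k} (hp : ZHom (sw k) p n)
    (h : ∀ v : List Bool, v.length = n → constantCoeff (word v p) = 0) : p = 0 := by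
  induction n generalizing p with
  | zero =>
    rw [hp.eq_C (by rintro (i | i) <;> simp [sw])]
    have := h [] rfl
    simp only [word, List.foldr_nil] at this
    rw [this, C_0]
  | succ n ih =>
    have e : (((n + 1 : ℕ) : ℤ) - 1) = n := by push_cast; ring
    have hw : ∀ (v : List Bool) (b : Bool), word (v ++ [b]) p = word v (if b then L p else Lb p) := by
      intro v b; simp [word]
    refine eq_zero_of_L hp (by omega) (ih (e ▸ zhom_L hp) fun v hv => ?_)
      (ih (e ▸ zhom_Lb hp) fun v hv => ?_)
    · have := h (v ++ [true]) (by simp [hv])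
      rwa [hw] at this
    · have := h (v ++ [false]) (by simp [hv])
      rwa [hw] at this

end Model

namespace Model

open MvPolynomial

theorem intertwine {σ B : Type*} [CommRing B] [Algebra ℂ B] (φ : MvPolynomial σ ℂ →+* B)
    (D₁ : Derivation ℂ (MvPolynomial σ ℂ) (MvPolynomial σ ℂ)) (D₂ : Derivation ℂ B B)
    (hC : ∀ c, D₂ (φ (C c)) = 0) (hX : ∀ i, D₂ (φ (X i)) = φ (D₁ (X i))) (p : MvPolynomial σ ℂ) :
    D₂ (φ p) = φ (D₁ p) := by
  induction p using MvPolynomial.induction_on with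
  | C c => simp [hC]
  | add p q hp hq => simp only [map_add, hp, hq]
  | mul_X p i hp =>
    simp only [map_mul, Derivation.leibniz, hp, hX, smul_eq_mul, map_add]

theorem zhom_map {σ τ : Type*} {w : σ → ℕ} {w' : τ → ℕ}
    (φ : MvPolynomial σ ℂ →+* MvPolynomial τ ℂ) (hC : ∀ c, ∃ c', φ (C c) = C c')
    (hX : ∀ i, ZHom w' (φ (X i)) (w i)) {P : MvPolynomial σ ℂ} {n : ℤ} (hP : ZHom w P n) :
    ZHom w' (φ P) n := by
  rw [P.as_sum, map_sum]
  refine ZHom.sum fun d hd => ?_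
  have h1 := hP (mem_support_iff.1 hd)
  rw [monomial_eq, map_mul, Finsupp.prod, map_prod]
  obtain ⟨c', hc'⟩ := hC (coeff d P)
  rw [hc']
  refine ZHom.C_mul _ ?_
  have h2 : ∀ s : Finset σ, ZHom w' (∏ x ∈ s, φ (X x ^ d x)) (∑ x ∈ s, (d x : ℤ) * w x) := by
    classical
    intro s
    induction s using Finset.induction_on with
    | empty => simpa using ZHom.C (w := w') 1
    | insert x s hx ih =>
      rw [Finset.prod_insert hx, Finset.sum_insert hx, map_pow]
      exact ((hX x).pow _).mul ih
  convert h2 d.support using 1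
  rw [← h1, Finsupp.weight_apply, Finsupp.sum]
  simp

variable {k : ℕ}

/-- Complex conjugation of polynomials in `z₁, z₂` and their conjugates. -/
noncomputable def starR : R2 →+* R2 := eval₂Hom (C.comp (starRingEnd ℂ)) fun d => X d.swap

/-- The conjugation of the model coordinates. -/
noncomputable def starS : SR k →+* SR k :=
  eval₂Hom (C.comp (starRingEnd ℂ))
    (Sum.elim ![Wv, Z] fun j => q (Fin.rev j) - Y (Fin.rev j))

@[simp] theorem starR_C (c : ℂ) : starR (C c) = C (starRingEnd ℂ c) := by simp [starR]
@[simp] theorem starR_X (d : Fin 2 ⊕ Fin 2) : starR (X d) = X d.swap := by simp [starR]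
@[simp] theorem starS_C (c : ℂ) : starS (C c : SR k) = C (starRingEnd ℂ c) := by simp [starS]
@[simp] theorem starS_Z : starS (Z : SR k) = Wv := by simp [starS, Z]
@[simp] theorem starS_Wv : starS (Wv : SR k) = Z := by simp [starS, Wv]
@[simp] theorem starS_Y (j : Fin (k + 1)) : starS (Y j) = q (Fin.rev j) - Y (Fin.rev j) := by
  simp [starS, Y]

theorem zhom_starS {p : SR k} {n : ℤ} (hp : ZHom (sw k) p n) : ZHom (sw k) (starS p) n := by
  refine zhom_map starS (fun c => ⟨_, starS_C c⟩) ?_ hp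
  rintro (i | j)
  · fin_cases i
    · simpa [sw, Z] using (by rw [starS_Z]; exact zhom_Wv : ZHom (sw k) (starS Z) 1)
    · simpa [sw, Wv] using (by rw [starS_Wv]; exact zhom_Z : ZHom (sw k) (starS Wv) 1)
  · have : ZHom (sw k) (starS (Y j)) (k + 2) := by
      rw [starS_Y]; exact (zhom_q _).sub (zhom_Y _)
    simpa [sw, Y] using this

theorem zhom_starR {p : R2} {n : ℤ} (hp : ZHom (w2 k) p n) : ZHom (w2 k) (starR p) n := by
  refine zhom_map starR (fun c => ⟨_, starR_C c⟩) ?_ hp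
  rintro (i | i)
  · rw [starR_X]; exact ZHom.X (w := w2 k) (Sum.inr i)
  · rw [starR_X]; exact ZHom.X (w := w2 k) (Sum.inl i)

theorem L_q (j : Fin (k + 1)) : L (q j) = C ((j.1 : ℂ) + 1) * (Z ^ j.1 * Wv ^ (k + 1 - j.1)) := by
  rw [q, L_mono]; simp

theorem Lb_q (j : Fin (k + 1)) :
    Lb (q j) = C ((k : ℂ) + 1 - j.1) * (Z ^ (j.1 + 1) * Wv ^ (k - j.1)) := by
  rw [q, Lb_mono]
  have : ((k + 1 - j.1 : ℕ) : ℂ) = (k : ℂ) + 1 - j.1 := by rw [Nat.cast_sub (by omega)]; simp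
  rw [this]
  congr 3
  omega

theorem Lb_starS_Y (j : Fin (k + 1)) :
    Lb (starS (Y j)) = C ((j.1 : ℂ) + 1) * (Wv ^ j.1 * Z ^ (k + 1 - j.1)) := by
  rw [starS_Y, map_sub, Lb_Y, sub_zero, Lb_q, Fin.val_rev]
  have h1 : ((k + 1 - (j.1 + 1) : ℕ) : ℂ) = (k : ℂ) - j.1 := by
    rw [Nat.cast_sub (by omega)]; push_cast; ring
  have h2 : k - (k + 1 - (j.1 + 1)) = j.1 := by omega
  have h3 : k + 1 - (j.1 + 1) + 1 = k + 1 - j.1 := by omega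
  rw [h1, h2, h3]
  congr 1
  · congr 1; ring
  · ring

theorem L_starS_Y (j : Fin (k + 1)) : L (starS (Y j)) = 0 := by
  rw [starS_Y, map_sub, L_q, L_Y, sub_self]

theorem starS_L (p : SR k) : starS (L p) = Lb (starS p) := by
  refine (intertwine starS L Lb (fun c => by rw [starS_C, Lb_C]) ?_ p).symm
  rintro (i | j)
  · fin_cases i
    · change Lb (starS Z) = starS (L Z); simp
    · change Lb (starS Wv) = starS (L Wv); simp
  · change Lb (starS (Y j)) = starS (L (Y j))
    rw [Lb_starS_Y, L_Y]; simp

theorem starS_Lb (p : SR k) : starS (Lb p) = L (starS p) := by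
  refine (intertwine starS Lb L (fun c => by rw [starS_C, L_C]) ?_ p).symm
  rintro (i | j)
  · fin_cases i
    · change L (starS Z) = starS (Lb Z); simp
    · change L (starS Wv) = starS (Lb Wv); simp
  · change L (starS (Y j)) = starS (Lb (Y j))
    rw [L_starS_Y, Lb_Y, map_zero]

variable (b : Fin (k + 1) → ℂ)

/-- The leading part of the second coefficient of the vector field. -/
noncomputable def A0 : R2 :=
  ∑ j : Fin (k + 1), C (b j * (j.1 + 1)) * (X (Sum.inl 0) ^ j.1 * X (Sum.inr 0) ^ (k + 1 - j.1))

/-- The leading part of the field `L`. -/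
noncomputable def L0 : Derivation ℂ R2 R2 := pderiv (Sum.inl 0) + A0 b • pderiv (Sum.inl 1)

/-- The leading part of the field `L̄`. -/
noncomputable def Lb0 : Derivation ℂ R2 R2 := pderiv (Sum.inr 0) + starR (A0 b) • pderiv (Sum.inr 1)

theorem L0_apply (p : R2) : L0 b p = pderiv (Sum.inl 0) p + A0 b * pderiv (Sum.inl 1) p := rfl
theorem Lb0_apply (p : R2) :
    Lb0 b p = pderiv (Sum.inr 0) p + starR (A0 b) * pderiv (Sum.inr 1) p := rfl

/-- The image of `z₂` in the model coordinates. -/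
noncomputable def Yb : SR k := ∑ j, C (b j) * Y j

/-- Passage to the model coordinates. -/
noncomputable def toS : R2 →ₐ[ℂ] SR k := aeval (Sum.elim ![Z, Yb b] ![Wv, starS (Yb b)])

@[simp] theorem toS_X00 : toS b (X (Sum.inl 0)) = Z := by simp [toS]
@[simp] theorem toS_X01 : toS b (X (Sum.inl 1)) = Yb b := by simp [toS]
@[simp] theorem toS_X10 : toS b (X (Sum.inr 0)) = Wv := by simp [toS]
@[simp] theorem toS_X11 : toS b (X (Sum.inr 1)) = starS (Yb b) := by simp [toS]
@[simp] theorem toS_C (c : ℂ) : toS b (C c) = C c := by simp [toS]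

theorem zhom_Yb : ZHom (sw k) (Yb b) (k + 2) := ZHom.sum fun j _ => (zhom_Y j).C_mul _

theorem zhom_toS {p : R2} {n : ℤ} (hp : ZHom (w2 k) p n) : ZHom (sw k) (toS b p) n := by
  refine zhom_map (toS b : R2 →+* SR k) (fun c => ⟨c, toS_C b c⟩) ?_ hp
  rintro (i | i) <;> fin_cases i
  · change ZHom (sw k) (toS b (X (Sum.inl 0))) _
    rw [toS_X00]; exact zhom_Z
  · change ZHom (sw k) (toS b (X (Sum.inl 1))) _
    rw [toS_X01]; simpa [w2] using zhom_Yb b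
  · change ZHom (sw k) (toS b (X (Sum.inr 0))) _
    rw [toS_X10]; exact zhom_Wv
  · change ZHom (sw k) (toS b (X (Sum.inr 1))) _
    rw [toS_X11]; simpa [w2] using zhom_starS (zhom_Yb b)

theorem toS_A0 :
    toS b (A0 b) = ∑ j, C (b j) * (C ((j.1 : ℂ) + 1) * (Z ^ j.1 * Wv ^ (k + 1 - j.1))) := by
  simp only [A0, map_sum, map_mul, map_pow, toS_X00, toS_X10, toS_C, mul_assoc]

theorem toS_starR (p : R2) : toS b (starR p) = starS (toS b p) := by
  have hss : ∀ j, starS (starS (Y j : SR k)) = Y j := by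
    intro j
    rw [starS_Y, map_sub, starS_Y, Fin.rev_rev, q]
    simp only [map_mul, map_pow, starS_Z, starS_Wv, q, Fin.val_rev]
    have h1 : k + 1 - (j.1 + 1) + 1 = k + 1 - j.1 := by omega
    have h2 : k + 1 - (k + 1 - (j.1 + 1)) = j.1 + 1 := by omega
    rw [h1, h2]; ring
  have : (toS b : R2 →+* SR k).comp starR = starS.comp (toS b : R2 →+* SR k) := by
    refine MvPolynomial.ringHom_ext (fun c => by simp) ?_
    rintro (i | i) <;> fin_cases i
    · simp
    · simp
    · simp
    · change toS b (starR (X (Sum.inr 1))) = starS (toS b (X (Sum.inr 1)))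
      simp only [starR_X, Sum.swap_inr, toS_X01, toS_X11, Yb, map_sum, map_mul, starS_C, hss,
        RingHomCompTriple.comp_apply, RingHom.id_apply]
  exact congrArg (fun f => f p) this

theorem L_toS (p : R2) : L (toS b p) = toS b (L0 b p) := by
  refine intertwine (toS b : R2 →+* SR k) (L0 b) L (fun c => ?_) ?_ p
  · change L (toS b (C c)) = 0
    rw [toS_C, L_C]
  rintro (i | i) <;> fin_cases i
  · change L (toS b (X (Sum.inl 0))) = toS b (L0 b (X (Sum.inl 0)))
    simp [L0_apply, pderiv_X]
  · change L (toS b (X (Sum.inl 1))) = toS b (L0 b (X (Sum.inl 1)))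
    simp [L0_apply, pderiv_X, toS_A0, Yb, Derivation.leibniz]
  · change L (toS b (X (Sum.inr 0))) = toS b (L0 b (X (Sum.inr 0)))
    simp [L0_apply, pderiv_X]
  · change L (toS b (X (Sum.inr 1))) = toS b (L0 b (X (Sum.inr 1)))
    rw [toS_X11, ← starS_Lb]
    simp [L0_apply, pderiv_X, Yb, Derivation.leibniz]

theorem starR_pderiv (i : Fin 2) (p : R2) :
    starR (pderiv (Sum.inl i) p) = pderiv (Sum.inr i) (starR p) := by
  refine (intertwine starR _ _ (fun c => by simp) (fun s => ?_) p).symm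
  rw [starR_X, pderiv_X, pderiv_X, Pi.single_apply, Pi.single_apply]
  rcases s with s | s
  · simp only [Sum.swap_inl, Sum.inr.injEq, Sum.inl.injEq]
    split_ifs <;> simp
  · simp

theorem starR_L0 (p : R2) : starR (L0 b p) = Lb0 b (starR p) := by
  rw [L0_apply, map_add, map_mul, starR_pderiv, starR_pderiv, Lb0_apply]

theorem starR_starR (p : R2) : starR (starR p) = p := by
  have : starR.comp starR = RingHom.id R2 := by
    refine MvPolynomial.ringHom_ext (fun c => by simp) fun i => by simp
  exact congrArg (fun f => f p) this

theorem Lb_toS (p : R2) : Lb (toS b p) = toS b (Lb0 b p) := by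
  rw [← starR_starR p, toS_starR, ← starS_L, L_toS, ← toS_starR, starR_L0]

theorem pderiv_toS (j : Fin (k + 1)) (p : R2) : pderiv (Sum.inr j) (toS b p)
    = C (b j) * toS b (pderiv (Sum.inl 1) p)
      - C (starRingEnd ℂ (b (Fin.rev j))) * toS b (pderiv (Sum.inr 1) p) := by
  have hY : ∀ i : Fin (k + 1), pderiv (Sum.inr j) (Y i : SR k) = if j = i then 1 else 0 := by
    intro i; rw [Y, pderiv_X, Pi.single_apply]; simp [eq_comm]
  have h := derivation_aeval (pderiv (Sum.inr j)) (Sum.elim ![Z, Yb b] ![Wv, starS (Yb b)]) p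
  rw [toS, h]
  simp only [Fintype.sum_sum_type, Fin.sum_univ_two]
  have h1 : pderiv (Sum.inr j) (Z : SR k) = 0 := by simp [Z, pderiv_X]
  have h2 : pderiv (Sum.inr j) (Wv : SR k) = 0 := by simp [Wv, pderiv_X]
  have h3 : pderiv (Sum.inr j) (Yb b) = C (b j) := by
    simp [Yb, Derivation.leibniz, hY]
  have h4 : pderiv (Sum.inr j) (starS (Yb b)) = - C (starRingEnd ℂ (b (Fin.rev j))) := by
    have hq : ∀ i, pderiv (Sum.inr j) (q i : SR k) = 0 := by
      intro i; simp [q, Derivation.leibniz, Derivation.leibniz_pow, h1, h2]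
    have e : ∀ i : Fin (k + 1), (j = Fin.rev i) ↔ (i = Fin.rev j) := fun i =>
      ⟨fun h => by rw [h, Fin.rev_rev], fun h => by rw [h, Fin.rev_rev]⟩
    simp only [Yb, map_sum, map_mul, starS_C, starS_Y, Derivation.leibniz, map_sub, hq, hY, e,
      pderiv_C, add_zero, zero_sub, smul_eq_mul, mul_neg, Finset.sum_neg_distrib,
      mul_ite, mul_one, mul_zero, Finset.sum_ite_eq', Finset.mem_univ, if_true]
  simp [h1, h2, h3, h4]
  ring

end Model

namespace Model

open MvPolynomial

variable {k : ℕ}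

/-- The `∂/∂Y_j` coefficients of the bracket indexed by a word. -/
noncomputable def uw (v : List Bool) (j : Fin (k + 1)) : SR k := u (v.count true) (v.count false) j

/-- The pairing of the bracket indexed by a word with the model contact form. -/
noncomputable def psi (a : SR k) : List Bool → SR k
  | [] => Lb a
  | true :: v => L (psi a v) - ∑ j, uw v j * pderiv (Sum.inr j) a
  | false :: v => Lb (psi a v)

theorem L_uw (v : List Bool) (j : Fin (k + 1)) : L (uw v j) = uw (true :: v) j := by
  simp [uw, L_u]

theorem Lb_uw (v : List Bool) (j : Fin (k + 1)) : Lb (uw v j) = uw (false :: v) j := by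
  simp [uw, Lb_u]

theorem zhom_uw (v : List Bool) (j : Fin (k + 1)) : ZHom (sw k) (uw v j) (k - v.length) := by
  have := zhom_u (v.count true) (v.count false) j
  have e : (k : ℤ) - v.count true - v.count false = k - v.length := by
    have := List.count_true_add_count_false v
    omega
  rwa [e] at this

theorem uw_eq_zero {v : List Bool} (h : k < v.length) (j : Fin (k + 1)) : uw v j = 0 :=
  u_eq_zero (by have := List.count_true_add_count_false v; omega) j

theorem zhom_psi {a : SR k} {W : ℕ} (ha : ZHom (sw k) a (W - 1)) (v : List Bool) :
    ZHom (sw k) (psi a v) (W - 2 - v.length) := by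
  induction v with
  | nil => have := zhom_Lb ha; simpa [psi, sub_sub] using this
  | cons b v ih =>
    have e : (W : ℤ) - 2 - (b :: v).length = W - 2 - v.length - 1 := by simp; ring
    rw [e]
    cases b
    · exact zhom_Lb ih
    · refine (zhom_L ih).sub (ZHom.sum fun j _ => ?_)
      refine (zhom_uw v j).mul' (ha.pderiv _) ?_
      simp [sw]; ring

/-- The word whose bracket is a multiple of `∂/∂Y_j`. -/
def topWord (j : Fin (k + 1)) : List Bool := List.replicate j.1 true ++ List.replicate (k - j.1) false

theorem length_topWord (j : Fin (k + 1)) : (topWord j).length = k := by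
  simp [topWord]; omega

theorem uw_topWord (i j : Fin (k + 1)) : uw (topWord i) j = if j = i then C (cu i) else 0 := by
  have h : uw (topWord i) j = u i.1 (k - i.1) j := by
    simp [uw, topWord, List.count_replicate]
  rw [h]
  split_ifs with e
  · rw [e, u_diag]
  · exact u_top e

/-- The coefficient functions `h_j` of the commutator solution. -/
noncomputable def hj (a : SR k) (j : Fin (k + 1)) : SR k := C (cu j)⁻¹ * psi a (topWord j)

theorem zhom_hj {a : SR k} {W : ℕ} (ha : ZHom (sw k) a (W - 1)) (j : Fin (k + 1)) : ZHom (sw k) (hj a j) (W - 2 - k) := by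
  have := (zhom_psi ha (topWord j)).C_mul (cu j)⁻¹
  rwa [length_topWord] at this

theorem u_zero (j : Fin (k + 1)) :
    u 0 0 j = C ((j.1 : ℂ) + 1) * C ((k : ℂ) + 1 - j.1) * (Z ^ j.1 * Wv ^ (k - j.1)) := by
  rw [u, ← C_mul]
  simp only [Nat.descFactorial_zero, mul_one, Nat.sub_zero, Nat.cast_mul]
  rw [Nat.cast_sub (by omega)]
  push_cast; rfl

theorem Lb_factor_mul (j : Fin (k + 1)) (h : SR k) :
    Lb ((C ((k : ℂ) + 2) * Y j - C ((j.1 : ℂ) + 1) * q j) * h)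
      = (C ((k : ℂ) + 2) * Y j - C ((j.1 : ℂ) + 1) * q j) * Lb h
        - Z * (C ((j.1 : ℂ) + 1) * C ((k : ℂ) + 1 - j.1) * (Z ^ j.1 * Wv ^ (k - j.1))) * h := by
  have : Lb (C ((k : ℂ) + 2) * Y j - C ((j.1 : ℂ) + 1) * q j)
      = - (C ((j.1 : ℂ) + 1) * (C ((k : ℂ) + 1 - j.1) * (Z ^ (j.1 + 1) * Wv ^ (k - j.1)))) := by
    rw [map_sub, Derivation.leibniz, Derivation.leibniz, Lb_C, Lb_C, Lb_Y, Lb_q]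
    simp only [smul_eq_mul]; ring
  rw [Derivation.leibniz, this, smul_eq_mul, smul_eq_mul]
  ring

theorem L_factor_mul (j : Fin (k + 1)) (h : SR k) :
    L ((C ((k : ℂ) + 2) * Y j - C ((j.1 : ℂ) + 1) * q j) * h)
      = (C ((k : ℂ) + 2) * Y j - C ((j.1 : ℂ) + 1) * q j) * L h + Wv * u 0 0 j * h := by
  have h1 : k + 1 - j.1 = (k - j.1) + 1 := by omega
  have h2 : (C ((k : ℂ) + 1 - j.1) : SR k) = C ((k : ℂ) + 2) - C ((j.1 : ℂ) + 1) := by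
    rw [← C_sub]; congr 1; ring
  have : L (C ((k : ℂ) + 2) * Y j - C ((j.1 : ℂ) + 1) * q j) = Wv * u 0 0 j := by
    rw [map_sub, Derivation.leibniz, Derivation.leibniz, L_C, L_C, L_Y, L_q, u_zero, h1, h2]
    simp only [smul_eq_mul]
    ring
  rw [Derivation.leibniz, this, smul_eq_mul, smul_eq_mul]
  ring

section

variable {a : SR k} {W : ℕ}

theorem psi_eq_zero (ha : ZHom (sw k) a (W - 1))
    (hψ : ∀ v : List Bool, v.length + 2 = W → constantCoeff (psi a v) = 0)
    {v : List Bool} (hv : k < v.length) : psi a v = 0 := by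
  by_cases h : v.length + 2 ≤ W
  · obtain ⟨n, hn⟩ : ∃ n : ℕ, n + v.length + 2 = W := ⟨W - 2 - v.length, by omega⟩
    have h1 : ∀ v' : List Bool, psi a (v' ++ v) = word v' (psi a v) := by
      intro v'
      induction v' with
      | nil => rfl
      | cons b v' ih =>
        cases b
        · change Lb (psi a (v' ++ v)) = _
          rw [ih]; rfl
        · change L (psi a (v' ++ v)) - ∑ j, uw (v' ++ v) j * pderiv (Sum.inr j) a = _
          rw [ih, Finset.sum_eq_zero fun j _ => by
            rw [uw_eq_zero (by simp; omega), zero_mul], sub_zero]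
          rfl
    refine eq_zero_of_word n ?_ fun v' hv' => ?_
    · have := zhom_psi ha v
      have e : (W : ℤ) - 2 - v.length = n := by omega
      rwa [e] at this
    · rw [← h1]
      exact hψ _ (by simp; omega)
  · exact (zhom_psi ha v).eq_zero_of_neg (by omega)

theorem L_hj (ha : ZHom (sw k) a (W - 1))
    (hψ : ∀ v : List Bool, v.length + 2 = W → constantCoeff (psi a v) = 0)
    (j : Fin (k + 1)) : L (hj a j) = pderiv (Sum.inr j) a := by
  have h := psi_eq_zero ha hψ (v := true :: topWord j) (by simp [length_topWord])
  simp only [psi, uw_topWord, ite_mul, zero_mul, Finset.sum_ite_eq', Finset.mem_univ, if_true] at h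
  rw [hj, Derivation.leibniz, L_C, smul_zero, add_zero, smul_eq_mul, sub_eq_zero.1 h, ← mul_assoc,
    ← C_mul, inv_mul_cancel₀ (cu_ne_zero j), C_1, one_mul]

theorem Lb_hj (ha : ZHom (sw k) a (W - 1))
    (hψ : ∀ v : List Bool, v.length + 2 = W → constantCoeff (psi a v) = 0)
    (j : Fin (k + 1)) : Lb (hj a j) = 0 := by
  have h := psi_eq_zero ha hψ (v := false :: topWord j) (by simp [length_topWord])
  simp only [psi] at h
  rw [hj, Derivation.leibniz, Lb_C, smul_zero, add_zero, smul_eq_mul, h, mul_zero]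

theorem psi_eq_sum (ha : ZHom (sw k) a (W - 1))
    (hψ : ∀ v : List Bool, v.length + 2 = W → constantCoeff (psi a v) = 0)
    (hW : k + 2 ≤ W) (n : ℕ) : ∀ v : List Bool, v.length + n = k + 1 →
    psi a v = ∑ j, uw v j * hj a j := by
  induction n with
  | zero =>
    intro v hv
    rw [psi_eq_zero ha hψ (by omega)]
    exact (Finset.sum_eq_zero fun j _ => by rw [uw_eq_zero (by omega), zero_mul]).symm
  | succ n ih =>
    intro v hv
    rw [← sub_eq_zero]
    have hz : ZHom (sw k) (psi a v - ∑ j, uw v j * hj a j) (W - 2 - v.length) := by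
      refine (zhom_psi ha v).sub (ZHom.sum fun j _ => ?_)
      exact (zhom_uw v j).mul' (zhom_hj ha j) (by ring)
    by_cases h0 : v.length + 2 = W
    · have e : (W : ℤ) - 2 - v.length = 0 := by omega
      rw [e] at hz
      rw [hz.eq_C (by rintro (i | i) <;> simp [sw]), map_sub, hψ v h0, map_sum,
        Finset.sum_eq_zero, sub_zero, C_0]
      intro j _
      rw [map_mul, hj, map_mul, hψ (topWord j) (by rw [length_topWord]; omega), mul_zero, mul_zero]
    refine eq_zero_of_L hz (by omega) ?_ ?_
    · have h1 := ih (true :: v) (by simp; omega)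
      simp only [psi] at h1
      rw [map_sub, sub_eq_iff_eq_add.1 h1, map_sum]
      simp only [Derivation.leibniz, smul_eq_mul, L_uw, L_hj ha hψ, Finset.sum_add_distrib]
      simp only [mul_comm]
      ring
    · have h1 := ih (false :: v) (by simp; omega)
      simp only [psi] at h1
      rw [map_sub, h1, map_sum]
      simp only [Derivation.leibniz, smul_eq_mul, Lb_uw, Lb_hj ha hψ, mul_zero, zero_add]
      simp only [mul_comm, sub_self]

/-- The holomorphic solution, up to a factor. -/
noncomputable def Qsol (a : SR k) : SR k :=
  Z * a + ∑ j, (C ((k : ℂ) + 2) * Y j - C ((j.1 : ℂ) + 1) * q j) * hj a j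

theorem Lb_Qsol (ha : ZHom (sw k) a (W - 1))
    (hψ : ∀ v : List Bool, v.length + 2 = W → constantCoeff (psi a v) = 0)
    (hW : k + 2 ≤ W) : Lb (Qsol a) = 0 := by
  have hLba : Lb a = ∑ j, u 0 0 j * hj a j := by
    have := psi_eq_sum ha hψ hW (k + 1) [] (by simp)
    simpa [psi, uw] using this
  rw [Qsol, map_add, map_sum, Derivation.leibniz, Lb_Z, hLba, smul_zero, add_zero, smul_eq_mul,
    Finset.mul_sum, ← Finset.sum_add_distrib]
  refine Finset.sum_eq_zero fun j _ => ?_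
  rw [Lb_factor_mul, Lb_hj ha hψ, u_zero]
  ring

theorem L_Qsol (ha : ZHom (sw k) a (W - 1))
    (hψ : ∀ v : List Bool, v.length + 2 = W → constantCoeff (psi a v) = 0)
    (hW : k + 2 ≤ W) : L (Qsol a) = C (W : ℂ) * a := by
  have hLba : Lb a = ∑ j, u 0 0 j * hj a j := by
    have := psi_eq_sum ha hψ hW (k + 1) [] (by simp)
    simpa [psi, uw] using this
  have he := ha.euler
  simp only [Fintype.sum_sum_type, Fin.sum_univ_two, sw, Sum.elim_inl, Sum.elim_inr,
    MvPolynomial.smul_eq_C_mul] at he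
  push_cast at he
  have hw : Wv * pderiv (Sum.inl 1) a = ∑ j, Wv * (u 0 0 j * hj a j) := by
    rw [← Finset.mul_sum, ← hLba]; rfl
  have hsum : L (Qsol a) = a + Z * L a + ∑ j, ((C ((k : ℂ) + 2) * Y j - C ((j.1 : ℂ) + 1) * q j)
      * pderiv (Sum.inr j) a + Wv * (u 0 0 j * hj a j)) := by
    rw [Qsol, map_add, map_sum, Derivation.leibniz, L_Z, smul_eq_mul, smul_eq_mul, mul_one,
      add_comm (Z * L a)]
    congr 1
    refine Finset.sum_congr rfl fun j _ => ?_
    rw [L_factor_mul, L_hj ha hψ]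
    ring
  have h3 : Z * ∑ j : Fin (k + 1), C ((j.1 : ℂ) + 1) * (Z ^ j.1 * Wv ^ (k + 1 - j.1))
      * pderiv (Sum.inr j) a = ∑ j : Fin (k + 1), C ((j.1 : ℂ) + 1) * q j * pderiv (Sum.inr j) a := by
    rw [Finset.mul_sum]
    exact Finset.sum_congr rfl fun j _ => by rw [q]; ring
  have h4 : ∑ j : Fin (k + 1), (C ((k : ℂ) + 2) * Y j) * pderiv (Sum.inr j) a
      = ∑ x : Fin (k + 1), C ((k : ℂ) + 2) * (X (Sum.inr x) * pderiv (Sum.inr x) a) :=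
    Finset.sum_congr rfl fun j _ => by rw [Y, mul_assoc]
  rw [hsum, Finset.sum_add_distrib, ← hw, L_apply, mul_add, h3]
  simp only [sub_mul, Finset.sum_sub_distrib]
  rw [h4]
  simp only [C_1, one_mul, map_sub] at he
  change Z * _ + Wv * _ + _ = _ at he
  linear_combination he

theorem exists_of_psi (ha : ZHom (sw k) a (W - 1))
    (hψ : ∀ v : List Bool, v.length + 2 = W → constantCoeff (psi a v) = 0)
    (hW : k + 2 ≤ W) {F : SR k} (hF : ZHom (sw k) F W) (hs : starS F = F)
    (haF : a = C 2 * L F) :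
    ∃ P : SR k, ZHom (sw k) P W ∧ Lb P = 0 ∧ P + starS P = C 2 * F := by
  have hW0 : (W : ℂ) ≠ 0 := by
    have : W ≠ 0 := by omega
    exact_mod_cast this
  have hzQ : ZHom (sw k) (Qsol a) W := by
    refine ZHom.add (zhom_Z.mul' ha (by ring)) (ZHom.sum fun j _ => ?_)
    exact (((zhom_Y j).C_mul _).sub ((zhom_q j).C_mul _)).mul' (zhom_hj ha j) (by ring)
  have hLbP : Lb (C (W : ℂ)⁻¹ * Qsol a) = 0 := by
    rw [Derivation.leibniz, Lb_C, Lb_Qsol ha hψ hW]; simp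
  have hLP : L (C (W : ℂ)⁻¹ * Qsol a) = a := by
    rw [Derivation.leibniz, L_C, L_Qsol ha hψ hW, smul_zero, add_zero, smul_eq_mul, ← mul_assoc,
      ← C_mul, inv_mul_cancel₀ hW0, C_1, one_mul]
  refine ⟨C (W : ℂ)⁻¹ * Qsol a, hzQ.C_mul _, hLbP, ?_⟩
  rw [← sub_eq_zero]
  refine eq_zero_of_L (n := W) ?_ (by omega) ?_ ?_
  · exact ((hzQ.C_mul _).add (zhom_starS (hzQ.C_mul _))).sub (hF.C_mul _)
  · rw [map_sub, map_add, hLP, ← starS_Lb, hLbP, map_zero, add_zero, Derivation.leibniz, L_C, haF]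
    simp
  · have h2 : starS (C 2 : SR k) = C 2 := by rw [starS_C, map_ofNat (starRingEnd ℂ) 2]
    rw [map_sub, map_add, hLbP, ← starS_L, hLP, haF, map_mul, starS_L, hs, h2,
      Derivation.leibniz, Lb_C]
    simp

end

end Model

namespace Model

open MvPolynomial

variable {k : ℕ} (b : Fin (k + 1) → ℂ)

/-- Words in the fields `L0, Lb0`. -/
noncomputable def word0 (v : List Bool) (p : R2) : R2 :=
  v.foldr (fun c g => if c then L0 b g else Lb0 b g) p

theorem toS_word0 (v : List Bool) (p : R2) : toS b (word0 b v p) = word v (toS b p) := by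
  induction v with
  | nil => rfl
  | cons c v ih =>
    cases c
    · change toS b (Lb0 b (word0 b v p)) = Lb (word v (toS b p))
      rw [← ih, Lb_toS]
    · change toS b (L0 b (word0 b v p)) = L (word v (toS b p))
      rw [← ih, L_toS]

theorem constantCoeff_q (j : Fin (k + 1)) : constantCoeff (q j) = 0 := by
  simp [q, Z, Wv]

theorem constantCoeff_toS (p : R2) : constantCoeff (toS b p) = constantCoeff p := by
  have h1 : constantCoeff (Yb b) = 0 := by simp [Yb, Y]
  have h2 : constantCoeff (starS (Yb b)) = 0 := by
    simp only [Yb, map_sum, map_mul, starS_Y, map_sub, constantCoeff_q]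
    simp [Y]
  have : (constantCoeff : SR k →+* ℂ).comp (toS b : R2 →+* SR k) = constantCoeff := by
    refine MvPolynomial.ringHom_ext (fun c => by simp) ?_
    rintro (i | i) <;> fin_cases i
    · simp [Z]
    · simp [h1]
    · simp [Wv]
    · simp [h2]
  exact congrArg (fun f => f p) this

/-- Leading part of the `∂/∂z₂` coefficient of the bracket indexed by a word. -/
noncomputable def mg1 (v : List Bool) : R2 := word0 b v (Lb0 b (A0 b))

/-- Leading part of the `∂/∂z̄₂` coefficient of the bracket indexed by a word. -/
noncomputable def mh1 (v : List Bool) : R2 := word0 b v (-(L0 b (starR (A0 b))))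

/-- Leading part of the `∂/∂z₃` coefficient of the bracket indexed by a word. -/
noncomputable def mg2 (c : R2) : List Bool → R2
  | [] => Lb0 b c
  | true :: v => L0 b (mg2 c v) - (mg1 b v * pderiv (Sum.inl 1) c + mh1 b v * pderiv (Sum.inr 1) c)
  | false :: v => Lb0 b (mg2 c v)

theorem word_sum (c : Fin (k + 1) → ℂ) (v : List Bool) :
    word v (∑ j, C (c j) * u 0 0 j) = ∑ j, C (c j) * uw v j := by
  induction v with
  | nil => rfl
  | cons e v ih =>
    cases e
    · change Lb (word v _) = _
      rw [ih, map_sum]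
      refine Finset.sum_congr rfl fun j _ => ?_
      rw [Derivation.leibniz, Lb_C, smul_zero, add_zero, smul_eq_mul, Lb_uw]
    · change L (word v _) = _
      rw [ih, map_sum]
      refine Finset.sum_congr rfl fun j _ => ?_
      rw [Derivation.leibniz, L_C, smul_zero, add_zero, smul_eq_mul, L_uw]

theorem toS_mg1 (v : List Bool) : toS b (mg1 b v) = ∑ j, C (b j) * uw v j := by
  rw [mg1, toS_word0, ← Lb_toS, toS_A0, map_sum, ← word_sum]
  congr 1
  refine Finset.sum_congr rfl fun j _ => ?_
  rw [Derivation.leibniz, Lb_C, smul_zero, add_zero, smul_eq_mul, Lb_LY]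

theorem starS_u (j : Fin (k + 1)) : starS (u 0 0 j : SR k) = u 0 0 (Fin.rev j) := by
  have h1 : k - (k + 1 - (j.1 + 1)) = j.1 := by omega
  have h2 : k + 1 - (j.1 + 1) = k - j.1 := by omega
  have h3 : (k : ℂ) + 1 - ((k : ℂ) - j.1) = j.1 + 1 := by ring
  rw [u_zero, u_zero, Fin.val_rev, h1, h2, Nat.cast_sub (by omega), h3]
  simp only [map_mul, starS_C, starS_Z, starS_Wv, map_pow, map_add, map_sub, map_one,
    Complex.conj_natCast]
  ring

theorem toS_mh1 (v : List Bool) :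
    toS b (mh1 b v) = - ∑ j, C (starRingEnd ℂ (b (Fin.rev j))) * uw v j := by
  have h0 : toS b (-(L0 b (starR (A0 b))))
      = ∑ j : Fin (k + 1), C (-starRingEnd ℂ (b (Fin.rev j))) * u 0 0 j := by
    rw [map_neg, ← L_toS, toS_starR, ← starS_Lb, toS_A0, map_sum, map_sum,
      ← Equiv.sum_comp Fin.revPerm, ← Finset.sum_neg_distrib]
    refine Finset.sum_congr rfl fun j _ => ?_
    rw [Derivation.leibniz, Lb_C, smul_zero, add_zero, smul_eq_mul, Lb_LY, map_mul, starS_u,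
      starS_C]
    simp
  rw [mh1, toS_word0, h0, word_sum, ← Finset.sum_neg_distrib]
  exact Finset.sum_congr rfl fun j _ => by simp

theorem toS_mg2 (c : R2) (v : List Bool) : toS b (mg2 b c v) = psi (toS b c) v := by
  induction v with
  | nil => exact (Lb_toS b c).symm
  | cons e v ih =>
    cases e
    · change toS b (Lb0 b (mg2 b c v)) = Lb _
      rw [← ih, Lb_toS]
    · change toS b (L0 b (mg2 b c v) - (mg1 b v * pderiv (Sum.inl 1) c
        + mh1 b v * pderiv (Sum.inr 1) c)) = L _ - _
      rw [map_sub, ← ih, L_toS, map_add, map_mul, map_mul, toS_mg1, toS_mh1]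
      congr 1
      rw [Finset.sum_mul, neg_mul, Finset.sum_mul, ← sub_eq_add_neg, ← Finset.sum_sub_distrib]
      refine Finset.sum_congr rfl fun j _ => ?_
      rw [pderiv_toS]; ring

theorem zhom_A0 : ZHom (w2 k) (A0 b) (k + 1) := by
  refine ZHom.sum fun j _ => ZHom.C_mul _ ?_
  refine ((ZHom.X (w := w2 k) (Sum.inl 0)).pow j.1).mul'
    ((ZHom.X (w := w2 k) (Sum.inr 0)).pow (k + 1 - j.1)) ?_
  simp [w2]

theorem zhom_L0 {p : R2} {n : ℤ} (hp : ZHom (w2 k) p n) : ZHom (w2 k) (L0 b p) (n - 1) := by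
  refine ZHom.add (by simpa [w2] using hp.pderiv (Sum.inl 0)) ?_
  exact (zhom_A0 b).mul' (hp.pderiv (Sum.inl 1)) (by simp [w2]; ring)

/-- A real weighted homogeneous polynomial whose commutator invariants vanish is the real part of a
holomorphic polynomial in the model coordinates. -/
theorem exists_of_commutator {W : ℕ} (hW : k + 2 ≤ W) {F : R2} (hF : ZHom (w2 k) F W)
    (hs : starR F = F)
    (h : ∀ v : List Bool, v.length + 2 = W → constantCoeff (mg2 b (C 2 * L0 b F) v) = 0) :
    ∃ P : SR k, ZHom (sw k) P W ∧ Lb P = 0 ∧ P + starS P = C 2 * toS b F := by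
  refine exists_of_psi (a := toS b (C 2 * L0 b F)) ?_ ?_ hW (zhom_toS b hF) ?_ ?_
  · exact zhom_toS b ((zhom_L0 b hF).C_mul 2)
  · intro v hv
    rw [← toS_mg2, constantCoeff_toS, h v hv]
  · rw [← toS_starR, hs]
  · rw [map_mul, toS_C, L_toS]

/-- The totally real model manifold. -/
def Nhat (k : ℕ) : Set (Fin 2 ⊕ Fin (k + 1) → ℂ) :=
  {x | x (Sum.inl 1) = starRingEnd ℂ (x (Sum.inl 0)) ∧ ∀ j, x (Sum.inr j)
    + starRingEnd ℂ (x (Sum.inr (Fin.rev j)))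
      = x (Sum.inl 0) ^ (j.1 + 1) * starRingEnd ℂ (x (Sum.inl 0)) ^ (k + 1 - j.1)}

/-- Evaluation of a polynomial in `z₁, z₂, z̄₁, z̄₂`. -/
noncomputable def evR (y : Fin 2 → ℂ) : R2 →+* ℂ :=
  eval (Sum.elim y fun i => starRingEnd ℂ (y i))

theorem eval_starS {x : Fin 2 ⊕ Fin (k + 1) → ℂ} (hx : x ∈ Nhat k) (p : SR k) :
    eval x (starS p) = starRingEnd ℂ (eval x p) := by
  have : (eval x).comp (starS : SR k →+* SR k) = (starRingEnd ℂ).comp (eval x) := by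
    refine MvPolynomial.ringHom_ext (fun c => by simp) ?_
    rintro (i | j)
    · fin_cases i
      · change eval x (starS Z) = starRingEnd ℂ (eval x (X (Sum.inl 0)))
        simp [Wv, hx.1]
      · change eval x (starS Wv) = starRingEnd ℂ (eval x (X (Sum.inl 1)))
        simp [Z, hx.1]
    · change eval x (starS (Y j)) = starRingEnd ℂ (eval x (X (Sum.inr j)))
      rw [starS_Y]
      have := hx.2 (Fin.rev j)
      rw [Fin.rev_rev] at this
      simp only [q, Z, Wv, Y, map_sub, map_mul, map_pow, eval_X, hx.1]
      rw [← this]; ring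
  exact congrArg (fun f => f p) this

theorem eval_toS {x : Fin 2 ⊕ Fin (k + 1) → ℂ} (hx : x ∈ Nhat k) (p : R2) :
    eval x (toS b p) = evR ![x (Sum.inl 0), ∑ j, b j * x (Sum.inr j)] p := by
  have h1 : eval x (Yb b) = ∑ j, b j * x (Sum.inr j) := by simp [Yb, Y]
  have : (eval x).comp (toS b : R2 →+* SR k) = evR ![x (Sum.inl 0), ∑ j, b j * x (Sum.inr j)] := by
    refine MvPolynomial.ringHom_ext (fun c => by simp [evR]) ?_
    rintro (i | i) <;> fin_cases i
    · simp [Z, evR]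
    · simp [h1, evR]
    · simp [Wv, evR, hx.1]
    · simp only [evR, RingHom.comp_apply, eval_X]
      change eval x (toS b (X (Sum.inr 1))) = starRingEnd ℂ (∑ j, b j * x (Sum.inr j))
      rw [toS_X11, eval_starS hx, h1]
  exact congrArg (fun f => f p) this

theorem eq_zero_of_eval_Nhat {p : SR k} (h : ∀ x ∈ Nhat k, eval x p = 0) : p = 0 := by
  let x0 : SR k := X (Sum.inl 0)
  let y0 : SR k := X (Sum.inl 1)
  let s : Fin (k + 1) → SR k := fun j => X (Sum.inr j)
  let zt : SR k := x0 + C Complex.I * y0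
  let wt : SR k := x0 - C Complex.I * y0
  let qt : Fin (k + 1) → SR k := fun j => zt ^ (j.1 + 1) * wt ^ (k + 1 - j.1)
  let θ : SR k →ₐ[ℂ] SR k := aeval (Sum.elim ![zt, wt] fun j =>
    C (1 / 2) * qt j + C (1 / 2) * (s j - s (Fin.rev j))
      + C (Complex.I / 2) * (s j + s (Fin.rev j)))
  let θ' : SR k →ₐ[ℂ] SR k := aeval (Sum.elim ![C (1 / 2) * (Z + Wv), C (-Complex.I / 2) * (Z - Wv)]
    fun j => C (1 / 2) * ((Y j - C (1 / 2) * q j) - (Y (Fin.rev j) - C (1 / 2) * q (Fin.rev j)))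
      + C (-Complex.I / 2) * ((Y j - C (1 / 2) * q j) + (Y (Fin.rev j) - C (1 / 2) * q (Fin.rev j))))
  have hI : (C Complex.I * C Complex.I : SR k) = -1 := by
    rw [← C_mul, Complex.I_mul_I]; simp
  have h2 : (C (1 / 2) * 2 : SR k) = 1 := by
    rw [← map_ofNat C 2, ← C_mul]; norm_num
  have hI2 : (C (Complex.I / 2) : SR k) = C Complex.I * C (1 / 2) := by
    rw [← C_mul]; congr 1; ring
  have hI3 : (C (-Complex.I / 2) : SR k) = - (C Complex.I * C (1 / 2)) := by
    rw [← C_mul, ← C_neg]; congr 1; ring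
  have hθC : ∀ c, θ' (C c) = C c := fun c => by simp [θ']
  have hx0 : θ' x0 = C (1 / 2) * (Z + Wv) := by simp [θ', x0]
  have hy0 : θ' y0 = C (-Complex.I / 2) * (Z - Wv) := by simp [θ', y0]
  have hzt : θ' zt = Z := by
    simp only [zt, map_add, map_mul, hx0, hy0, hθC, hI3]
    linear_combination (-(C (1 / 2)) * (Z - Wv)) * hI + Z * h2
  have hwt : θ' wt = Wv := by
    simp only [wt, map_sub, map_mul, hx0, hy0, hθC, hI3]
    linear_combination ((C (1 / 2)) * (Z - Wv)) * hI + Wv * h2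
  have hqt : ∀ j, θ' (qt j) = q j := fun j => by simp only [qt, map_mul, map_pow, hzt, hwt, q]
  have hs : ∀ j, θ' (s j) = C (1 / 2) * ((Y j - C (1 / 2) * q j)
      - (Y (Fin.rev j) - C (1 / 2) * q (Fin.rev j))) + C (-Complex.I / 2) * ((Y j - C (1 / 2) * q j)
        + (Y (Fin.rev j) - C (1 / 2) * q (Fin.rev j))) := fun j => by simp [θ', s]
  have hinv : ∀ p, θ' (θ p) = p := by
    have : θ'.comp θ = AlgHom.id ℂ _ := by
      refine algHom_ext fun i => ?_
      rcases i with i | j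
      · fin_cases i
        · change θ' (θ (X (Sum.inl 0))) = Z
          simpa [θ] using hzt
        · change θ' (θ (X (Sum.inl 1))) = Wv
          simpa [θ] using hwt
      · change θ' (θ (X (Sum.inr j))) = Y j
        have : θ (X (Sum.inr j)) = C (1 / 2) * qt j + C (1 / 2) * (s j - s (Fin.rev j))
          + C (Complex.I / 2) * (s j + s (Fin.rev j)) := by simp [θ]
        rw [this]
        simp only [map_add, map_mul, map_sub, hθC, hqt, hs, Fin.rev_rev, hI2, hI3]
        linear_combination (-(C (1 / 2) * C (1 / 2) * 2) * ((Y j - C (1 / 2) * q j)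
          + (Y (Fin.rev j) - C (1 / 2) * q (Fin.rev j)))) * hI
          + (Y j - C (1 / 2) * q j) * (2 * C (1 / 2) + 1) * h2
    intro p
    exact congrArg (fun f => f p) this
  have hθ : θ p = 0 := by
    refine MvPolynomial.funext_set (fun _ => Set.range ((↑) : ℝ → ℂ))
      (fun _ => Set.infinite_range_of_injective Complex.ofReal_injective) fun x hx => ?_
    rw [map_zero]
    have hr : ∀ i, starRingEnd ℂ (x i) = x i := by
      intro i
      obtain ⟨r, hr⟩ := hx i trivial
      rw [← hr, Complex.conj_ofReal]
    let y : Fin 2 ⊕ Fin (k + 1) → ℂ := fun i => eval x (θ (X i))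
    have hy : eval x (θ p) = eval y p := by
      have : (eval x).comp (θ : SR k →+* SR k) = eval y :=
        MvPolynomial.ringHom_ext (fun c => by simp) fun i => by simp [y]
      exact congrArg (fun f => f p) this
    rw [hy]
    have h0 : y (Sum.inl 0) = x (Sum.inl 0) + Complex.I * x (Sum.inl 1) := by
      simp [y, θ, zt, x0, y0]
    have h1 : y (Sum.inl 1) = x (Sum.inl 0) - Complex.I * x (Sum.inl 1) := by
      simp [y, θ, wt, x0, y0]
    have hj : ∀ j, y (Sum.inr j) = (y (Sum.inl 0) ^ (j.1 + 1) * y (Sum.inl 1) ^ (k + 1 - j.1)) / 2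
        + (x (Sum.inr j) - x (Sum.inr (Fin.rev j))) / 2
        + Complex.I / 2 * (x (Sum.inr j) + x (Sum.inr (Fin.rev j))) := by
      intro j
      rw [h0, h1]
      simp [y, θ, zt, wt, x0, y0, qt, s]
      ring
    have hc : y (Sum.inl 1) = starRingEnd ℂ (y (Sum.inl 0)) := by
      rw [h0, h1]; simp [hr]; ring
    have hc' : starRingEnd ℂ (y (Sum.inl 1)) = y (Sum.inl 0) := by rw [hc]; simp
    refine h y ⟨hc, fun j => ?_⟩
    have e1 : k + 1 - (j.1 + 1) + 1 = k + 1 - j.1 := by omega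
    have e2 : k + 1 - (k + 1 - (j.1 + 1)) = j.1 + 1 := by omega
    rw [← hc, hj, hj]
    simp only [map_add, map_mul, map_div₀, map_sub, map_pow, hr, Complex.conj_I, Fin.rev_rev,
      Fin.val_rev, e1, e2, ← hc, hc', map_ofNat (starRingEnd ℂ) 2]
    ring
  rw [← hinv p, hθ, map_zero]

end Model

namespace Model

open MvPolynomial

variable {k : ℕ} (b : Fin (k + 1) → ℂ)

theorem evR_starR (y : Fin 2 → ℂ) (p : R2) : evR y (starR p) = starRingEnd ℂ (evR y p) := by
  have : (evR y).comp starR = (starRingEnd ℂ).comp (evR y) := by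
    refine MvPolynomial.ringHom_ext (fun c => by simp [evR]) ?_
    rintro (i | i) <;> simp [evR]
  exact congrArg (fun f => f p) this

/-- The mixed second derivatives of a polynomial. -/
noncomputable def hess (F : R2) (i j : Fin 2) : R2 := pderiv (Sum.inl i) (pderiv (Sum.inr j) F)

theorem starR_hess {F : R2} (hs : starR F = F) (i j : Fin 2) : starR (hess F i j) = hess F j i := by
  have h : starR (pderiv (Sum.inr j) F) = pderiv (Sum.inl j) F := by
    rw [← starR_starR (pderiv (Sum.inl j) F), starR_pderiv, hs]
  rw [hess, starR_pderiv, h, hess, pderiv_pderiv_comm]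

/-- Plurisubharmonicity of a polynomial. -/
def PshR (F : R2) : Prop := ∀ y ξ : Fin 2 → ℂ,
  0 ≤ (∑ i, ∑ j, evR y (hess F i j) * ξ i * starRingEnd ℂ (ξ j)).re

/-- The holomorphic half of the weighted Euler operator. -/
noncomputable def holEuler (k : ℕ) (F : R2) : R2 :=
  X (Sum.inl 0) * pderiv (Sum.inl 0) F
    + C ((k : ℂ) + 2) * (X (Sum.inl 1) * pderiv (Sum.inl 1) F)

theorem zhom_holEuler {k W : ℕ} {F : R2} (hF : ZHom (w2 k) F W) :
    ZHom (w2 k) (holEuler k F) W :=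
  ZHom.add ((ZHom.X (w := w2 k) (Sum.inl 0)).mul' (hF.pderiv _) (by ring))
    (ZHom.C_mul _ ((ZHom.X (w := w2 k) (Sum.inl 1)).mul' (hF.pderiv _) (by ring)))

theorem holEuler_add_starR {k W : ℕ} {F : R2} (hF : ZHom (w2 k) F W) (hs : starR F = F) :
    holEuler k F + starR (holEuler k F) = C (W : ℂ) * F := by
  have he := hF.euler
  simp only [Fintype.sum_sum_type, Fin.sum_univ_two, w2, Sum.elim_inl, Sum.elim_inr,
    MvPolynomial.smul_eq_C_mul, Matrix.cons_val_zero, Matrix.cons_val_one, Nat.cast_one,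
    C_1, one_mul, Int.cast_natCast] at he
  push_cast at he
  have hc : starRingEnd ℂ ((k : ℂ) + 2) = k + 2 := by
    rw [map_add, map_ofNat (starRingEnd ℂ) 2, Complex.conj_natCast]
  rw [holEuler]
  simp only [map_add starR, map_mul, starR_X, starR_pderiv, hs, starR_C, hc, Sum.swap_inl]
  rw [← he]

/-- The Levi form of `F` along the model field. -/
noncomputable def lamR (F : R2) : R2 :=
  ∑ i, ∑ j, hess F i j * (![1, A0 b] i : R2) * starR (![1, A0 b] j)

theorem eq_zero_of_psd {H : Fin 2 → Fin 2 → ℂ} (hH : ∀ i j, starRingEnd ℂ (H i j) = H j i)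
    (hpos : ∀ ξ : Fin 2 → ℂ, 0 ≤ (∑ i, ∑ j, H i j * ξ i * starRingEnd ℂ (ξ j)).re)
    {ξ : Fin 2 → ℂ} (hξ : ∑ i, ∑ j, H i j * ξ i * starRingEnd ℂ (ξ j) = 0) (i : Fin 2) :
    ∑ j, H i j * starRingEnd ℂ (ξ j) = 0 := by
  set B := ∑ j, H i j * starRingEnd ℂ (ξ j) with hB
  have hBc : starRingEnd ℂ B = ∑ j, H j i * ξ j := by
    rw [hB, map_sum]
    exact Finset.sum_congr rfl fun j _ => by rw [map_mul, hH]; simp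
  have key : ∀ s : ℝ, 0 ≤ -2 * s * Complex.normSq B + s ^ 2 * (Complex.normSq B * (H i i).re) := by
    intro s
    have h1 := hpos (ξ + Pi.single i (-(s : ℂ) * starRingEnd ℂ B))
    have h2 : ∑ i₁, ∑ j, H i₁ j * (ξ + Pi.single i (-(s : ℂ) * starRingEnd ℂ B) : Fin 2 → ℂ) i₁
        * starRingEnd ℂ ((ξ + Pi.single i (-(s : ℂ) * starRingEnd ℂ B) : Fin 2 → ℂ) j)
        = (∑ i, ∑ j, H i j * ξ i * starRingEnd ℂ (ξ j))
          + (∑ j, H i j * starRingEnd ℂ (ξ j)) * (-(s : ℂ) * starRingEnd ℂ B)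
          + (∑ j, H j i * ξ j) * (-(s : ℂ) * B)
          + H i i * ((s : ℂ) ^ 2 * (B * starRingEnd ℂ B)) := by
      fin_cases i <;> simp [Fin.sum_univ_two, Complex.conj_ofReal] <;> ring
    rw [h2, hξ, ← hB, ← hBc, zero_add, Complex.mul_conj] at h1
    have h3 : B * (-(s : ℂ) * starRingEnd ℂ B) + starRingEnd ℂ B * (-(s : ℂ) * B)
        + H i i * ((s : ℂ) ^ 2 * (Complex.normSq B : ℂ))
        = ((-2 * s * Complex.normSq B : ℝ) : ℂ)
          + H i i * ((s ^ 2 * Complex.normSq B : ℝ) : ℂ) := by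
      push_cast
      rw [← Complex.mul_conj]; ring
    rw [h3, Complex.add_re, Complex.ofReal_re, Complex.re_mul_ofReal] at h1
    linarith
  by_contra h0
  have hn : 0 < Complex.normSq B := Complex.normSq_pos.2 h0
  have h1 := key (1 / (|(H i i).re| + 1))
  have h2 : (H i i).re < |(H i i).re| + 1 := by linarith [le_abs_self (H i i).re]
  have h3 : 0 < |(H i i).re| + 1 := by positivity
  set c := |(H i i).re| + 1
  have h4 : -2 * (1 / c) * Complex.normSq B + (1 / c) ^ 2 * (Complex.normSq B * (H i i).re)
      = (Complex.normSq B / c ^ 2) * ((H i i).re - 2 * c) := by field_simp; ring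
  rw [h4] at h1
  have h5 : 0 < Complex.normSq B / c ^ 2 := by positivity
  nlinarith

theorem exists_of_levi {W : ℕ} (hW : 2 ≤ W) {F : R2} (hF : ZHom (w2 k) F W)
    (hs : starR F = F) (hpsh : PshR F)
    (h : ∀ v : List Bool, v.length + 2 = W → constantCoeff (word0 b v (lamR b F)) = 0) :
    ∃ P : SR k, ZHom (sw k) P W ∧ Lb P = 0 ∧ P + starS P = C 2 * toS b F := by
  have hzA : ∀ i : Fin 2, ZHom (w2 k) (![1, A0 b] i : R2) (w2 k (Sum.inl i) - 1) := by
    intro i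
    fin_cases i
    · simpa [w2] using (ZHom.C 1 : ZHom (w2 k) (C 1) 0)
    · have e : ((k : ℤ) + 2 - 1) = k + 1 := by ring
      simpa [w2, e] using zhom_A0 b
  have hlam : ZHom (w2 k) (lamR b F) (W - 2) := by
    refine ZHom.sum fun i _ => ZHom.sum fun j _ => ?_
    refine (((hF.pderiv _).pderiv _).mul (hzA i)).mul' (zhom_starR (hzA j)) ?_
    simp [w2]; ring
  have h0 : toS b (lamR b F) = 0 := by
    obtain ⟨n, rfl⟩ : ∃ n, W = n + 2 := ⟨W - 2, by omega⟩
    refine eq_zero_of_word n ?_ fun v hv => ?_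
    · have := zhom_toS b hlam
      simpa using this
    · rw [← toS_word0, constantCoeff_toS]
      exact h v (by omega)
  have hrow : ∀ i, toS b (Lb0 b (pderiv (Sum.inl i) F)) = 0 := by
    intro i
    refine eq_zero_of_eval_Nhat fun x hx => ?_
    rw [eval_toS b hx]
    set y : Fin 2 → ℂ := ![x (Sum.inl 0), ∑ j, b j * x (Sum.inr j)]
    have h1 : evR y (lamR b F) = 0 := by rw [← eval_toS b hx, h0, map_zero]
    have h2 := eq_zero_of_psd (H := fun i j => evR y (hess F i j))
      (ξ := fun i => evR y (![1, A0 b] i)) (fun i j => by rw [← evR_starR, starR_hess hs])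
      (fun ξ => hpsh y ξ) (by
        rw [lamR] at h1
        simpa only [map_sum, map_mul, evR_starR] using h1) i
    rw [← h2, Lb0_apply, map_add, map_mul, Fin.sum_univ_two, evR_starR, pderiv_pderiv_comm,
      pderiv_pderiv_comm (Sum.inr 1)]
    simp [hess, mul_comm]
  have hW0 : (W : ℂ) ≠ 0 := by
    have : W ≠ 0 := by omega
    exact_mod_cast this
  set G : R2 := holEuler k F with hG
  have hGz : ZHom (w2 k) G W := zhom_holEuler hF
  have hGs : G + starR G = C (W : ℂ) * F := holEuler_add_starR hF hs
  refine ⟨toS b (C (2 / (W : ℂ)) * G), zhom_toS b (hGz.C_mul _), ?_, ?_⟩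
  · rw [Lb_toS, Derivation.leibniz, map_add, smul_eq_mul, smul_eq_mul, map_mul, map_mul]
    have e1 : Lb0 b (C (2 / (W : ℂ))) = 0 := by simp
    have e2 : toS b (Lb0 b G) = 0 := by
      rw [hG, holEuler, map_add, Derivation.leibniz, Derivation.leibniz, Derivation.leibniz]
      have x0 : Lb0 b (X (Sum.inl 0)) = 0 := by simp [Lb0_apply, pderiv_X]
      have x1 : Lb0 b (X (Sum.inl 1)) = 0 := by simp [Lb0_apply, pderiv_X]
      have c1 : Lb0 b (C ((k : ℂ) + 2)) = 0 := by simp [Lb0_apply]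
      rw [x0, x1, c1]
      simp only [smul_eq_mul, mul_zero, add_zero, map_add, map_mul, hrow]
    rw [e1, e2, map_zero, mul_zero, mul_zero, add_zero]
  · have hc : starRingEnd ℂ (2 / (W : ℂ)) = 2 / W := by
      rw [map_div₀, map_ofNat (starRingEnd ℂ) 2, Complex.conj_natCast]
    rw [← toS_starR, map_mul starR, starR_C, hc, ← map_add, ← mul_add, hGs, ← mul_assoc, ← C_mul,
      div_mul_cancel₀ _ hW0, map_mul, toS_C]

end Model

/-- The derivative of a smooth function in a constant direction. -/
noncomputable def dirD {n : ℕ} (v : Cn n) (f : SF n) : SF n :=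
  ∑ j, (v j • wD (Sum.inl j) f + starRingEnd ℂ (v j) • wD (Sum.inr j) f)

theorem hasDerivAt_line {n : ℕ} (f : SF n) (x v : Cn n) (t : ℝ) :
    HasDerivAt (fun s : ℝ => f.1 (x + s • v)) ((dirD v f).1 (x + t • v)) t := by
  have h1 : HasDerivAt (fun s : ℝ => x + s • v) v t := by
    simpa using ((hasDerivAt_id t).smul_const v).const_add x
  have h2 := (f.differentiableAt (x + t • v)).hasFDerivAt.comp_hasDerivAt t h1
  rw [fderiv_eq_sum_wirt] at h2
  have h3 : (dirD v f).1 (x + t • v) = ∑ j, (v j * wz j f.1 (x + t • v)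
      + starRingEnd ℂ (v j) * wzb j f.1 (x + t • v)) := by
    rw [← evAt_apply, dirD, map_sum]
    refine Finset.sum_congr rfl fun j _ => ?_
    rw [map_add, map_smul, map_smul]
    rfl
  rw [h3]
  exact h2

theorem hasDerivAt_line_re {n : ℕ} (f : SF n) (x v : Cn n) (t : ℝ) :
    HasDerivAt (fun s : ℝ => (f.1 (x + s • v)).re) ((dirD v f).1 (x + t • v)).re t :=
  Complex.reCLM.hasFDerivAt.comp_hasDerivAt t (hasDerivAt_line f x v t)

theorem dirD_dirD_add (f : SF 1) :
    dirD (fun _ => 1) (dirD (fun _ => 1) f) + dirD (fun _ => Complex.I) (dirD (fun _ => Complex.I) f)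
      = (4 : ℂ) • wD (Sum.inl 0) (wD (Sum.inr 0) f) := by
  simp only [dirD, Fin.sum_univ_one, map_add, Derivation.map_smul, map_one, one_smul, Complex.conj_I,
    smul_add, smul_smul, wD_comm (Sum.inr 0) (Sum.inl 0)]
  simp only [Complex.I_mul_I, mul_neg, neg_mul, neg_neg]
  module

/-- Second derivative test at a local maximum along a line. -/
theorem dirD_dirD_re_nonpos {n : ℕ} (f : SF n) (x v : Cn n)
    (h : IsLocalMax (fun y => (f.1 y).re) x) : ((dirD v (dirD v f)).1 x).re ≤ 0 := by
  by_contra! hpos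
  set φ : ℝ → ℝ := fun s => (f.1 (x + s • v)).re with hφ
  have hd : deriv φ = fun s => ((dirD v f).1 (x + s • v)).re :=
    funext fun t => (hasDerivAt_line_re f x v t).deriv
  have hdd : ∀ t, deriv (deriv φ) t = ((dirD v (dirD v f)).1 (x + t • v)).re := fun t => by
    rw [hd]; exact (hasDerivAt_line_re (dirD v f) x v t).deriv
  have hc : ContinuousAt (fun s : ℝ => x + s • v) 0 := by fun_prop
  have hmax : IsLocalMax φ 0 := by
    have h' : IsLocalMax (fun y => (f.1 y).re) ((fun s : ℝ => x + s • v) 0) := by simpa using h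
    exact hc.eventually h'
  have hmin : IsLocalMin φ 0 := isLocalMin_of_deriv_deriv_pos (by simpa [hdd] using hpos)
    hmax.deriv_eq_zero (hasDerivAt_line_re f x v 0).continuousAt
  have heq : φ =ᶠ[𝓝 0] fun _ => φ 0 := by
    filter_upwards [hmax, hmin] with t h1 h2 using le_antisymm h1 h2
  have h2 := heq.deriv.deriv.eq_of_nhds
  rw [hdd] at h2
  simp at h2
  linarith

/-- A strictly subharmonic function attains its maximum over a compact set outside every open
subset. -/
theorem re_nonpos_of_subharmonic (f : SF 1) {K S : Set (Cn 1)} (hK : IsCompact K) (hS : IsOpen S)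
    (hSK : S ⊆ K) (hsub : ∀ x ∈ S, 0 < ((wD (Sum.inl 0) (wD (Sum.inr 0) f)).1 x).re)
    (hb : ∀ x ∈ K, x ∉ S → (f.1 x).re ≤ 0) {x : Cn 1} (hx : x ∈ K) : (f.1 x).re ≤ 0 := by
  have hcont : Continuous fun y => (f.1 y).re := Complex.continuous_re.comp f.smooth.continuous
  obtain ⟨y, hy, hmax⟩ := hK.exists_isMaxOn ⟨x, hx⟩ hcont.continuousOn
  refine (hmax hx).trans ?_
  by_contra! hpos
  have hyS : y ∈ S := by
    by_contra hn
    exact absurd (hb y hy hn) (not_le.2 hpos)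
  have hloc : IsLocalMax (fun y => (f.1 y).re) y := by
    filter_upwards [hS.mem_nhds hyS] with z hz using hmax (hSK hz)
  have h1 := dirD_dirD_re_nonpos f y (fun _ => 1) hloc
  have h2 := dirD_dirD_re_nonpos f y (fun _ => Complex.I) hloc
  have h3 := congrArg (fun g : SF 1 => (evAt y g).re) (dirD_dirD_add f)
  simp only [map_add, map_smul, Complex.add_re, evAt_apply, smul_eq_mul, Complex.mul_re,
    Complex.re_ofNat, Complex.im_ofNat, zero_mul, sub_zero] at h3
  linarith [hsub y hyS]

/-- `|ξ|²` on `ℂ`. -/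
noncomputable def sqn : SF 1 := coord (Sum.inl 0) * coord (Sum.inr 0)

theorem sqn_apply (x : Cn 1) : sqn.1 x = ((‖x 0‖ ^ 2 : ℝ) : ℂ) := by
  change x 0 * starRingEnd ℂ (x 0) = _
  rw [Complex.mul_conj, Complex.normSq_eq_norm_sq]

theorem wD_sqn_inl : wD (Sum.inl 0) sqn = coord (Sum.inr 0) := by
  simp [sqn, wD_coord]

theorem wD_sqn_inr : wD (Sum.inr 0) sqn = coord (Sum.inl 0) := by
  simp [sqn, wD_coord]

theorem lap_sqn : wD (Sum.inl 0) (wD (Sum.inr 0) sqn) = 1 := by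
  rw [wD_sqn_inr, wD_coord]; simp

/-- The barrier function. -/
noncomputable def barrier (N : ℕ) : SF 1 := (1 - (1 / 2 : ℂ) • sqn) ^ (N + 2)

theorem barrier_apply (N : ℕ) (x : Cn 1) :
    (barrier N).1 x = (((1 - ‖x 0‖ ^ 2 / 2) ^ (N + 2) : ℝ) : ℂ) := by
  rw [← evAt_apply, barrier]
  simp only [map_pow, map_sub, map_one, map_smul, evAt_apply, sqn_apply]
  push_cast
  rw [smul_eq_mul]; ring

theorem lap_barrier (N : ℕ) (x : Cn 1) :
    ((wD (Sum.inl 0) (wD (Sum.inr 0) (barrier N))).1 x).re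
      = (N + 2) / 2 * (1 - ‖x 0‖ ^ 2 / 2) ^ N * ((N + 2) / 2 * ‖x 0‖ ^ 2 - 1) := by
  have h1 : wD (Sum.inr 0) (barrier N)
      = (-((N + 2 : ℕ) : ℂ) / 2) • ((1 - (1 / 2 : ℂ) • sqn) ^ (N + 1) * coord (Sum.inl 0)) := by
    rw [barrier, Derivation.leibniz_pow, map_sub, Derivation.map_smul, wD_sqn_inr, Derivation.map_one_eq_zero,
      zero_sub]
    simp only [smul_eq_mul, ← Nat.cast_smul_eq_nsmul ℂ, mul_neg, smul_neg,
      mul_smul_comm, smul_smul, show N + 2 - 1 = N + 1 from rfl]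
    rw [← neg_smul]; congr 1; ring
  rw [h1, Derivation.map_smul, Derivation.leibniz, Derivation.leibniz_pow, map_sub, Derivation.map_smul, wD_sqn_inl,
    Derivation.map_one_eq_zero, zero_sub, wD_coord, ← evAt_apply]
  have h2 : coord (Sum.inl 0) * coord (Sum.inr 0) = sqn := rfl
  simp only [smul_eq_mul, ← Nat.cast_smul_eq_nsmul ℂ, map_smul, map_add, map_mul, map_pow, map_sub,
    map_one, map_neg, evAt_apply, sqn_apply, if_true, Nat.add_sub_cancel]
  have h3 : (coord (Sum.inl 0) : SF 1).1 x * (coord (Sum.inr 0) : SF 1).1 x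
      = ((‖x 0‖ ^ 2 : ℝ) : ℂ) := sqn_apply x
  rw [← Complex.ofReal_re ((N + 2) / 2 * (1 - ‖x 0‖ ^ 2 / 2) ^ N * ((N + 2) / 2 * ‖x 0‖ ^ 2 - 1))]
  congr 1
  push_cast at h3 ⊢
  rw [pow_succ]
  linear_combination (-(N + 2 : ℂ) / 2 * ((N + 1 : ℂ) * (1 - 1 / 2 * (‖x 0‖ : ℂ) ^ 2) ^ N * (-1 / 2))) * h3

theorem continuous_norm_apply_zero : Continuous fun x : Cn 1 => ‖x 0‖ := by fun_prop

theorem isCompact_annulus (δ : ℝ) : IsCompact {x : Cn 1 | δ ≤ ‖x 0‖ ∧ ‖x 0‖ ≤ 1} := by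
  refine (isCompact_closedBall (0 : Cn 1) 1).of_isClosed_subset ?_ fun x hx => ?_
  · exact (isClosed_le continuous_const continuous_norm_apply_zero).inter
      (isClosed_le continuous_norm_apply_zero continuous_const)
  · rw [mem_closedBall_zero_iff, pi_norm_le_iff_of_nonneg zero_le_one]
    intro i
    rw [Subsingleton.elim i 0]
    exact hx.2

/-- The maximum principle on the unit disc. -/
theorem re_nonpos_of_disc (g : SF 1)
    (hsub : ∀ x, 0 ≤ ((wD (Sum.inl 0) (wD (Sum.inr 0) g)).1 x).re)
    (h0 : ∀ x : Cn 1, ‖x 0‖ = 1 → (g.1 x).re = 0) {x : Cn 1} (hx : ‖x 0‖ ≤ 1) :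
    (g.1 x).re ≤ 0 := by
  refine le_of_forall_pos_le_add fun ε hε => ?_
  have h := re_nonpos_of_subharmonic (g + (ε : ℂ) • (sqn - 1))
    (K := {x : Cn 1 | -1 ≤ ‖x 0‖ ∧ ‖x 0‖ ≤ 1}) (S := {x : Cn 1 | ‖x 0‖ < 1})
    (isCompact_annulus _) (isOpen_lt continuous_norm_apply_zero continuous_const)
    (fun y hy => ⟨by linarith [norm_nonneg (y 0)], le_of_lt hy⟩) (fun y _ => ?_) (fun y hy hyS => ?_)
    (x := x) ⟨by linarith [norm_nonneg (x 0)], hx⟩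
  · rw [← evAt_apply] at h
    simp only [map_add, map_smul, map_sub, map_one, evAt_apply, sqn_apply, smul_eq_mul,
      Complex.add_re, Complex.re_ofReal_mul, Complex.sub_re, Complex.ofReal_re, Complex.one_re] at h
    nlinarith [sq_nonneg ‖x 0‖]
  · have h1 := hsub y
    rw [← evAt_apply] at h1 ⊢
    simp only [map_add, Derivation.map_smul, map_sub, lap_sqn, Derivation.map_one_eq_zero, map_smul,
      sub_zero, map_one, Complex.add_re, smul_eq_mul, mul_one, Complex.ofReal_re]
    linarith
  · have hy1 : ‖y 0‖ = 1 := le_antisymm hy.2 (not_lt.1 hyS)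
    rw [← evAt_apply]
    simp only [map_add, map_smul, map_sub, map_one]
    simp [evAt_apply, sqn_apply, hy1, h0 y hy1]

/-- The Hopf lemma on the unit disc. -/
theorem re_nonneg_of_disc (g : SF 1)
    (hsub : ∀ x, 0 ≤ ((wD (Sum.inl 0) (wD (Sum.inr 0) g)).1 x).re)
    (h0 : ∀ x : Cn 1, ‖x 0‖ = 1 → (g.1 x).re = 0)
    (hd : ((dirD (fun _ => 1) g).1 fun _ => 1).re = 0) : 0 ≤ (g.1 0).re := by
  by_contra! hneg
  have hcont : Continuous fun y => (g.1 y).re := Complex.continuous_re.comp g.smooth.continuous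
  obtain ⟨δ, hδ0, hδ1, hδ⟩ : ∃ δ : ℝ, 0 < δ ∧ δ < 1 ∧ ∀ x : Cn 1, ‖x 0‖ ≤ δ →
      (g.1 x).re < (g.1 0).re / 2 := by
    have hev : ∀ᶠ x in 𝓝 (0 : Cn 1), (g.1 x).re < (g.1 0).re / 2 :=
      hcont.continuousAt.eventually_lt continuousAt_const (by linarith)
    obtain ⟨r, hr, hball⟩ := Metric.eventually_nhds_iff.1 hev
    refine ⟨min (r / 2) (1 / 2), by positivity, by
      have := min_le_right (r / 2) (1 / 2 : ℝ); linarith, fun x hx => hball ?_⟩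
    rw [dist_zero_right, pi_norm_lt_iff hr]
    intro i
    rw [Subsingleton.elim i 0]
    have := min_le_left (r / 2) (1 / 2 : ℝ)
    linarith
  obtain ⟨N, hN⟩ := exists_nat_gt (2 / δ ^ 2)
  have hN2 : 1 < (N + 2) / 2 * δ ^ 2 := by
    rw [div_lt_iff₀ (by positivity)] at hN
    nlinarith [sq_nonneg δ]
  set c : ℝ := (1 / 2) ^ (N + 2) with hc
  set ε : ℝ := -(g.1 0).re / 2 with hε
  have hεp : 0 < ε := by rw [hε]; linarith
  have hcp : 0 < c := by positivity
  set u : SF 1 := g + (ε : ℂ) • (barrier N - (c : ℂ) • 1) with hu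
  have hval : ∀ x, (u.1 x).re = (g.1 x).re + ε * ((1 - ‖x 0‖ ^ 2 / 2) ^ (N + 2) - c) := by
    intro x
    rw [← evAt_apply, hu]
    simp only [map_add, map_smul, map_sub, map_one, evAt_apply, barrier_apply, smul_eq_mul,
      Complex.add_re, Complex.re_ofReal_mul, Complex.sub_re, Complex.ofReal_re,
      mul_one]
  have hle : ∀ x : Cn 1, δ ≤ ‖x 0‖ → ‖x 0‖ ≤ 1 → (u.1 x).re ≤ 0 := by
    intro x hx1 hx2
    refine re_nonpos_of_subharmonic u (S := {x : Cn 1 | δ < ‖x 0‖ ∧ ‖x 0‖ < 1})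
      (isCompact_annulus δ) ((isOpen_lt continuous_const continuous_norm_apply_zero).inter
        (isOpen_lt continuous_norm_apply_zero continuous_const))
      (fun y hy => ⟨hy.1.le, hy.2.le⟩) (fun y hy => ?_) (fun y hy hyS => ?_) ⟨hx1, hx2⟩
    · have h1 := hsub y
      have h2 : ((wD (Sum.inl 0) (wD (Sum.inr 0) u)).1 y).re
          = ((wD (Sum.inl 0) (wD (Sum.inr 0) g)).1 y).re
            + ε * ((wD (Sum.inl 0) (wD (Sum.inr 0) (barrier N))).1 y).re := by
        rw [hu]
        simp only [← evAt_apply, map_add, Derivation.map_smul, map_sub, Derivation.map_one_eq_zero,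
          map_smul, smul_zero, sub_zero, Complex.add_re, smul_eq_mul,
          Complex.re_ofReal_mul]
      rw [h2, lap_barrier]
      have h3 : 0 < 1 - ‖y 0‖ ^ 2 / 2 := by nlinarith [hy.2, norm_nonneg (y 0)]
      have h4 : δ ^ 2 ≤ ‖y 0‖ ^ 2 := pow_le_pow_left₀ hδ0.le hy.1.le 2
      have h5 : 0 < (N + 2) / 2 * ‖y 0‖ ^ 2 - 1 := by
        have : (N + 2 : ℝ) / 2 * δ ^ 2 ≤ (N + 2) / 2 * ‖y 0‖ ^ 2 := by gcongr
        linarith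
      positivity
    · rw [hval]
      by_cases h1 : ‖y 0‖ = 1
      · rw [h1, h0 y h1, hc]; norm_num
      · have h2 : ‖y 0‖ ≤ δ := by
          by_contra! h
          exact hyS ⟨h, lt_of_le_of_ne hy.2 h1⟩
        have h3 : (1 - ‖y 0‖ ^ 2 / 2) ^ (N + 2) ≤ 1 :=
          pow_le_one₀ (by nlinarith [hy.2, norm_nonneg (y 0)]) (by nlinarith [sq_nonneg ‖y 0‖])
        have h4 : ε * ((1 - ‖y 0‖ ^ 2 / 2) ^ (N + 2) - c) ≤ ε * 1 := by
          gcongr; linarith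
        have := hδ y h2
        rw [hε] at h4 ⊢
        linarith
  have hline := (hasDerivAt_line_re g 0 (fun _ => 1) 1)
  have e1 : (0 : Cn 1) + (1 : ℝ) • (fun _ => (1 : ℂ)) = fun _ => 1 := by simp
  rw [e1, hd] at hline
  have hpoly : HasDerivAt (fun t : ℝ => ε * ((1 - t ^ 2 / 2) ^ (N + 2) - c))
      (ε * (((N + 2 : ℕ) : ℝ) * (1 - 1 ^ 2 / 2) ^ (N + 1) * (-(2 * 1 / 2)))) 1 := by
    have h1 : HasDerivAt (fun t : ℝ => 1 - t ^ 2 / 2) (-(2 * 1 / 2)) 1 := by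
      simpa using ((hasDerivAt_pow 2 (1 : ℝ)).div_const 2).const_sub 1
    exact ((h1.pow (N + 2)).sub_const c).const_mul ε
  have htot := hline.add hpoly
  set φ : ℝ → ℝ := (fun s : ℝ => (g.1 (0 + s • fun _ => (1 : ℂ))).re)
    + fun t : ℝ => ε * ((1 - t ^ 2 / 2) ^ (N + 2) - c) with hφ
  have hφ0 : φ 1 = 0 := by
    have h1 := h0 (fun _ => 1) (by simp)
    simp only [hφ, Pi.add_apply, e1, h1, hc]
    norm_num
  have hφle : ∀ t : ℝ, δ ≤ t → t ≤ 1 → φ t ≤ 0 := by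
    intro t h1 h2
    have h3 : ‖(t • fun _ => (1 : ℂ) : Cn 1) 0‖ = t := by
      simp [abs_of_nonneg (hδ0.le.trans h1)]
    have h4 := hle (t • fun _ => (1 : ℂ)) (by rw [h3]; exact h1) (by rw [h3]; exact h2)
    rw [hval, h3] at h4
    simpa [hφ] using h4
  have hslope : Filter.Tendsto (slope φ 1) (𝓝[<] 1) (𝓝 _) :=
    (hasDerivAt_iff_tendsto_slope_left_right.1 htot).1
  have hge : 0 ≤ 0 + ε * (((N + 2 : ℕ) : ℝ) * (1 - 1 ^ 2 / 2) ^ (N + 1) * (-(2 * 1 / 2))) := by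
    refine ge_of_tendsto hslope ?_
    filter_upwards [Ioo_mem_nhdsLT hδ1] with t ht
    rw [slope_def_field, hφ0]
    exact div_nonneg_of_nonpos (by linarith [hφle t ht.1.le ht.2.le]) (by linarith [ht.2])
  have hpos : 0 < ε * (((N + 2 : ℕ) : ℝ) * (1 - 1 ^ 2 / 2) ^ (N + 1)) := by
    have : (0 : ℝ) < 1 - 1 ^ 2 / 2 := by norm_num
    positivity
  linarith

namespace Disc

open Polynomial

/-- The part of positive frequencies of `p(ξ) r(ξ⁻¹)`, normalized to vanish at `ξ = 1`. -/
noncomputable def posPart (A : Type*) [CommRing A] : A[X] →ₗ[A] A[X] →ₗ[A] A[X] :=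
  (basisMonomials A).constr A fun n => (basisMonomials A).constr A fun m =>
    if m < n then X ^ (n - m) - 1 else 0

section

variable {A : Type*} [CommRing A]

theorem posPart_monomial (n m : ℕ) (a c : A) : posPart A (monomial n a) (monomial m c)
    = C (a * c) * (if m < n then X ^ (n - m) - 1 else 0) := by
  have h : ∀ (n : ℕ) (a : A), monomial n a = a • basisMonomials A n := fun n a => by
    simp [smul_monomial]
  rw [h n a, h m c, map_smul, map_smul, LinearMap.smul_apply, posPart,
    Module.Basis.constr_basis, Module.Basis.constr_basis, smul_smul, smul_eq_C_mul, mul_comm c]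

/-- Bilinear identities may be checked on monomials. -/
theorem bilin_induction {P : A[X] → A[X] → Prop} (h1 : ∀ p p' r, P p r → P p' r → P (p + p') r)
    (h2 : ∀ p r r', P p r → P p r' → P p (r + r'))
    (h3 : ∀ n a m c, P (monomial n a) (monomial m c)) (p r : A[X]) : P p r := by
  induction p using Polynomial.induction_on' with
  | add p p' hp hp' => exact h1 _ _ _ hp hp'
  | monomial n a =>
    induction r using Polynomial.induction_on' with
    | add r r' hr hr' => exact h2 _ _ _ hr hr'
    | monomial m c => exact h3 n a m c

theorem map_posPart {B : Type*} [CommRing B] (φ : A →+* B) (p r : A[X]) :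
    (posPart A p r).map φ = posPart B (p.map φ) (r.map φ) := by
  refine bilin_induction (P := fun p r => (posPart A p r).map φ = posPart B (p.map φ) (r.map φ))
    (fun p p' r h h' => ?_) (fun p r r' h h' => ?_) (fun n a m c => ?_) p r
  · simp only [map_add, LinearMap.add_apply, Polynomial.map_add, h, h']
  · simp only [map_add, Polynomial.map_add, h, h']
  · simp only [map_monomial, posPart_monomial]
    split_ifs <;> simp

theorem eval_one_posPart (p r : A[X]) : (posPart A p r).eval 1 = 0 := by
  refine bilin_induction (P := fun p r => (posPart A p r).eval 1 = 0)
    (fun p p' r h h' => ?_) (fun p r r' h h' => ?_) (fun n a m c => ?_) p r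
  · simp only [map_add, LinearMap.add_apply, eval_add, h, h', add_zero]
  · simp only [map_add, eval_add, h, h', add_zero]
  · rw [posPart_monomial]
    split_ifs <;> simp

theorem eval_posPart_add {F : Type*} [Field F] {ξ : F} (hξ : ξ ≠ 0) (p r : F[X]) :
    (posPart F p r).eval ξ + (posPart F r p).eval ξ⁻¹
      = p.eval ξ * r.eval ξ⁻¹ - p.eval 1 * r.eval 1 := by
  refine bilin_induction (P := fun p r => (posPart F p r).eval ξ + (posPart F r p).eval ξ⁻¹
      = p.eval ξ * r.eval ξ⁻¹ - p.eval 1 * r.eval 1)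
    (fun p p' r h h' => ?_) (fun p r r' h h' => ?_) (fun n a m c => ?_) p r
  · simp only [map_add, LinearMap.add_apply, eval_add]
    linear_combination h + h'
  · simp only [map_add, LinearMap.add_apply, eval_add]
    linear_combination h + h'
  · rw [posPart_monomial, posPart_monomial]
    rcases lt_trichotomy m n with h | rfl | h
    · obtain ⟨l, rfl⟩ := Nat.exists_eq_add_of_lt h
      have : ξ ^ (m + l + 1) * ξ⁻¹ ^ m = ξ ^ (l + 1) := by
        rw [add_assoc, pow_add, mul_right_comm, ← mul_pow, mul_inv_cancel₀ hξ, one_pow, one_mul]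
      rw [if_pos h, if_neg (by omega), show m + l + 1 - m = l + 1 by omega]
      simp only [eval_mul, eval_C, eval_sub, eval_pow, eval_X, eval_one, eval_monomial, mul_zero,
        eval_zero, one_pow]
      linear_combination -a * c * this
    · have : ξ ^ m * ξ⁻¹ ^ m = 1 := by rw [← mul_pow, mul_inv_cancel₀ hξ, one_pow]
      simp only [lt_self_iff_false, if_false, mul_zero, eval_zero, eval_monomial, one_pow]
      linear_combination -a * c * this
    · obtain ⟨l, rfl⟩ := Nat.exists_eq_add_of_lt h
      have : ξ⁻¹ ^ (n + l + 1) * ξ ^ n = ξ⁻¹ ^ (l + 1) := by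
        rw [add_assoc, pow_add, mul_right_comm, ← mul_pow, inv_mul_cancel₀ hξ, one_pow, one_mul]
      rw [if_pos h, if_neg (by omega), show n + l + 1 - n = l + 1 by omega]
      simp only [eval_mul, eval_C, eval_sub, eval_pow, eval_X, eval_one, eval_monomial, mul_zero,
        eval_zero, one_pow]
      linear_combination -a * c * this

theorem eval_zero_posPart_monomial (n m : ℕ) (a c : A) :
    (posPart A (monomial n a) (monomial m c)).eval 0 = if m < n then -(a * c) else 0 := by
  rw [posPart_monomial]
  split_ifs with h
  · have : n - m ≠ 0 := by omega
    simp [this]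
  · simp

theorem X_sub_one_mul_monomial (n : ℕ) (a : A) :
    (X - 1) * monomial n a = monomial (n + 1) a - monomial n a := by
  rw [sub_mul, X_mul_monomial, one_mul]

theorem eval_zero_posPart_expand_right (p r : A[X]) :
    (posPart A (expand A 2 p) ((X - 1) * expand A 2 r)).eval 0 = 0 := by
  refine bilin_induction
    (P := fun p r => (posPart A (expand A 2 p) ((X - 1) * expand A 2 r)).eval 0 = 0)
    (fun p p' r h h' => ?_) (fun p r r' h h' => ?_) (fun n a m c => ?_) p r
  · simp only [map_add, LinearMap.add_apply, eval_add, h, h', add_zero]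
  · simp only [map_add, mul_add, eval_add, h, h', add_zero]
  · rw [expand_monomial, expand_monomial, X_sub_one_mul_monomial, map_sub, eval_sub,
      eval_zero_posPart_monomial, eval_zero_posPart_monomial]
    have : m * 2 + 1 < n * 2 ↔ m * 2 < n * 2 := by omega
    simp [this]

theorem eval_zero_posPart_expand_left (p r : A[X]) :
    (posPart A ((X - 1) * expand A 2 p) (expand A 2 r)).eval 0
      = -∑ n ∈ r.support, p.coeff n * r.coeff n := by
  have h0 : ∀ r : A[X], ∑ n ∈ r.support, p.coeff n * r.coeff n = r.sum fun n c => p.coeff n * c :=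
    fun r => rfl
  rw [h0]
  refine bilin_induction (P := fun p r => (posPart A ((X - 1) * expand A 2 p) (expand A 2 r)).eval 0
      = -r.sum fun n c => p.coeff n * c)
    (fun p p' r h h' => ?_) (fun p r r' h h' => ?_) (fun n a m c => ?_) p r
  · simp only [map_add, mul_add, LinearMap.add_apply, eval_add, h, h', coeff_add, add_mul]
    rw [Polynomial.sum_add, neg_add]
  · simp only [map_add, eval_add, h, h']
    rw [Polynomial.sum_add_index _ _ _ (by simp) (by simp [mul_add]), neg_add]
  · rw [expand_monomial, expand_monomial, X_sub_one_mul_monomial, map_sub, LinearMap.sub_apply,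
      eval_sub, eval_zero_posPart_monomial, eval_zero_posPart_monomial,
      sum_monomial_index _ _ (by simp), coeff_monomial]
    rcases lt_trichotomy m n with h | rfl | h
    · rw [if_pos (by omega), if_pos (by omega), if_neg (by omega)]; simp
    · simp
    · rw [if_neg (by omega), if_neg (by omega), if_neg (by omega)]; simp

/-- The pairing of coefficients giving the first variation of the centres. -/
noncomputable def varCoeff (A : Type*) [CommRing A] (a c m : ℕ) : A :=
  (posPart A ((X - 1) * expand A 2 (X ^ m * (1 - X) ^ a)) (expand A 2 ((1 - X) ^ c))).eval 0

theorem natDegree_one_sub_X_pow_le (c : ℕ) : ((1 - X : A[X]) ^ c).natDegree ≤ c := by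
  refine natDegree_pow_le.trans ?_
  have : (1 - X : A[X]).natDegree ≤ 1 := (natDegree_sub_le _ _).trans (by simp [natDegree_X_le])
  nlinarith

theorem varCoeff_eq_zero {a c m : ℕ} (h : c < m) : varCoeff A a c m = 0 := by
  rw [varCoeff, eval_zero_posPart_expand_left, neg_eq_zero]
  refine Finset.sum_eq_zero fun n hn => ?_
  have h1 : n ≤ c := (le_natDegree_of_mem_supp n hn).trans (natDegree_one_sub_X_pow_le c)
  rw [coeff_X_pow_mul', if_neg (by omega), zero_mul]

theorem varCoeff_ne_zero [Nontrivial A] {a m : ℕ} : varCoeff A a m m ≠ 0 := by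
  have hlead : ((1 - X : A[X]) ^ m).coeff m = (-1) ^ m := by
    have : (1 - X : A[X]) ^ m = C ((-1) ^ m) * (X - C 1) ^ m := by
      rw [C_pow, ← mul_pow]; congr 1; simp
    have h2 : ((X - C 1 : A[X]) ^ m).coeff m = 1 := by
      have h3 := ((monic_X_sub_C (1 : A)).pow m).coeff_natDegree
      rwa [(monic_X_sub_C (1 : A)).natDegree_pow, natDegree_X_sub_C, mul_one] at h3
    rw [this, coeff_C_mul, h2, mul_one]
  have hu : IsUnit ((-1 : A) ^ m) := (isUnit_one.neg).pow m
  rw [varCoeff, eval_zero_posPart_expand_left, neg_ne_zero, Finset.sum_eq_single m]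
  · rw [hlead, coeff_X_pow_mul', if_pos le_rfl, Nat.sub_self, coeff_zero_eq_eval_zero]
    simpa using hu.ne_zero
  · intro n hn hne
    have h1 : n ≤ m := (le_natDegree_of_mem_supp n hn).trans (natDegree_one_sub_X_pow_le m)
    rw [coeff_X_pow_mul', if_neg (by omega), zero_mul]
  · intro hn
    rw [notMem_support_iff.1 hn, mul_zero]

end

end Disc

theorem dirD_mul {n : ℕ} (v : Cn n) (f g : SF n) :
    dirD v (f * g) = f * dirD v g + g * dirD v f := by
  simp only [dirD, Derivation.leibniz, Finset.mul_sum, smul_eq_mul, ← Finset.sum_add_distrib]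
  refine Finset.sum_congr rfl fun j _ => ?_
  simp only [Algebra.smul_def]
  ring

theorem dirD_add {n : ℕ} (v : Cn n) (f g : SF n) : dirD v (f + g) = dirD v f + dirD v g := by
  simp only [dirD, map_add, smul_add, ← Finset.sum_add_distrib]
  exact Finset.sum_congr rfl fun j _ => by abel

theorem dirD_one {n : ℕ} (v : Cn n) : dirD v (1 : SF n) = 0 := by
  simp [dirD]

theorem dirD_coord_inl {n : ℕ} (v : Cn n) (i : Fin n) :
    dirD v (coord (Sum.inl i)) = algebraMap ℂ (SF n) (v i) := by
  simp [dirD, wD_coord, Finset.sum_ite_eq', Algebra.algebraMap_eq_smul_one]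

theorem dirD_coord_inr {n : ℕ} (v : Cn n) (i : Fin n) :
    dirD v (coord (Sum.inr i)) = algebraMap ℂ (SF n) (starRingEnd ℂ (v i)) := by
  simp [dirD, wD_coord, Finset.sum_ite_eq', Algebra.algebraMap_eq_smul_one]

/-- The first order jet of a smooth function along a direction. -/
noncomputable def jet {n : ℕ} (x v : Cn n) : SF n →+* DualNumber ℂ where
  toFun f := TrivSqZeroExt.inl (evAt x f) + TrivSqZeroExt.inr (evAt x (dirD v f))
  map_one' := by ext <;> simp [dirD_one]
  map_zero' := by ext <;> simp [dirD]
  map_add' f g := by ext <;> simp [dirD_add]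
  map_mul' f g := by
    ext
    · simp
    · simp [dirD_mul]
      ring

theorem snd_jet {n : ℕ} (x v : Cn n) (f : SF n) : (jet x v f).snd = evAt x (dirD v f) := by
  simp [jet]

theorem fst_jet {n : ℕ} (x v : Cn n) (f : SF n) : (jet x v f).fst = evAt x f := by
  simp [jet]

namespace Disc

open Polynomial

/-- The inclusion of the constants in the dual numbers. -/
abbrev dinl : ℂ →+* DualNumber ℂ := TrivSqZeroExt.inlHom ℂ ℂ

theorem eps_mul_eps : (DualNumber.eps * DualNumber.eps : DualNumber ℂ) = 0 := DualNumber.eps_mul_eps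

theorem dual_pow (P E : ℂ[X]) (n : ℕ) :
    (P.map dinl + C DualNumber.eps * E.map dinl) ^ (n + 1)
      = (P ^ (n + 1)).map dinl + C DualNumber.eps * (C ((n : ℂ) + 1) * (P ^ n * E)).map dinl := by
  have he : (C DualNumber.eps * C DualNumber.eps : (DualNumber ℂ)[X]) = 0 := by
    rw [← C_mul, eps_mul_eps, C_0]
  induction n with
  | zero => simp
  | succ n ih =>
    rw [pow_succ, ih]
    simp only [Polynomial.map_mul, Polynomial.map_pow, map_C, Nat.cast_add, Nat.cast_one,
      Polynomial.map_add, Polynomial.map_one, map_add, map_one]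
    generalize C (dinl (n : ℂ)) = c
    linear_combination (c + 1) * P.map dinl ^ n * E.map dinl ^ 2 * he

theorem snd_eval_zero_posPart_dual (P E R G : ℂ[X]) :
    ((posPart (DualNumber ℂ) (P.map dinl + C DualNumber.eps * E.map dinl)
      (R.map dinl + C DualNumber.eps * G.map dinl)).eval 0).snd
      = (posPart ℂ P G).eval 0 + (posPart ℂ E R).eval 0 := by
  have h0 : ∀ p : ℂ[X], (p.map dinl).eval 0 = dinl (p.eval 0) := fun p => by
    rw [← map_zero dinl, eval_map, eval₂_at_apply]
  simp only [map_add, LinearMap.add_apply, ← smul_eq_C_mul, map_smul, LinearMap.smul_apply,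
    ← map_posPart, eval_add, eval_smul, h0, smul_eq_mul]
  simp [add_comm]

variable {k : ℕ}

/-- The family of boundary functions of the discs. -/
noncomputable def fam {A : Type*} [CommRing A] (c : Fin (k + 2) → A) : A[X] :=
  expand A 2 (1 - X) *
    (C (1 + c 0) + ∑ m : Fin (k + 1), C (c m.succ) * ((X - 1) * expand A 2 (X ^ (m.1 + 1))))

theorem map_fam {A B : Type*} [CommRing A] [CommRing B] (φ : A →+* B) (c : Fin (k + 2) → A) :
    (fam c).map φ = fam fun i => φ (c i) := by
  simp [fam, Polynomial.map_sum]

theorem eval_one_fam {A : Type*} [CommRing A] (c : Fin (k + 2) → A) : (fam c).eval 1 = 0 := by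
  simp [fam]

theorem eval_zero_fam {A : Type*} [CommRing A] (c : Fin (k + 2) → A) :
    (fam c).eval 0 = 1 + c 0 := by
  simp [fam, eval_finsetSum]

theorem fam_dual {v : Fin (k + 2) → ℂ} (hv : v 0 = 0) :
    fam (fun i => DualNumber.eps * dinl (v i)) = (expand ℂ 2 (1 - X)).map dinl
      + C DualNumber.eps * (expand ℂ 2 (1 - X) * ∑ m : Fin (k + 1),
        C (v m.succ) * ((X - 1) * expand ℂ 2 (X ^ (m.1 + 1)))).map dinl := by
  have h1 : expand (DualNumber ℂ) 2 (1 - X) = (expand ℂ 2 (1 - X)).map dinl := by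
    rw [map_expand]; simp
  have h2 : ∀ m : ℕ, (X - 1) * expand (DualNumber ℂ) 2 (X ^ m)
      = ((X - 1) * expand ℂ 2 (X ^ m)).map dinl := fun m => by
    rw [Polynomial.map_mul, map_expand]; simp
  simp only [fam, hv, map_zero, mul_zero, add_zero, C_1, h1, h2]
  rw [mul_add, mul_one, Polynomial.map_mul, Polynomial.map_sum]
  refine congrArg _ (Eq.trans (congrArg _ ?_) (mul_left_comm _ _ _).symm)
  rw [Finset.mul_sum]
  exact Finset.sum_congr rfl fun m _ => by
    rw [Polynomial.map_mul dinl (p := C (v m.succ)), map_C, C_mul]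
    exact mul_assoc _ _ _

/-- The centres of the discs. -/
noncomputable def ctr (k : ℕ) : Fin (k + 2) → SF (k + 2) :=
  Fin.cons ((fam fun i => coord (Sum.inl i)).eval 0) fun j : Fin (k + 1) =>
    (posPart (SF (k + 2)) ((fam fun i => coord (Sum.inl i)) ^ (j.1 + 1))
      ((fam fun i => coord (Sum.inr i)) ^ (k - j.1 + 1))).eval 0

theorem dirD_ctr_zero (v : Cn (k + 2)) : evAt 0 (dirD v (ctr k 0)) = v 0 := by
  rw [ctr, Fin.cons_zero, eval_zero_fam, dirD_add, dirD_one, zero_add, dirD_coord_inl,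
    AlgHomClass.commutes]
  rfl

theorem dirD_ctr_succ {v : Cn (k + 2)} (hv : v 0 = 0) (j : Fin (k + 1)) :
    evAt 0 (dirD v (ctr k j.succ))
      = (j.1 + 1) * ∑ m : Fin (k + 1), v m.succ * varCoeff ℂ (j.1 + 1) (k - j.1 + 1) (m.1 + 1) := by
  have hj : ∀ (p : (SF (k + 2))[X]), jet (0 : Cn (k + 2)) v (p.eval 0) = (p.map (jet 0 v)).eval 0 :=
    fun p => by
      rw [eval_map, ← map_zero (jet (0 : Cn (k + 2)) v), eval₂_at_apply]
  have e1 : ∀ i, jet 0 v (coord (Sum.inl i)) = DualNumber.eps * dinl (v i) := fun i => by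
    ext
    · have : evAt (0 : Cn (k + 2)) (coord (Sum.inl i)) = 0 := rfl
      simp [fst_jet, this]
    · rw [snd_jet, dirD_coord_inl, AlgHomClass.commutes]; simp
  have e2 : ∀ i, jet 0 v (coord (Sum.inr i)) = DualNumber.eps * dinl (starRingEnd ℂ (v i)) :=
    fun i => by
      ext
      · have : evAt (0 : Cn (k + 2)) (coord (Sum.inr i)) = 0 := by
          change starRingEnd ℂ 0 = 0
          simp
        simp [fst_jet, this]
      · rw [snd_jet, dirD_coord_inr, AlgHomClass.commutes]; simp
  have hv' : starRingEnd ℂ (v 0) = 0 := by rw [hv, map_zero]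
  rw [← snd_jet, ctr, Fin.cons_succ, hj, map_posPart, Polynomial.map_pow, Polynomial.map_pow,
    map_fam, map_fam]
  simp only [e1, e2]
  rw [fam_dual hv, fam_dual (v := fun i => starRingEnd ℂ (v i)) hv', dual_pow, dual_pow,
    snd_eval_zero_posPart_dual]
  have h1 : ∀ (a n : ℕ) (w : Fin (k + 1) → ℂ), C ((a : ℂ) + 1) * (expand ℂ 2 (1 - X) ^ n *
      (expand ℂ 2 (1 - X) * ∑ m, C (w m) * ((X - 1) * expand ℂ 2 (X ^ (m.1 + 1)))))
      = ∑ m, ((a : ℂ) + 1) • w m • ((X - 1) * expand ℂ 2 (X ^ (m.1 + 1) * (1 - X) ^ (n + 1))) := by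
    intro a n w
    simp only [Finset.mul_sum, smul_eq_C_mul, map_mul (expand ℂ 2), map_pow (expand ℂ 2)]
    exact Finset.sum_congr rfl fun m _ => by ring
  rw [h1, h1, ← map_pow, ← map_pow]
  simp only [map_sum, map_smul, LinearMap.sum_apply, LinearMap.smul_apply, eval_finsetSum,
    eval_smul, eval_zero_posPart_expand_right, mul_zero, Finset.sum_const_zero, zero_add,
    smul_eq_mul, Finset.mul_sum]
  rfl

theorem eq_zero_of_dirD_ctr {v : Cn (k + 2)} (h : ∀ i, evAt 0 (dirD v (ctr k i)) = 0) : v = 0 := by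
  have h0 : v 0 = 0 := (dirD_ctr_zero v).symm.trans (h 0)
  have hs : ∀ (N : ℕ) (m : Fin (k + 1)), m.1 < N → v m.succ = 0 := by
    intro N
    induction N with
    | zero => intro m hm; omega
    | succ N ih =>
      intro m hm
      rcases Nat.lt_succ_iff_lt_or_eq.1 hm with h1 | h1
      · exact ih m h1
      · have h2 := h (Fin.rev m).succ
        have hrev : k - (Fin.rev m).1 + 1 = m.1 + 1 := by
          rw [Fin.val_rev]; omega
        rw [dirD_ctr_succ h0, Finset.sum_eq_single m] at h2
        · rw [hrev] at h2
          rcases mul_eq_zero.1 h2 with h3 | h3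
          · exact absurd h3 (Nat.cast_add_one_ne_zero _)
          · exact (mul_eq_zero.1 h3).resolve_right varCoeff_ne_zero
        · intro n _ hne
          rcases lt_or_gt_of_ne hne with h3 | h3
          · rw [ih n (by have : n.1 < m.1 := h3; omega), zero_mul]
          · rw [varCoeff_eq_zero (by rw [hrev]; have : m.1 < n.1 := h3; omega), mul_zero]
        · simp
  funext i
  refine Fin.cases h0 (fun m => hs (m.1 + 1) m (Nat.lt_succ_self _)) i

theorem map_toMap_ctr_nhds :
    Filter.map (toMap (ctr k)) (𝓝 0) = 𝓝 (toMap (ctr k) 0) := by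
  have hc : ContDiffAt ℝ (⊤ : ℕ∞) (toMap (ctr k)) 0 := (contDiff_toMap (ctr k)).contDiffAt
  refine HasStrictFDerivAt.map_nhds_eq_of_surj (hc.hasStrictFDerivAt (by simp)) ?_
  have hd : ∀ v i, fderiv ℝ (toMap (ctr k)) 0 v i = evAt 0 (dirD v (ctr k i)) := by
    intro v i
    have h1 : fderiv ℝ (toMap (ctr k)) 0 = ContinuousLinearMap.pi fun i => fderiv ℝ (ctr k i).1 0 :=
      fderiv_pi fun i => (ctr k i).differentiableAt 0
    rw [h1, ContinuousLinearMap.pi_apply, fderiv_eq_sum_wirt, dirD, map_sum]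
    refine Finset.sum_congr rfl fun j _ => ?_
    rw [map_add, map_smul, map_smul]
    rfl
  refine LinearMap.range_eq_top.2 (LinearMap.injective_iff_surjective.1 ?_)
  refine (injective_iff_map_eq_zero _).2 fun v hv => eq_zero_of_dirD_ctr fun i => ?_
  rw [← hd]
  exact congrFun hv i

end Disc

namespace Disc

open Polynomial

/-- A polynomial as a holomorphic function on `ℂ`. -/
noncomputable def polyF (p : ℂ[X]) : SF 1 := aeval (coord (Sum.inl 0)) p

theorem polyF_apply (p : ℂ[X]) (x : Cn 1) : (polyF p).1 x = p.eval (x 0) := by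
  have h := aeval_algHom_apply (evAt x).toAlgHom (coord (Sum.inl 0)) p
  rw [← evAt_apply, ← coe_aeval_eq_eval]
  exact h.symm

theorem wD_inr_polyF (p : ℂ[X]) (j : Fin 1) : wD (Sum.inr j) (polyF p) = 0 := by
  rw [polyF, Derivation.map_aeval, wD_coord, if_neg (by simp), smul_zero]

variable {k : ℕ}

/-- The holomorphic disc with parameter `s`. -/
noncomputable def disc (s : Cn (k + 2)) : Fin (k + 2) → SF 1 :=
  Fin.cons (polyF (fam s)) fun j : Fin (k + 1) =>
    polyF (posPart ℂ (fam s ^ (j.1 + 1)) (fam (fun i => starRingEnd ℂ (s i)) ^ (k - j.1 + 1)))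

theorem wD_inr_disc (s : Cn (k + 2)) (i : Fin (k + 2)) (j : Fin 1) :
    wD (Sum.inr j) (disc s i) = 0 := by
  refine Fin.cases ?_ (fun m => ?_) i <;> exact wD_inr_polyF _ _

theorem toMap_disc_zero (s : Cn (k + 2)) (x : Cn 1) : toMap (disc s) x 0 = (fam s).eval (x 0) :=
  polyF_apply _ _

theorem toMap_disc_succ (s : Cn (k + 2)) (x : Cn 1) (j : Fin (k + 1)) :
    toMap (disc s) x j.succ = (posPart ℂ (fam s ^ (j.1 + 1))
      (fam (fun i => starRingEnd ℂ (s i)) ^ (k - j.1 + 1))).eval (x 0) :=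
  polyF_apply _ _

theorem toMap_disc_one (s : Cn (k + 2)) : toMap (disc s) (fun _ => 1) = 0 := by
  funext i
  refine Fin.cases ?_ (fun m => ?_) i
  · rw [toMap_disc_zero, eval_one_fam]; rfl
  · rw [toMap_disc_succ, eval_one_posPart]; rfl

theorem toMap_disc_center (s : Cn (k + 2)) : toMap (disc s) 0 = toMap (ctr k) s := by
  have h : ∀ p : (SF (k + 2))[X], evAt s (p.eval 0) = (p.map (evAt s : SF (k + 2) →+* ℂ)).eval 0 :=
    fun p => by
      have := (eval₂_at_apply (p := p) (evAt s : SF (k + 2) →+* ℂ) 0).symm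
      rwa [map_zero, eval₂_eq_eval_map] at this
  have h1 : ∀ i, evAt s (coord (Sum.inl i)) = s i := fun _ => rfl
  have h2 : ∀ i, evAt s (coord (Sum.inr i)) = starRingEnd ℂ (s i) := fun _ => rfl
  funext i
  refine Fin.cases ?_ (fun m => ?_) i
  · rw [toMap_disc_zero]
    refine Eq.trans ?_ (h _).symm
    rw [map_fam]
    rfl
  · rw [toMap_disc_succ]
    refine Eq.trans ?_ (h _).symm
    rw [map_posPart, Polynomial.map_pow, Polynomial.map_pow, map_fam, map_fam]
    rfl

theorem conj_eval (p : ℂ[X]) (ξ : ℂ) :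
    starRingEnd ℂ (p.eval ξ) = (p.map (starRingEnd ℂ)).eval (starRingEnd ℂ ξ) := by
  rw [eval_map, eval₂_at_apply]

theorem toMap_disc_boundary (s : Cn (k + 2)) {x : Cn 1} (hx : ‖x 0‖ = 1) (j : Fin (k + 1)) :
    toMap (disc s) x j.succ + starRingEnd ℂ (toMap (disc s) x (Fin.rev j).succ)
      = toMap (disc s) x 0 ^ (j.1 + 1) * starRingEnd ℂ (toMap (disc s) x 0) ^ (k + 1 - j.1) := by
  have hne : x 0 ≠ 0 := by
    intro h; simp [h] at hx
  have hinv : starRingEnd ℂ (x 0) = (x 0)⁻¹ := by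
    rw [Complex.inv_def, Complex.normSq_eq_norm_sq, hx]; simp
  have hr : (Fin.rev j).1 = k - j.1 := by rw [Fin.val_rev]; omega
  have hr' : k - (k - j.1) = j.1 := by have := j.2; omega
  rw [toMap_disc_succ, toMap_disc_succ, toMap_disc_zero, conj_eval, conj_eval, map_posPart,
    Polynomial.map_pow, Polynomial.map_pow, map_fam, map_fam, hinv, hr, hr']
  simp only [Complex.conj_conj]
  rw [eval_posPart_add hne, eval_pow, eval_pow, eval_pow, eval_one_fam,
    show k + 1 - j.1 = k - j.1 + 1 by have := j.2; omega]
  simp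

/-- A plurisubharmonic function vanishing on the model manifold, with vanishing differential at the
origin, vanishes near some point. -/
theorem eventually_re_eq_zero (f : SF (k + 2)) (hf : ∀ x ξ, 0 ≤ (leviAt f x ξ).re)
    (hN : ∀ x : Cn (k + 2), (∀ j : Fin (k + 1), x j.succ + starRingEnd ℂ (x (Fin.rev j).succ)
      = x 0 ^ (j.1 + 1) * starRingEnd ℂ (x 0) ^ (k + 1 - j.1)) → (f.1 x).re = 0)
    (hd : ∀ d, evAt 0 (wD d f) = 0) :
    ∀ᶠ x in 𝓝 (toMap (ctr k) 0), (f.1 x).re = 0 := by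
  rw [← map_toMap_ctr_nhds, Filter.eventually_map]
  refine Filter.Eventually.of_forall fun s => ?_
  have hsub : ∀ x, 0 ≤ ((wD (Sum.inl 0) (wD (Sum.inr 0) (pull (disc s) f))).1 x).re := by
    intro x
    have h := leviAt_pull (wD_inr_disc s) f x (fun _ => 1)
    have h1 : leviAt (pull (disc s) f) x (fun _ => 1)
        = (wD (Sum.inl 0) (wD (Sum.inr 0) (pull (disc s) f))).1 x := by
      simp [leviAt, evAt_apply]
    rw [← h1, h]
    exact hf _ _
  have h0 : ∀ x : Cn 1, ‖x 0‖ = 1 → ((pull (disc s) f).1 x).re = 0 := fun x hx => by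
    rw [pull_coe]
    exact hN _ fun j => toMap_disc_boundary s hx j
  have hder : ((dirD (fun _ => 1) (pull (disc s) f)).1 fun _ => 1).re = 0 := by
    have h1 : ∀ d, evAt (fun _ => 1) (wD d (pull (disc s) f)) = 0 := by
      intro d
      rw [wD_pull, map_sum]
      refine Finset.sum_eq_zero fun e _ => ?_
      rw [map_mul, evAt_apply, pull_coe, toMap_disc_one, ← evAt_apply, hd, zero_mul]
    rw [← evAt_apply, dirD, map_sum, Finset.sum_eq_zero, Complex.zero_re]
    intro j _
    rw [map_add, map_smul, map_smul, h1, h1]; simp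
  have hle := re_nonpos_of_disc _ hsub h0 (x := 0) (by simp)
  have hge := re_nonneg_of_disc _ hsub h0 hder
  rw [pull_coe, toMap_disc_center] at hle hge
  exact le_antisymm hle hge

end Disc

namespace Model

open MvPolynomial

theorem evAt_zero_aeval {n : ℕ} {σ : Type*} {g : σ → SF n} (hg : ∀ s, evAt 0 (g s) = 0)
    (P : MvPolynomial σ ℂ) : evAt 0 (aeval g P) = constantCoeff P := by
  have : (evAt (0 : Cn n) : SF n →+* ℂ).comp (aeval g : MvPolynomial σ ℂ →ₐ[ℂ] SF n)
      = (constantCoeff : MvPolynomial σ ℂ →+* ℂ) := by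
    refine MvPolynomial.ringHom_ext (fun c => ?_) fun s => ?_
    · change evAt 0 (aeval g (C c)) = _
      rw [aeval_C, AlgHomClass.commutes, constantCoeff_C]; rfl
    · change evAt 0 (aeval g (X s)) = _
      rw [aeval_X, hg, constantCoeff_X]
  exact congrArg (fun f => f P) this

theorem ringHom_aeval {σ : Type*} {A B : Type*} [CommRing A] [CommRing B] [Algebra ℂ A]
    [Algebra ℂ B] (φ : A →ₐ[ℂ] B) (g : σ → A) (P : MvPolynomial σ ℂ) :
    φ (aeval g P) = aeval (fun s => φ (g s)) P := by
  have : φ.comp (aeval g) = aeval fun s => φ (g s) := algHom_ext fun s => by simp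
  exact congrArg (fun f => f P) this

/-- A polynomial in two variables and their conjugates as a smooth function. -/
noncomputable def pv {n : ℕ} (ι : Fin 2 → Fin n) : R2 →ₐ[ℂ] SF n :=
  aeval fun d => coord (d.map ι ι)

theorem pv_apply {n : ℕ} (ι : Fin 2 → Fin n) (P : R2) (x : Cn n) :
    (pv ι P).1 x = evR (fun i => x (ι i)) P := by
  have h := ringHom_aeval (evAt x).toAlgHom (fun d : Fin 2 ⊕ Fin 2 => coord (d.map ι ι)) P
  rw [← evAt_apply]
  refine h.trans ?_
  rw [evR, aeval_eq_eval]
  refine congrArg (fun g => eval g P) (funext fun d => ?_)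
  rcases d with i | i <;> rfl

theorem pv_star {n : ℕ} (ι : Fin 2 → Fin n) (P : R2) : star (pv ι P) = pv ι (starR P) := by
  ext x
  rw [pv_apply, evR_starR, ← pv_apply]
  rfl

theorem wD_pv {n : ℕ} {ι : Fin 2 → Fin n} (hι : Function.Injective ι) (d : Fin 2 ⊕ Fin 2) (P : R2) :
    wD (d.map ι ι) (pv ι P) = pv ι (pderiv d P) := by
  rw [pv, derivation_aeval, Finset.sum_eq_single d]
  · rw [wD_coord, if_pos rfl, mul_one]
  · intro e _ he
    rw [wD_coord, if_neg, mul_zero]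
    intro h
    exact he ((Sum.map_injective.2 ⟨hι, hι⟩) h).symm
  · simp

theorem wD_pv_eq_zero {n : ℕ} {ι : Fin 2 → Fin n} {d : Fin n ⊕ Fin n}
    (hd : ∀ e : Fin 2 ⊕ Fin 2, d ≠ e.map ι ι) (P : R2) : wD d (pv ι P) = 0 := by
  rw [pv, derivation_aeval]
  exact Finset.sum_eq_zero fun e _ => by rw [wD_coord, if_neg (hd e), mul_zero]

theorem leviAt_pv (F : R2) (y ξ : Cn 2) : leviAt (pv id F) y ξ
    = ∑ i, ∑ j, evR y (hess F i j) * ξ i * starRingEnd ℂ (ξ j) := by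
  refine Finset.sum_congr rfl fun i _ => Finset.sum_congr rfl fun j _ => ?_
  have h1 := wD_pv Function.injective_id (Sum.inr j) F
  have h2 := wD_pv Function.injective_id (Sum.inl i) (pderiv (Sum.inr j) F)
  rw [Sum.map_inr, id] at h1
  rw [Sum.map_inl, id] at h2
  rw [h1, h2, evAt_apply, pv_apply]
  rfl

theorem eq_zero_of_eventually {p : R2} {y₀ : Fin 2 → ℂ} (h : ∀ᶠ y in 𝓝 y₀, evR y p = 0) :
    p = 0 := by
  let θ : R2 →ₐ[ℂ] R2 := aeval (Sum.elim (fun i => X (Sum.inl i) + C Complex.I * X (Sum.inr i))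
    fun i => X (Sum.inl i) - C Complex.I * X (Sum.inr i))
  let θ' : R2 →ₐ[ℂ] R2 := aeval (Sum.elim (fun i => C (1 / 2) * (X (Sum.inl i) + X (Sum.inr i)))
    fun i => C (-Complex.I / 2) * (X (Sum.inl i) - X (Sum.inr i)))
  have hI : (C Complex.I * C Complex.I : R2) = -1 := by
    rw [← C_mul, Complex.I_mul_I]; simp
  have h2 : (C (1 / 2) * 2 : R2) = 1 := by
    rw [← map_ofNat C 2, ← C_mul]; norm_num
  have hI3 : (C (-Complex.I / 2) : R2) = - (C Complex.I * C (1 / 2)) := by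
    rw [← C_mul, ← C_neg]; congr 1; ring
  have hθC : ∀ c, θ' (C c) = C c := fun c => by simp [θ']
  have hl : ∀ i, θ' (X (Sum.inl i)) = C (1 / 2) * (X (Sum.inl i) + X (Sum.inr i)) := fun i => by
    simp [θ']
  have hr : ∀ i, θ' (X (Sum.inr i)) = C (-Complex.I / 2) * (X (Sum.inl i) - X (Sum.inr i)) :=
    fun i => by simp [θ']
  have hinv : ∀ p, θ' (θ p) = p := by
    have : θ'.comp θ = AlgHom.id ℂ _ := by
      refine algHom_ext fun d => ?_
      rcases d with i | i
      · have : θ (X (Sum.inl i)) = X (Sum.inl i) + C Complex.I * X (Sum.inr i) := by simp [θ]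
        rw [AlgHom.comp_apply, this, map_add, map_mul, hl, hr, hθC, hI3, AlgHom.id_apply]
        linear_combination (-(C (1 / 2)) * (X (Sum.inl i) - X (Sum.inr i))) * hI
          + X (Sum.inl i) * h2
      · have : θ (X (Sum.inr i)) = X (Sum.inl i) - C Complex.I * X (Sum.inr i) := by simp [θ]
        rw [AlgHom.comp_apply, this, map_sub, map_mul, hl, hr, hθC, hI3, AlgHom.id_apply]
        linear_combination (C (1 / 2) * (X (Sum.inl i) - X (Sum.inr i))) * hI
          + X (Sum.inr i) * h2
    intro p
    exact congrArg (fun f => f p) this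
  obtain ⟨ε, hε, hball⟩ := Metric.eventually_nhds_iff.1 h
  have hθ : θ p = 0 := by
    refine MvPolynomial.funext_set
      (Sum.elim (fun i => (↑) '' Set.Ioo (y₀ i).re ((y₀ i).re + ε / 2))
        fun i => ((↑) : ℝ → ℂ) '' Set.Ioo (y₀ i).im ((y₀ i).im + ε / 2)) ?_ fun x hx => ?_
    · rintro (i | i) <;>
      exact (Set.Ioo_infinite (by linarith)).image Complex.ofReal_injective.injOn
    rw [map_zero]
    have hx1 : ∀ i, ∃ t : ℝ, t ∈ Set.Ioo (y₀ i).re ((y₀ i).re + ε / 2) ∧ (t : ℂ) = x (Sum.inl i) :=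
      fun i => hx (Sum.inl i) trivial
    have hx2 : ∀ i, ∃ t : ℝ, t ∈ Set.Ioo (y₀ i).im ((y₀ i).im + ε / 2) ∧ (t : ℂ) = x (Sum.inr i) :=
      fun i => hx (Sum.inr i) trivial
    choose t ht htx using hx1
    choose s hs hsx using hx2
    have hy : eval x (θ p) = evR (fun i => t i + Complex.I * s i) p := by
      have : (eval x).comp (θ : R2 →+* R2) = evR (fun i => t i + Complex.I * s i) := by
        refine MvPolynomial.ringHom_ext (fun c => by simp [evR]) ?_
        rintro (i | i)
        · simp [evR, θ, htx, hsx]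
        · simp [evR, θ, ← htx, ← hsx, sub_eq_add_neg]
      exact congrArg (fun f => f p) this
    rw [hy]
    refine hball ((dist_pi_lt_iff hε).2 fun i => ?_)
    rw [Complex.dist_eq]
    have e1 : (t i + Complex.I * s i - y₀ i : ℂ)
        = ((t i - (y₀ i).re : ℝ) : ℂ) + ((s i - (y₀ i).im : ℝ) : ℂ) * Complex.I := by
      apply Complex.ext <;> simp
    rw [e1]
    refine (norm_add_le _ _).trans_lt ?_
    rw [norm_mul, Complex.norm_I, mul_one, Complex.norm_real, Complex.norm_real, Real.norm_eq_abs,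
      Real.norm_eq_abs, abs_of_pos (by linarith [(ht i).1]), abs_of_pos (by linarith [(hs i).1])]
    linarith [(ht i).2, (hs i).2]
  rw [← hinv p, hθ, map_zero]

theorem wD_eventually_eq_zero {n : ℕ} {f : SF n} {c : Cn n} (h : ∀ᶠ x in 𝓝 c, f.1 x = 0)
    (d : Fin n ⊕ Fin n) : ∀ᶠ x in 𝓝 c, (wD d f).1 x = 0 := by
  filter_upwards [h.eventually_nhds] with x hx
  have h1 : f.1 =ᶠ[𝓝 x] fun _ => 0 := hx
  rw [wD_coe, wirt_eq, h1.fderiv_eq]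
  simp

variable {k : ℕ} {b : Fin (k + 1) → ℂ}

/-- The coordinates of the original space in terms of the extended ones. -/
noncomputable def proj (b : Fin (k + 1) → ℂ) : Fin 2 → SF (k + 2) :=
  ![coord (Sum.inl 0), ∑ j : Fin (k + 1), b j • coord (Sum.inl j.succ)]

/-- The functions substituted for the variables `z, w, Y_j`. -/
noncomputable def liftVar (k : ℕ) : Fin 2 ⊕ Fin (k + 1) → SF (k + 2) :=
  Sum.elim ![coord (Sum.inl 0), coord (Sum.inr 0)] fun j => coord (Sum.inl j.succ)

theorem wD_inr_lift {P : SR k} (hP : Lb P = 0) (j : Fin (k + 2)) :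
    wD (Sum.inr j) (aeval (liftVar k) P) = 0 := by
  rw [derivation_aeval, Fintype.sum_sum_type, Fin.sum_univ_two]
  have h1 : pderiv (Sum.inl 1) P = 0 := hP
  simp [liftVar, wD_coord, h1]

theorem wD_inr_proj (i : Fin 2) (j : Fin (k + 2)) : wD (Sum.inr j) (proj b i) = 0 := by
  fin_cases i <;> simp [proj, wD_coord, Derivation.map_smul]

theorem toMap_proj (x : Cn (k + 2)) : toMap (proj b) x = ![x 0, ∑ j, b j * x j.succ] := by
  funext i
  fin_cases i
  · rfl
  · change evAt x (∑ j : Fin (k + 1), b j • coord (Sum.inl j.succ)) = _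
    rw [map_sum]
    simp only [map_smul]
    rfl

theorem jac_proj (x ξ : Cn (k + 2)) : jac (proj b) x ξ = ![ξ 0, ∑ j, b j * ξ j.succ] := by
  funext i
  fin_cases i
  · simp [jac, proj, wD_coord, Finset.sum_ite_eq', apply_ite]
  · have h : ∀ i, evAt x (wD (Sum.inl i) (proj b 1)) = Fin.cons (α := fun _ => ℂ) 0 b i := by
      intro i
      change evAt x (wD (Sum.inl i) (∑ j : Fin (k + 1), b j • coord (Sum.inl j.succ))) = _
      simp only [map_sum, Derivation.map_smul, map_smul, wD_coord, Sum.inl.injEq]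
      refine Fin.cases ?_ (fun m => ?_) i
      · simp [Fin.succ_ne_zero, eq_comm]
      · simp [apply_ite]
    simp [jac, h, Fin.sum_univ_succ (n := k + 1), mul_comm]

/-- The function of the extended coordinates which vanishes on the model manifold. -/
noncomputable def diffFun (b : Fin (k + 1) → ℂ) (F : R2) (P : SR k) : SF (k + 2) :=
  pull (proj b) (pv id F)
    - (1 / 2 : ℂ) • (aeval (liftVar k) P + star (aeval (liftVar k) P))

theorem leviAt_diffFun {F : R2} {P : SR k} (hP : Lb P = 0) (x ξ : Cn (k + 2)) :
    leviAt (diffFun b F P) x ξ = ∑ i, ∑ j, evR (toMap (proj b) x) (hess F i j)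
      * jac (proj b) x ξ i * starRingEnd ℂ (jac (proj b) x ξ j) := by
  rw [← leviAt_pv, ← leviAt_pull wD_inr_proj]
  refine Finset.sum_congr rfl fun i _ => Finset.sum_congr rfl fun j _ => ?_
  have h1 : wD (Sum.inl i) (wD (Sum.inr j) (star (aeval (liftVar k) P))) = 0 := by
    rw [wD_comm, wD_star, Sum.swap_inl, wD_inr_lift hP]; simp
  rw [diffFun, map_sub, map_sub, Derivation.map_smul, Derivation.map_smul, map_add, map_add,
    wD_inr_lift hP, h1, map_zero, add_zero, smul_zero, sub_zero]

theorem evAt_zero_wD_diffFun {W : ℕ} (hW : k + 2 < W) {F : R2} (hF : ZHom (w2 k) F W) {P : SR k}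
    (hPz : ZHom (sw k) P W) (d) : evAt 0 (wD d (diffFun b F P)) = 0 := by
  have hpos : ∀ {σ : Type} {w : σ → ℕ} {Q : MvPolynomial σ ℂ} {s : σ}, ZHom w Q W → w s ≤ k + 2 →
      constantCoeff (pderiv s Q) = 0 := by
    intro σ w Q s hQ hs
    exact (hQ.pderiv s).constantCoeff_eq_zero (by omega)
  have h1 : ∀ d, evAt 0 (wD d (aeval (liftVar k) P)) = 0 := by
    intro d
    rw [derivation_aeval, map_sum]
    refine Finset.sum_eq_zero fun s _ => ?_
    rw [map_mul, evAt_zero_aeval, hpos hPz, zero_mul]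
    · rcases s with i | j
      · change 1 ≤ _; omega
      · exact le_rfl
    · rintro (i | j)
      · fin_cases i
        · rfl
        · exact map_zero (starRingEnd ℂ)
      · rfl
  have h2 : ∀ e, evAt (0 : Cn 2) (wD e (pv id F)) = 0 := by
    intro e
    have h3 := wD_pv Function.injective_id e F
    rw [Sum.map_id_id, id] at h3
    rw [h3, pv, evAt_zero_aeval, hpos hF]
    · rcases e with i | i <;> fin_cases i <;> simp [w2]
    · rintro (i | i)
      · rfl
      · exact map_zero (starRingEnd ℂ)
  have h3 : toMap (proj b) (0 : Cn (k + 2)) = 0 := by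
    rw [toMap_proj]
    funext i
    fin_cases i <;> simp
  rw [diffFun, map_sub, map_sub, Derivation.map_smul, map_smul, map_add, map_add, h1, wD_star,
    map_star, h1, star_zero, add_zero, smul_zero, sub_zero, wD_pull, map_sum]
  refine Finset.sum_eq_zero fun e _ => ?_
  rw [map_mul, evAt_apply, pull_coe, h3, ← evAt_apply, h2, zero_mul]

theorem diffFun_eq_zero {F : R2} {P : SR k} (hPF : P + starS P = C 2 * toS b F) {x : Cn (k + 2)}
    (hx : ∀ j : Fin (k + 1), x j.succ + starRingEnd ℂ (x (Fin.rev j).succ)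
      = x 0 ^ (j.1 + 1) * starRingEnd ℂ (x 0) ^ (k + 1 - j.1)) : (diffFun b F P).1 x = 0 := by
  set y : Fin 2 ⊕ Fin (k + 1) → ℂ := Sum.elim ![x 0, starRingEnd ℂ (x 0)] fun j => x j.succ with hy
  have hyN : y ∈ Nhat k := ⟨rfl, hx⟩
  have h1 : evAt x (aeval (liftVar k) P) = eval y P := by
    refine (ringHom_aeval (evAt x).toAlgHom (liftVar k) P).trans ?_
    rw [aeval_eq_eval]
    refine congrArg (fun g => eval g P) (funext fun d => ?_)
    rcases d with i | i
    · fin_cases i <;> rfl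
    · rfl
  have h2 := congrArg (eval y) hPF
  rw [map_add, map_mul, eval_C, eval_starS hyN, eval_toS b hyN] at h2
  rw [← evAt_apply, diffFun, map_sub, map_smul, map_add, map_star, h1, evAt_apply, pull_coe,
    pv_apply, toMap_proj]
  change _ - (1 / 2 : ℂ) • (_ + starRingEnd ℂ (eval y P)) = 0
  rw [h2, smul_eq_mul, ← mul_assoc, one_div_mul_cancel two_ne_zero, one_mul]
  exact sub_self _

theorem star_diffFun {F : R2} (hs : starR F = F) (P : SR k) :
    star (diffFun b F P) = diffFun b F P := by
  have h2 : star (1 / 2 : ℂ) = 1 / 2 := by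
    change starRingEnd ℂ (1 / 2) = _
    rw [map_div₀, map_one, map_ofNat (starRingEnd ℂ) 2]
  rw [diffFun, star_sub, star_smul, star_add, star_star, ← map_star, pv_star, hs, h2,
    add_comm (star _)]

/-- A plurisubharmonic weighted homogeneous polynomial whose restriction to the model manifold is
the real part of a CR polynomial is pluriharmonic. -/
theorem hess_eq_zero (hb : b ≠ 0) {W : ℕ} (hW : k + 2 < W) {F : R2} (hF : ZHom (w2 k) F W)
    (hs : starR F = F) (hpsh : PshR F) {P : SR k} (hPz : ZHom (sw k) P W) (hP : Lb P = 0)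
    (hPF : P + starS P = C 2 * toS b F) (i j : Fin 2) : hess F i j = 0 := by
  set c := toMap (Disc.ctr k) 0
  obtain ⟨j₀, hj₀⟩ := Function.ne_iff.1 hb
  have h1 : ∀ᶠ x in 𝓝 c, (diffFun b F P).1 x = 0 := by
    refine (Disc.eventually_re_eq_zero (diffFun b F P) (fun x ξ => ?_) (fun x hx => ?_)
      (evAt_zero_wD_diffFun hW hF hPz)).mono fun x hx => ?_
    · rw [leviAt_diffFun hP]; exact hpsh _ _
    · rw [diffFun_eq_zero hPF hx, Complex.zero_re]
    · have h2 : starRingEnd ℂ ((diffFun b F P).1 x) = (diffFun b F P).1 x :=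
        congrArg (fun f : SF (k + 2) => f.1 x) (star_diffFun hs P)
      exact Complex.ext hx (Complex.conj_eq_iff_im.1 h2)
  have h2 : ∀ᶠ x in 𝓝 c, ∀ ξ, leviAt (diffFun b F P) x ξ = 0 := by
    have h3 : ∀ᶠ x in 𝓝 c, ∀ i j, evAt x (wD (Sum.inl i) (wD (Sum.inr j) (diffFun b F P))) = 0 :=
      Filter.eventually_all.2 fun i => Filter.eventually_all.2 fun j =>
        wD_eventually_eq_zero (wD_eventually_eq_zero h1 (Sum.inr j)) (Sum.inl i)
    filter_upwards [h3] with x hx ξ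
    simp [leviAt, hx]
  let sec : Cn 2 → Cn (k + 2) := fun y i =>
    c i + Fin.cons (α := fun _ => ℂ) (y 0 - toMap (proj b) c 0)
      (Pi.single j₀ ((y 1 - toMap (proj b) c 1) / b j₀)) i
  have hsec : Continuous sec := by
    refine continuous_pi fun i => continuous_const.add ?_
    refine Fin.cases ?_ (fun m => ?_) i
    · simp only [Fin.cons_zero]; fun_prop
    · simp only [Fin.cons_succ]
      by_cases hm : m = j₀
      · subst hm; simp only [Pi.single_eq_same]; fun_prop
      · simp only [Pi.single_eq_of_ne hm]; fun_prop
  have hsec0 : sec (toMap (proj b) c) = c := by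
    funext i
    refine Fin.cases ?_ (fun m => ?_) i <;> simp [sec]
  have hproj : ∀ y, toMap (proj b) (sec y) = y := by
    intro y
    rw [toMap_proj]
    funext i
    fin_cases i
    · simp [sec, toMap_proj]
    · simp only [sec, Fin.cons_succ, mul_add, Finset.sum_add_distrib]
      simp [Pi.single_apply, toMap_proj, mul_div_cancel₀ _ hj₀]
  refine eq_zero_of_eventually (y₀ := toMap (proj b) c) ?_
  have h4 : ∀ᶠ y in 𝓝 (toMap (proj b) c), ∀ ξ, leviAt (diffFun b F P) (sec y) ξ = 0 := by
    have h3 := hsec.tendsto (toMap (proj b) c)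
    rw [hsec0] at h3
    exact h3.eventually h2
  filter_upwards [h4] with y hy
  have h5 : ∀ η : Fin 2 → ℂ, ∑ i, ∑ j, evR y (hess F i j) * η i * starRingEnd ℂ (η j) = 0 := by
    intro η
    have h6 := hy (Fin.cons (η 0) (Pi.single j₀ (η 1 / b j₀)))
    rw [leviAt_diffFun hP, hproj, jac_proj] at h6
    have h7 : (![(Fin.cons (η 0) (Pi.single j₀ (η 1 / b j₀)) : Cn (k + 2)) 0, ∑ j, b j *
        (Fin.cons (η 0) (Pi.single j₀ (η 1 / b j₀)) : Cn (k + 2)) j.succ] : Fin 2 → ℂ) = η := by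
      funext i
      fin_cases i
      · simp
      · simp [Pi.single_apply, mul_div_cancel₀ _ hj₀]
    rwa [h7] at h6
  have h8 := eq_zero_of_psd (H := fun i j => evR y (hess F i j))
    (fun i j => by rw [← evR_starR, starR_hess hs]) (fun ξ => hpsh y ξ) (h5 (Pi.single j 1)) i
  simpa [Pi.single_apply, apply_ite] using h8

end Model

namespace Model

open MvPolynomial

/-- The weights of the coordinates of `ℂ³`. -/
def om (k W : ℕ) : Fin 3 → ℕ := ![1, k + 2, W]

/-- The directions in `ℂ³` corresponding to the first two variables. -/
def dm (e : Fin 2 ⊕ Fin 2) : Fin 3 ⊕ Fin 3 := e.map Fin.castSucc Fin.castSucc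

theorem forall_dm {Q : Fin 3 ⊕ Fin 3 → Prop} :
    (∀ d, Q d) ↔ (∀ e, Q (dm e)) ∧ Q (Sum.inl 2) ∧ Q (Sum.inr 2) := by
  refine ⟨fun h => ⟨fun e => h _, h _, h _⟩, fun ⟨h, h1, h2⟩ d => ?_⟩
  rcases d with i | i
  · fin_cases i
    · exact h (Sum.inl 0)
    · exact h (Sum.inl 1)
    · exact h1
  · fin_cases i
    · exact h (Sum.inr 0)
    · exact h (Sum.inr 1)
    · exact h2

/-- Polynomials in the first two variables as functions on `ℂ³`. -/
noncomputable abbrev p3 : R2 →ₐ[ℂ] SF 3 := pv Fin.castSucc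

variable {k W : ℕ}

theorem dwt_dm (e : Fin 2 ⊕ Fin 2) : dwt (om k W) (dm e) = w2 k e := by
  rcases e with i | i <;> fin_cases i <;> rfl

theorem dwt_inl_two : dwt (om k W) (Sum.inl 2) = W := rfl

theorem dwt_inr_two : dwt (om k W) (Sum.inr 2) = W := rfl

theorem w2_pos (e : Fin 2 ⊕ Fin 2) : 0 < w2 k e := by
  rcases e with i | i <;> fin_cases i <;> simp [w2]

theorem wD_p3 (e : Fin 2 ⊕ Fin 2) (P : R2) : wD (dm e) (p3 P) = p3 (pderiv e P) :=
  wD_pv (Fin.castSucc_injective _) e P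

theorem wD_inl_two_p3 (P : R2) : wD (Sum.inl 2) (p3 P) = 0 :=
  wD_pv_eq_zero (by rintro (e | e) <;> fin_cases e <;> simp) P

theorem wD_inr_two_p3 (P : R2) : wD (Sum.inr 2) (p3 P) = 0 :=
  wD_pv_eq_zero (by rintro (e | e) <;> fin_cases e <;> simp) P

theorem evAt_zero_p3 (P : R2) : evAt 0 (p3 P) = constantCoeff P :=
  evAt_zero_aeval (fun s => by
    rcases s with i | i
    · rfl
    · exact map_zero (starRingEnd ℂ)) P

theorem p3_mem_fil {P : R2} {m : ℤ} (hP : ZHom (w2 k) P m) : p3 P ∈ fil (om k W) m := by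
  by_cases hm : m ≤ 0
  · exact mem_fil_of_nonpos hm _
  refine mem_fil_iff.2 ⟨fun _ => ?_, forall_dm.2 ⟨fun e => ?_, ?_, ?_⟩⟩
  · rw [evAt_zero_p3, hP.constantCoeff_eq_zero (by omega)]
  · have := w2_pos (k := k) e
    rw [wD_p3, dwt_dm]
    exact p3_mem_fil (hP.pderiv e)
  · rw [wD_inl_two_p3]; exact Submodule.zero_mem _
  · rw [wD_inr_two_p3]; exact Submodule.zero_mem _
termination_by m.toNat
decreasing_by omega

theorem mem_fil_one {n : ℕ} {ω : Fin n → ℕ} (hω : ∀ i, 0 < ω i) {f : SF n} (hf : evAt 0 f = 0) :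
    f ∈ fil ω 1 := by
  refine mem_fil_iff.2 ⟨fun _ => hf, fun d => mem_fil_of_nonpos ?_ _⟩
  have := hω (widx d)
  simp only [dwt]
  omega

theorem eq_zero_of_p3_mem {P : R2} {m : ℤ} (hP : ZHom (w2 k) P m)
    (h : p3 P ∈ fil (om k W) (m + 1)) : P = 0 := by
  rcases lt_trichotomy m 0 with hm | rfl | hm
  · exact hP.eq_zero_of_neg hm
  · rw [hP.eq_C w2_pos, ← evAt_zero_p3, evAt_eq_zero_of_mem h (by norm_num), C_0]
  · refine hP.eq_zero_of_pderiv hm.ne' fun e => ?_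
    have := w2_pos (k := k) e
    refine eq_zero_of_p3_mem (hP.pderiv e) ?_
    have h1 := wD_mem_fil (dm e) h
    rw [wD_p3, dwt_dm] at h1
    exact fil_mono (by omega) h1
termination_by m.toNat
decreasing_by omega

/-- `P` is the part of weight `m` of the function `f`, which has weighted order at least `m`. -/
def Lead (k W : ℕ) (m : ℤ) (f : SF 3) (P : R2) : Prop :=
  ZHom (w2 k) P m ∧ f - p3 P ∈ fil (om k W) (m + 1)

namespace Lead

variable {m n : ℤ} {f g : SF 3} {P Q : R2}

theorem mem (h : Lead k W m f P) : f ∈ fil (om k W) m := by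
  have := Submodule.add_mem _ (fil_mono (by omega) h.2) (p3_mem_fil h.1)
  rwa [sub_add_cancel] at this

theorem unique (h : Lead k W m f P) (h' : Lead k W m f Q) : P = Q := by
  refine sub_eq_zero.1 (eq_zero_of_p3_mem (k := k) (W := W) (h.1.sub h'.1) ?_)
  have := Submodule.sub_mem _ h'.2 h.2
  rwa [sub_sub_sub_cancel_left, ← map_sub] at this

theorem of_p3 (hP : ZHom (w2 k) P m) : Lead k W m (p3 P) P :=
  ⟨hP, by rw [sub_self]; exact Submodule.zero_mem _⟩

theorem of_mem (hf : f ∈ fil (om k W) (m + 1)) : Lead k W m f 0 :=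
  ⟨ZHom.zero, by rwa [map_zero, sub_zero]⟩

theorem add (hf : Lead k W m f P) (hg : Lead k W m g Q) : Lead k W m (f + g) (P + Q) :=
  ⟨hf.1.add hg.1, by rw [map_add, add_sub_add_comm]; exact Submodule.add_mem _ hf.2 hg.2⟩

theorem sub (hf : Lead k W m f P) (hg : Lead k W m g Q) : Lead k W m (f - g) (P - Q) :=
  ⟨hf.1.sub hg.1, by rw [map_sub, sub_sub_sub_comm]; exact Submodule.sub_mem _ hf.2 hg.2⟩

theorem neg (hf : Lead k W m f P) : Lead k W m (-f) (-P) := by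
  have := (of_mem (Submodule.zero_mem _)).sub hf
  rwa [zero_sub, zero_sub] at this

theorem add_mem (hf : Lead k W m f P) (hg : g ∈ fil (om k W) (m + 1)) : Lead k W m (f + g) P := by
  have := hf.add (of_mem hg)
  rwa [add_zero] at this

theorem sum {ι : Type*} {s : Finset ι} {f : ι → SF 3} {P : ι → R2}
    (h : ∀ i ∈ s, Lead k W m (f i) (P i)) : Lead k W m (∑ i ∈ s, f i) (∑ i ∈ s, P i) :=
  ⟨ZHom.sum fun i hi => (h i hi).1, by
    rw [map_sum, ← Finset.sum_sub_distrib]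
    exact Submodule.sum_mem _ fun i hi => (h i hi).2⟩

theorem mul (hf : Lead k W m f P) (hg : Lead k W n g Q) : Lead k W (m + n) (f * g) (P * Q) := by
  refine ⟨hf.1.mul hg.1, ?_⟩
  have e : f * g - p3 (P * Q) = (f - p3 P) * g + p3 P * (g - p3 Q) := by
    rw [map_mul]; ring
  rw [e]
  exact Submodule.add_mem _ (mul_mem_fil' hf.2 hg.mem (by omega))
    (mul_mem_fil' (p3_mem_fil hf.1) hg.2 (by omega))

theorem mul' {l : ℤ} (hf : Lead k W m f P) (hg : Lead k W n g Q) (hl : m + n = l) :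
    Lead k W l (f * g) (P * Q) := hl ▸ hf.mul hg

theorem wD (h : Lead k W m f P) (e : Fin 2 ⊕ Fin 2) :
    Lead k W (m - w2 k e) (wD (dm e) f) (pderiv e P) := by
  refine ⟨h.1.pderiv e, ?_⟩
  have := wD_mem_fil (dm e) h.2
  rw [map_sub, wD_p3, dwt_dm] at this
  exact fil_mono (by omega) this

theorem wD_inl_two (h : Lead k W m f P) : _root_.wD (Sum.inl 2) f ∈ fil (om k W) (m + 1 - W) := by
  have := wD_mem_fil (Sum.inl 2) h.2
  rwa [map_sub, wD_inl_two_p3, sub_zero] at this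

theorem wD_inr_two (h : Lead k W m f P) : _root_.wD (Sum.inr 2) f ∈ fil (om k W) (m + 1 - W) := by
  have := wD_mem_fil (Sum.inr 2) h.2
  rwa [map_sub, wD_inr_two_p3, sub_zero] at this

theorem evAt (h : Lead k W 0 f P) : evAt 0 f = constantCoeff P := by
  have := evAt_eq_zero_of_mem h.2 (by norm_num)
  rwa [map_sub, sub_eq_zero, evAt_zero_p3] at this

end Lead

theorem Lead.star {m : ℤ} {f : SF 3} {P : R2} (h : Lead k W m f P) :
    Lead k W m (star f) (starR P) := by
  refine ⟨zhom_starR h.1, ?_⟩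
  have := star_mem_fil h.2
  rwa [star_sub, pv_star] at this

theorem exists_lead (hW : 0 < W) {f : SF 3} {n : ℤ} (hn : n ≤ W) (hf : f ∈ fil (om k W) n)
    (h : n = W → evAt 0 (wD (Sum.inl 2) f) = 0 ∧ evAt 0 (wD (Sum.inr 2) f) = 0) :
    ∃ P, Lead k W n f P := by
  have hω : ∀ i, 0 < om k W i := by intro i; fin_cases i <;> simp [om, hW]
  rcases lt_trichotomy n 0 with hn0 | rfl | hn0
  · exact ⟨0, Lead.of_mem (mem_fil_of_nonpos (by omega) f)⟩
  · refine ⟨C (evAt 0 f), ZHom.C _, ?_⟩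
    rw [zero_add]
    refine mem_fil_one hω ?_
    rw [map_sub, evAt_zero_p3, constantCoeff_C, sub_self]
  have H : ∀ e, ∃ P, Lead k W (n - w2 k e) (wD (dm e) f) P := fun e => by
    have := w2_pos (k := k) e
    refine exists_lead hW (by omega) ?_ (by omega)
    have := wD_mem_fil (dm e) hf
    rwa [dwt_dm] at this
  choose P hP using H
  have hcomm : ∀ d e, pderiv d (P e) = pderiv e (P d) := fun d e => by
    have h1 := (hP e).wD d
    have h2 := (hP d).wD e
    rw [wD_comm, sub_right_comm] at h1
    exact h1.unique h2
  have hn' : (n : ℂ) ≠ 0 := by exact_mod_cast hn0.ne'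
  let p : R2 := (1 / n : ℂ) • ∑ i, (w2 k i : ℂ) • (X i * P i)
  have hpz : ZHom (w2 k) p n := (ZHom.sum fun i _ =>
    (((ZHom.X i).mul' (hP i).1 (by omega))).smul _).smul _
  have hpd : ∀ e, pderiv e p = P e := fun e => by
    have he := (hP e).1.euler
    have : pderiv e (∑ i, (w2 k i : ℂ) • (X i * P i)) = (n : ℂ) • P e := by
      rw [map_sum]
      simp only [Derivation.map_smul, Derivation.leibniz, smul_eq_mul, hcomm e, smul_add,
        Finset.sum_add_distrib, he]
      rw [Finset.sum_eq_single e]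
      · rw [pderiv_X_self, mul_one, ← add_smul]
        congr 1; push_cast; ring
      · intro i _ hi
        rw [pderiv_X_of_ne hi, mul_zero, smul_zero]
      · simp
    simp only [p]
    rw [Derivation.map_smul, this, smul_smul, one_div_mul_cancel hn', one_smul]
  refine ⟨p, hpz, mem_fil_iff.2 ⟨fun _ => ?_, forall_dm.2 ⟨fun e => ?_, ?_, ?_⟩⟩⟩
  · rw [map_sub, evAt_zero_p3, hpz.constantCoeff_eq_zero hn0.ne', evAt_eq_zero_of_mem hf hn0,
      sub_zero]
  · rw [map_sub, wD_p3, hpd, dwt_dm]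
    exact fil_mono (by omega) (hP e).2
  · rw [map_sub, wD_inl_two_p3, sub_zero, dwt_inl_two]
    by_cases hnW : n = W
    · exact fil_mono (by omega) (mem_fil_one hω (h hnW).1)
    · exact mem_fil_of_nonpos (by omega) _
  · rw [map_sub, wD_inr_two_p3, sub_zero, dwt_inr_two]
    by_cases hnW : n = W
    · exact fil_mono (by omega) (mem_fil_one hω (h hnW).2)
    · exact mem_fil_of_nonpos (by omega) _
termination_by n.toNat
decreasing_by omega

end Model

namespace Model

open MvPolynomial

variable {k W : ℕ} {b : Fin (k + 1) → ℂ}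

theorem pderiv_A0 {d : Fin 2 ⊕ Fin 2} (h0 : d ≠ Sum.inl 0) (h1 : d ≠ Sum.inr 0) :
    pderiv d (A0 b) = 0 := by
  simp [A0, Derivation.leibniz, Derivation.leibniz_pow, pderiv_X_of_ne h0.symm,
    pderiv_X_of_ne h1.symm]

/-- `L` has the leading part `L0 b`. -/
structure LeadField (k W : ℕ) (b : Fin (k + 1) → ℂ) (F : R2) (a : Fin 3 → SF 3) : Prop where
  h0 : Lead k W 0 (a 0) 1
  h1 : Lead k W (k + 1) (a 1) (A0 b)
  h2 : Lead k W (W - 1) (a 2) (C 2 * L0 b F)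

namespace LeadField

variable {F : R2} {a : Fin 3 → SF 3}

theorem mem (h : LeadField k W b F a) (j : Fin 3) : a j ∈ fil (om k W) (om k W j - 1) := by
  fin_cases j
  · exact fil_mono (by simp [om]) h.h0.mem
  · exact fil_mono (by simp [om]; omega) h.h1.mem
  · exact fil_mono (by simp [om]) h.h2.mem

theorem lead (h : LeadField k W b F a) (i : Fin 2) :
    Lead k W (w2 k (Sum.inl i) - 1) (a i.castSucc) (![1, A0 b] i) := by
  fin_cases i
  · have := h.h0
    exact this
  · have := h.h1
    have e : (k : ℤ) + 1 = (w2 k (Sum.inl 1) : ℤ) - 1 := by simp [w2]; ring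
    rw [e] at this
    exact this

theorem hol (h : LeadField k W b F a) {m : ℤ} {f : SF 3} {P : R2} (hf : Lead k W m f P) :
    Lead k W (m - 1) ((holField a).act f) (L0 b P) := by
  rw [holField_act, Fin.sum_univ_three, L0_apply]
  refine (Lead.add ?_ ?_).add_mem ?_
  · have := h.h0.mul' (hf.wD (Sum.inl 0)) (l := m - 1) (by simp [w2])
    rwa [one_mul] at this
  · exact h.h1.mul' (hf.wD (Sum.inl 1)) (by simp [w2]; ring)
  · exact mul_mem_fil' h.h2.mem hf.wD_inl_two (by omega)

theorem anti (h : LeadField k W b F a) {m : ℤ} {f : SF 3} {P : R2} (hf : Lead k W m f P) :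
    Lead k W (m - 1) ((antiField a).act f) (Lb0 b P) := by
  have := (h.hol hf.star).star
  rwa [← antiField_act_star, star_star, starR_L0, starR_starR] at this

theorem hol_mem (h : LeadField k W b F a) {m : ℤ} {f : SF 3} (hf : f ∈ fil (om k W) m) :
    (holField a).act f ∈ fil (om k W) (m - 1) := by
  have := (hasOrder_combField h.mem 1 0).act_mem hf
  rwa [combField_act, one_mul, zero_mul, add_zero] at this

theorem anti_mem (h : LeadField k W b F a) {m : ℤ} {f : SF 3} (hf : f ∈ fil (om k W) m) :
    (antiField a).act f ∈ fil (om k W) (m - 1) := by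
  have := (hasOrder_combField h.mem 0 1).act_mem hf
  rwa [combField_act, one_mul, zero_mul, zero_add] at this

end LeadField

/-- The leading parts of the components of a bracket. -/
structure LeadBrk (k W : ℕ) (n : ℤ) (V : VF 3) (g h c : R2) : Prop where
  two : 2 ≤ n
  hg : Lead k W (k + 2 - n) (V (Sum.inl 1)) g
  hh : Lead k W (k + 2 - n) (V (Sum.inr 1)) h
  hc : Lead k W (W - n) (V (Sum.inl 2)) c
  hd : V (Sum.inr 2) ∈ fil (om k W) (W - n)

namespace LeadBrk

variable {n : ℤ} {V : VF 3} {g h c : R2}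

theorem act (hV : LeadBrk k W n V g h c) {m : ℤ} {f : SF 3} {P : R2} (hf : Lead k W m f P) :
    Lead k W (m - n) (V.act f) (g * pderiv (Sum.inl 1) P + h * pderiv (Sum.inr 1) P) := by
  have hn := hV.two
  have e1 : ∀ d : Fin 2 ⊕ Fin 2, w2 k d = 1 → V (dm d) * wD (dm d) f ∈ fil (om k W) (m - n + 1) :=
    fun d hd => mul_mem_fil' (k := 0) (mem_fil_of_nonpos le_rfl _) (hf.wD d).mem (by omega)
  have h1 := hV.hg.mul' (hf.wD (Sum.inl 1)) (l := m - n) (by simp [w2])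
  have h2 := hV.hh.mul' (hf.wD (Sum.inr 1)) (l := m - n) (by simp [w2])
  have h3 := mul_mem_fil' (m := m - n + 1) hV.hc.mem hf.wD_inl_two (by omega)
  have h4 := mul_mem_fil' (m := m - n + 1) hV.hd hf.wD_inr_two (by omega)
  have := (((((h1.add h2).add_mem (e1 (Sum.inl 0) rfl)).add_mem (e1 (Sum.inr 0) rfl)).add_mem
    h3).add_mem h4)
  convert this using 1
  rw [VF.act_apply, Fintype.sum_sum_type, Fin.sum_univ_three, Fin.sum_univ_three]
  simp only [dm, Sum.map_inl, Sum.map_inr, Fin.castSucc_zero, Fin.castSucc_one]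
  ring

theorem act_mem (hV : LeadBrk k W n V g h c) {m : ℤ} {f : SF 3} (hf : f ∈ fil (om k W) m) :
    V.act f ∈ fil (om k W) (m - n) := by
  have hn := hV.two
  have hord : V.HasOrder (om k W) (-n) := by
    refine forall_dm.2 ⟨fun e => ?_, fil_mono (by simp [dwt_inl_two]) hV.hc.mem,
      fil_mono (by simp [dwt_inr_two]) hV.hd⟩
    rw [dwt_dm]
    rcases e with i | i <;> fin_cases i
    · exact mem_fil_of_nonpos (by simp [w2]; omega) _
    · exact fil_mono (by simp [w2]) hV.hg.mem
    · exact mem_fil_of_nonpos (by simp [w2]; omega) _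
    · exact fil_mono (by simp [w2]) hV.hh.mem
  exact hord.act_mem hf

end LeadBrk

/-- The brackets of `L` and `L̄` indexed by words. -/
noncomputable def brkWord (a : Fin 3 → SF 3) : List Bool → VF 3
  | [] => (antiField a).brk (holField a)
  | true :: v => (holField a).brk (brkWord a v)
  | false :: v => (antiField a).brk (brkWord a v)

theorem combField_one_zero {n : ℕ} (a : Fin n → SF n) : combField a 1 0 = holField a := by
  simp [combField]

theorem combField_zero_one {n : ℕ} (a : Fin n → SF n) : combField a 0 1 = antiField a := by
  simp [combField]

theorem isBrk_brkWord (a : Fin 3 → SF 3) (v : List Bool) : IsBrk a (v.length + 2) (brkWord a v) := by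
  induction v with
  | nil =>
    have := IsBrk.succ 0 1 _ (IsBrk.one (a := a) 1 0)
    rwa [combField_one_zero, combField_zero_one] at this
  | cons c v ih =>
    cases c
    · have := IsBrk.succ 0 1 _ ih
      rwa [combField_zero_one] at this
    · have := IsBrk.succ 1 0 _ ih
      rwa [combField_one_zero] at this

theorem leadBrk_brkWord {F : R2} {a : Fin 3 → SF 3} (h : LeadField k W b F a) (v : List Bool) :
    LeadBrk k W (v.length + 2) (brkWord a v) (mg1 b v) (mh1 b v) (mg2 b (C 2 * L0 b F) v) := by
  have hb : ∀ {m m' : ℤ} {f : SF 3} {P : R2}, Lead k W m f P → m = m' → Lead k W m' f P :=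
    fun h e => e ▸ h
  have p1 : pderiv (Sum.inl 1) (A0 b) = 0 := pderiv_A0 (by simp) (by simp)
  have p2 : pderiv (Sum.inr 1) (A0 b) = 0 := pderiv_A0 (by simp) (by simp)
  have p3 : pderiv (Sum.inl 1) (starR (A0 b)) = 0 := by
    have := starR_pderiv 1 (starR (A0 b))
    rw [starR_starR, p2] at this
    have := congrArg starR this
    rwa [starR_starR, map_zero] at this
  have p4 : pderiv (Sum.inr 1) (starR (A0 b)) = 0 := by
    have := starR_pderiv 1 (A0 b)
    rw [p1, map_zero] at this
    exact this.symm
  induction v with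
  | nil =>
    refine ⟨by simp, ?_, ?_, ?_, ?_⟩
    · change Lead k W _ ((antiField a).act (a 1) - (holField a).act 0) (Lb0 b (A0 b))
      rw [map_zero, sub_zero]
      exact hb (h.anti h.h1) (by simp)
    · change Lead k W _ ((antiField a).act 0 - (holField a).act (star (a 1)))
        (-(L0 b (starR (A0 b))))
      rw [map_zero, zero_sub]
      exact hb (h.hol h.h1.star).neg (by simp)
    · change Lead k W _ ((antiField a).act (a 2) - (holField a).act 0) (Lb0 b (C 2 * L0 b F))
      rw [map_zero, sub_zero]
      exact hb (h.anti h.h2) (by simp; ring)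
    · change (antiField a).act 0 - (holField a).act (star (a 2)) ∈ _
      rw [map_zero, zero_sub]
      exact Submodule.neg_mem _ (fil_mono (by simp) (h.hol_mem (star_mem_fil h.h2.mem)))
  | cons c v ih =>
    cases c
    · refine ⟨by simp; omega, ?_, ?_, ?_, ?_⟩
      · change Lead k W _ ((antiField a).act (brkWord a v (Sum.inl 1)) - (brkWord a v).act 0)
          (Lb0 b (mg1 b v))
        rw [map_zero, sub_zero]
        exact hb (h.anti ih.hg) (by simp; ring)
      · change Lead k W _ ((antiField a).act (brkWord a v (Sum.inr 1))
          - (brkWord a v).act (star (a 1))) (Lb0 b (mh1 b v))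
        have := (hb (h.anti ih.hh) (by ring)).sub (ih.act h.h1.star) (m := k + 1 - (v.length + 2))
        rw [p3, p4, mul_zero, mul_zero, add_zero, sub_zero] at this
        exact hb this (by simp; ring)
      · change Lead k W _ ((antiField a).act (brkWord a v (Sum.inl 2)) - (brkWord a v).act 0)
          (Lb0 b (mg2 b (C 2 * L0 b F) v))
        rw [map_zero, sub_zero]
        exact hb (h.anti ih.hc) (by simp; ring)
      · change (antiField a).act (brkWord a v (Sum.inr 2)) - (brkWord a v).act (star (a 2)) ∈ _
        exact Submodule.sub_mem _ (fil_mono (by simp) (h.anti_mem ih.hd))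
          (fil_mono (by simp; omega) (ih.act_mem (star_mem_fil h.h2.mem)))
    · refine ⟨by simp; omega, ?_, ?_, ?_, ?_⟩
      · change Lead k W _ ((holField a).act (brkWord a v (Sum.inl 1)) - (brkWord a v).act (a 1))
          (L0 b (mg1 b v))
        have := (hb (h.hol ih.hg) (by ring)).sub (ih.act h.h1) (m := k + 1 - (v.length + 2))
        rw [p1, p2, mul_zero, mul_zero, add_zero, sub_zero] at this
        exact hb this (by simp; ring)
      · change Lead k W _ ((holField a).act (brkWord a v (Sum.inr 1)) - (brkWord a v).act 0)
          (L0 b (mh1 b v))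
        rw [map_zero, sub_zero]
        exact hb (h.hol ih.hh) (by simp; ring)
      · change Lead k W _ ((holField a).act (brkWord a v (Sum.inl 2)) - (brkWord a v).act (a 2))
          (L0 b (mg2 b (C 2 * L0 b F) v) - (mg1 b v * pderiv (Sum.inl 1) (C 2 * L0 b F)
            + mh1 b v * pderiv (Sum.inr 1) (C 2 * L0 b F)))
        have := (hb (h.hol ih.hc) (by ring)).sub (ih.act h.h2) (m := W - 1 - (v.length + 2))
        exact hb this (by simp; ring)
      · change (holField a).act (brkWord a v (Sum.inr 2)) - (brkWord a v).act 0 ∈ _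
        rw [map_zero, sub_zero]
        exact fil_mono (by simp) (h.hol_mem ih.hd)

theorem constantCoeff_mg2 {F : R2} {a : Fin 3 → SF 3} (h : LeadField k W b F a) {r : SF 3}
    (hr : ∀ j, evAt 0 (wD (Sum.inl j) r) = if j = 2 then -1 / 2 else 0)
    (hv : CommVanish r a 0 (W + 1)) (v : List Bool) (hW : v.length + 2 = W) :
    constantCoeff (mg2 b (C 2 * L0 b F) v) = 0 := by
  have h1 := hv (v.length + 2) (by omega) _ (isBrk_brkWord a v)
  have h2 := (leadBrk_brkWord h v).hc
  have e : (W : ℤ) - (v.length + 2) = 0 := by omega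
  rw [e] at h2
  rw [← h2.evAt]
  rw [VF.act_apply, Fintype.sum_sum_type, Fin.sum_univ_three] at h1
  simp only [VF.holPart, Sum.elim_inl, Sum.elim_inr, Pi.zero_apply, zero_mul,
    Finset.sum_const_zero, add_zero, map_add, map_mul, hr] at h1
  simpa using h1

/-- The defining function with its linear part removed. -/
noncomputable def red (r : SF 3) : SF 3 :=
  r + (1 / 2 : ℂ) • (coord (Sum.inl 2) + coord (Sum.inr 2))

theorem wD_wD_red (r : SF 3) (d e : Fin 3 ⊕ Fin 3) : wD d (wD e (red r)) = wD d (wD e r) := by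
  have : ∀ c : Fin 3 ⊕ Fin 3, wD d (wD e (coord c)) = 0 := fun c => by
    rw [wD_coord]; split_ifs <;> simp
  rw [red, map_add, map_add, Derivation.map_smul, Derivation.map_smul, map_add, map_add,
    this, this, add_zero, smul_zero, add_zero]

theorem lead_leviF {F : R2} {a : Fin 3 → SF 3} (h : LeadField k W b F a) {r : SF 3}
    (hr : Lead k W W (red r) F) : Lead k W (W - 2) (leviF r a) (lamR b F) := by
  have key : ∀ (i j : Fin 2), Lead k W (W - 2)
      (wD (Sum.inl i.castSucc) (wD (Sum.inr j.castSucc) r) * a i.castSucc * star (a j.castSucc))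
      (hess F i j * ![1, A0 b] i * starR (![1, A0 b] j)) := fun i j => by
    have h1 := (hr.wD (Sum.inr j)).wD (Sum.inl i)
    simp only [dm, Sum.map_inl, Sum.map_inr, wD_wD_red] at h1
    refine (h1.mul (h.lead i)).mul' (h.lead j).star ?_
    have : w2 k (Sum.inr j) = w2 k (Sum.inl j) := rfl
    rw [this]
    ring
  have e1 : ∀ d, wD d (wD (Sum.inr 2) r) ∈ fil (om k W) (1 - dwt (om k W) d) := fun d => by
    rw [← wD_wD_red]
    exact wD_mem_fil d (fil_mono (by omega) hr.wD_inr_two)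
  have e2 : ∀ d, wD (Sum.inl 2) (wD d r) ∈ fil (om k W) (1 - dwt (om k W) d) := fun d => by
    rw [← wD_wD_red, wD_comm]
    exact wD_mem_fil d (fil_mono (by omega) hr.wD_inl_two)
  have rest : ∀ i j : Fin 3, (i = 2 ∨ j = 2) →
      wD (Sum.inl i) (wD (Sum.inr j) r) * a i * star (a j) ∈ fil (om k W) (W - 2 + 1) := by
    rintro i j (rfl | rfl)
    · refine mul_mem_fil' (mul_mem_fil (e2 _) (h.mem 2)) (star_mem_fil (h.mem j)) ?_
      simp only [dwt, widx, Sum.elim_inr, id, om, Matrix.cons_val]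
      omega
    · refine mul_mem_fil' (mul_mem_fil (e1 _) (h.mem i)) (star_mem_fil (h.mem 2)) ?_
      simp only [dwt, widx, Sum.elim_inl, id, om, Matrix.cons_val]
      omega
  have hsum : leviF r a = ∑ i : Fin 2, ∑ j : Fin 2,
      wD (Sum.inl i.castSucc) (wD (Sum.inr j.castSucc) r) * a i.castSucc * star (a j.castSucc)
      + ((∑ i : Fin 2, wD (Sum.inl i.castSucc) (wD (Sum.inr 2) r) * a i.castSucc * star (a 2))
        + ∑ j : Fin 3, wD (Sum.inl 2) (wD (Sum.inr j) r) * a 2 * star (a j)) := by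
    rw [leviF, Fin.sum_univ_castSucc]
    simp only [Fin.sum_univ_castSucc (n := 2), Finset.sum_add_distrib, Fin.reduceLast]
    ring
  rw [hsum]
  refine (Lead.sum fun i _ => Lead.sum fun j _ => key i j).add_mem (Submodule.add_mem _ ?_ ?_)
  · exact Submodule.sum_mem _ fun i _ => rest _ _ (Or.inr rfl)
  · exact Submodule.sum_mem _ fun i _ => rest _ _ (Or.inl rfl)

theorem lead_word {F : R2} {a : Fin 3 → SF 3} (h : LeadField k W b F a) {m : ℤ} {f : SF 3} {P : R2}
    (hf : Lead k W m f P) (v : List Bool) : ∃ cs : List (SF 3 × SF 3), cs.length = v.length ∧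
      Lead k W (m - v.length) (actWord a cs f) (word0 b v P) := by
  induction v with
  | nil => exact ⟨[], rfl, by simpa [actWord, word0] using hf⟩
  | cons c v ih =>
    obtain ⟨cs, hl, hcs⟩ := ih
    have e : m - (v.length : ℤ) - 1 = m - ((c :: v).length : ℕ) := by simp; ring
    cases c
    · refine ⟨cs ++ [(0, 1)], by simp [hl], ?_⟩
      rw [actWord, List.foldl_append, ← e]
      simp only [List.foldl_cons, List.foldl_nil, combField_zero_one]
      exact h.anti hcs
    · refine ⟨cs ++ [(1, 0)], by simp [hl], ?_⟩
      rw [actWord, List.foldl_append, ← e]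
      simp only [List.foldl_cons, List.foldl_nil, combField_one_zero]
      exact h.hol hcs

theorem constantCoeff_word_lamR {F : R2} {a : Fin 3 → SF 3} (h : LeadField k W b F a) {r : SF 3}
    (hr : Lead k W W (red r) F) (hv : LeviVanish r a 0 (W + 1)) (v : List Bool)
    (hW : v.length + 2 = W) : constantCoeff (word0 b v (lamR b F)) = 0 := by
  obtain ⟨cs, hl, hcs⟩ := lead_word h (lead_leviF h hr) v
  have e : (W : ℤ) - 2 - v.length = 0 := by omega
  rw [e] at hcs
  rw [← hcs.evAt]
  exact hv cs (by omega)

end Model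

/-- The weighted dilations of `ℂⁿ`. -/
noncomputable def dil {n : ℕ} (ω : Fin n → ℕ) (ε : ℝ) (x : Cn n) : Cn n :=
  fun j => (ε : ℂ) ^ ω j * x j

theorem smul_dil {n : ℕ} (ω : Fin n → ℕ) (ε t : ℝ) (x : Cn n) : t • dil ω ε x = dil ω ε (t • x) := by
  funext j
  simp only [dil, Pi.smul_apply, Complex.real_smul]
  ring

theorem norm_dil_apply_le {n : ℕ} {ω : Fin n → ℕ} {ε R : ℝ} (hε : 0 ≤ ε) {x : Cn n} (hx : ‖x‖ ≤ R)
    (j : Fin n) : ‖dil ω ε x j‖ ≤ ε ^ ω j * R := by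
  rw [dil, norm_mul, norm_pow, Complex.norm_real, Real.norm_of_nonneg hε]
  exact mul_le_mul_of_nonneg_left ((norm_le_pi_norm x j).trans hx) (by positivity)

theorem norm_dil_le {n : ℕ} {ω : Fin n → ℕ} {ε R : ℝ} (hε : 0 ≤ ε) (hε1 : ε ≤ 1) {x : Cn n}
    (hx : ‖x‖ ≤ R) : ‖dil ω ε x‖ ≤ R := by
  have hR := (norm_nonneg x).trans hx
  refine (pi_norm_le_iff_of_nonneg hR).2 fun j => (norm_dil_apply_le hε hx j).trans ?_
  exact mul_le_of_le_one_left hR (pow_le_one₀ hε hε1)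

theorem exists_norm_dil_le {n : ℕ} {ω : Fin n → ℕ} (hω : ∀ i, 0 < ω i) {R : ℝ} (hR : 0 ≤ R)
    {f : SF n} {m : ℤ} (hf : f ∈ fil ω m) : ∃ C, 0 ≤ C ∧ ∀ x, ‖x‖ ≤ R → ∀ ε, 0 ≤ ε → ε ≤ 1 →
      ‖f.1 (dil ω ε x)‖ ≤ C * ε ^ m.toNat := by
  by_cases hm : m ≤ 0
  · obtain ⟨C, hC⟩ := (isCompact_closedBall (0 : Cn n) R).exists_bound_of_continuousOn
      f.smooth.continuous.continuousOn
    refine ⟨max C 0, le_max_right _ _, fun x hx ε hε hε1 => ?_⟩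
    rw [Int.toNat_of_nonpos hm, pow_zero, mul_one]
    exact (hC _ (by simpa using norm_dil_le hε hε1 hx)).trans (le_max_left _ _)
  have H : ∀ d, ∃ C, 0 ≤ C ∧ ∀ x, ‖x‖ ≤ R → ∀ ε, 0 ≤ ε → ε ≤ 1 →
      ‖(wD d f).1 (dil ω ε x)‖ ≤ C * ε ^ (m - dwt ω d).toNat := fun d => by
    have := hω (widx d)
    have h1 : 0 < dwt ω d := by simp only [dwt]; omega
    exact exists_norm_dil_le hω hR (wD_mem_fil d hf)
  choose C hC0 hC using H
  refine ⟨∑ j, R * (C (Sum.inl j) + C (Sum.inr j)), Finset.sum_nonneg fun j _ =>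
    mul_nonneg hR (add_nonneg (hC0 _) (hC0 _)), fun x hx ε hε hε1 => ?_⟩
  set v := dil ω ε x with hv
  have hd : ∀ t ∈ Set.Icc (0 : ℝ) 1, HasDerivWithinAt (fun s : ℝ => f.1 (0 + s • v))
      ((dirD v f).1 (0 + t • v)) (Set.Icc 0 1) t := fun t _ => (hasDerivAt_line f 0 v t).hasDerivWithinAt
  have h := norm_image_sub_le_of_norm_deriv_le_segment_01' hd
    (C := (∑ j, R * (C (Sum.inl j) + C (Sum.inr j))) * ε ^ m.toNat) fun t ht => ?_
  · have h0 : f.1 0 = 0 := evAt_eq_zero_of_mem hf (by omega)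
    simpa [h0] using h
  have ht' : ‖t • x‖ ≤ R := by
    rw [norm_smul, Real.norm_of_nonneg ht.1]
    exact (mul_le_of_le_one_left (norm_nonneg x) ht.2.le).trans hx
  rw [zero_add, hv, smul_dil, ← hv, ← evAt_apply, dirD, map_sum, Finset.sum_mul]
  refine (norm_sum_le _ _).trans (Finset.sum_le_sum fun j _ => ?_)
  rw [map_add, map_smul, map_smul, evAt_apply, evAt_apply, smul_eq_mul, smul_eq_mul]
  refine (norm_add_le _ _).trans ?_
  rw [norm_mul, norm_mul, RCLike.norm_conj, ← mul_add]
  have e1 := hC (Sum.inl j) _ ht' ε hε hε1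
  have e2 := hC (Sum.inr j) _ ht' ε hε hε1
  have e3 := norm_dil_apply_le (ω := ω) hε hx j
  have e4 : ε ^ ω j * ε ^ (m - ω j).toNat ≤ ε ^ m.toNat := by
    rw [← pow_add]
    exact pow_le_pow_of_le_one hε hε1 (by omega)
  have e5 : dwt ω (Sum.inl j) = ω j := rfl
  have e6 : dwt ω (Sum.inr j) = ω j := rfl
  rw [e5] at e1
  rw [e6] at e2
  have hc := add_nonneg (hC0 (Sum.inl j)) (hC0 (Sum.inr j))
  calc ‖v j‖ * (‖(wD (Sum.inl j) f).1 (dil ω ε (t • x))‖ + ‖(wD (Sum.inr j) f).1 (dil ω ε (t • x))‖)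
      ≤ (ε ^ ω j * R) * (C (Sum.inl j) * ε ^ (m - ω j).toNat
        + C (Sum.inr j) * ε ^ (m - ω j).toNat) := by gcongr
    _ = R * (C (Sum.inl j) + C (Sum.inr j)) * (ε ^ ω j * ε ^ (m - ω j).toNat) := by ring
    _ ≤ _ := by gcongr
termination_by m.toNat
decreasing_by omega

namespace Model

open MvPolynomial Filter

variable {k W : ℕ}

theorem evR_dil {P : R2} {m : ℕ} (hP : ZHom (w2 k) P m) (ε : ℝ) (y : Fin 2 → ℂ) :
    evR (fun i => (ε : ℂ) ^ w2 k (Sum.inl i) * y i) P = (ε : ℂ) ^ m * evR y P := by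
  rw [evR, evR, eval_eq', eval_eq', Finset.mul_sum]
  refine Finset.sum_congr rfl fun d hd => ?_
  have h1 := hP (mem_support_iff.1 hd)
  rw [ZHom.weight_cast] at h1
  have h2 : Finsupp.weight (w2 k) d = m := by exact_mod_cast h1
  have h3 : ∀ s, (Sum.elim (fun i => (ε : ℂ) ^ w2 k (Sum.inl i) * y i)
      (fun i => starRingEnd ℂ ((ε : ℂ) ^ w2 k (Sum.inl i) * y i)) s) ^ d s
      = (ε : ℂ) ^ (d s * w2 k s) * (Sum.elim y (fun i => starRingEnd ℂ (y i)) s) ^ d s := by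
    rintro (i | i)
    · simp only [Sum.elim_inl]
      rw [mul_pow, ← pow_mul, mul_comm (d _)]
    · simp only [Sum.elim_inr]
      rw [map_mul, map_pow, Complex.conj_ofReal, mul_pow, ← pow_mul, mul_comm (d _)]
      rfl
  have h4 : ∑ s, d s * w2 k s = m := by
    rw [← h2, Finsupp.weight_apply, Finsupp.sum_fintype _ _ (by simp)]
    rfl
  simp only [h3]
  rw [Finset.prod_mul_distrib, Finset.prod_pow_eq_pow_sum, h4]
  ring

theorem Lead.exists_norm_sub_le {m : ℕ} (hW : 0 < W) {f : SF 3} {P : R2} (h : Lead k W m f P) {R : ℝ}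
    (hR : 0 ≤ R) : ∃ C, 0 ≤ C ∧ ∀ x : Cn 3, ‖x‖ ≤ R → ∀ ε : ℝ, 0 ≤ ε → ε ≤ 1 →
      ‖f.1 (dil (om k W) ε x) - (ε : ℂ) ^ m * evR (fun i => x i.castSucc) P‖ ≤ C * ε ^ (m + 1) := by
  have hω : ∀ i, 0 < om k W i := by intro i; fin_cases i <;> simp [om, hW]
  obtain ⟨C, hC0, hC⟩ := exists_norm_dil_le hω hR h.2
  refine ⟨C, hC0, fun x hx ε hε hε1 => ?_⟩
  have := hC x hx ε hε hε1
  have e : (f - p3 P).1 (dil (om k W) ε x)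
      = f.1 (dil (om k W) ε x) - (ε : ℂ) ^ m * evR (fun i => x i.castSucc) P := by
    rw [← evAt_apply, map_sub, evAt_apply, evAt_apply, pv_apply, ← evR_dil h.1]
    congr 2
    congr 1
    funext i
    fin_cases i <;> rfl
  rw [e] at this
  exact this

/-- Curves in the hypersurface with prescribed leading parts of the first two coordinates. -/
theorem exists_curve (hW : 0 < W) {r : SF 3} {F : R2} (hr : Lead k W W (red r) F) (hs : star r = r)
    (hF : starR F = F) (y : Fin 2 → ℂ) : ∃ q : ℝ → Cn 3,
      (∀ᶠ ε in 𝓝[>] 0, r.1 (q ε) = 0) ∧ ∀ (m : ℕ) f P, Lead k W m f P →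
        Tendsto (fun ε => f.1 (q ε) * ((ε : ℂ) ^ m)⁻¹) (𝓝[>] 0) (𝓝 (evR y P)) := by
  set c : ℝ := (evR y F).re with hc
  have hFc : evR y F = c := by
    have := evR_starR y F
    rw [hF] at this
    exact (Complex.conj_eq_iff_re.1 this.symm).symm
  set pt : ℝ → Cn 3 := fun t => ![y 0, y 1, t] with hpt
  have hpt2 : ∀ t, (fun i : Fin 2 => pt t i.castSucc) = y := fun t => by
    funext i; fin_cases i <;> rfl
  set R : ℝ := ‖y 0‖ + ‖y 1‖ + (|c| + 1) with hRdef
  have hR : 0 ≤ R := by positivity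
  have hptR : ∀ t ∈ Set.Icc (c - 1) (c + 1), ‖pt t‖ ≤ R := fun t ht => by
    have h1 : |t| ≤ |c| + 1 := by
      have h2 : |t - c| ≤ 1 := abs_le.2 ⟨by linarith [ht.1], by linarith [ht.2]⟩
      have h3 := abs_add_le (t - c) c
      rw [sub_add_cancel] at h3
      linarith
    have n0 := norm_nonneg (y 0)
    have n1 := norm_nonneg (y 1)
    have n2 := abs_nonneg c
    refine (pi_norm_le_iff_of_nonneg hR).2 fun j => ?_
    fin_cases j
    · change ‖y 0‖ ≤ R
      linarith
    · change ‖y 1‖ ≤ R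
      linarith
    · change ‖(t : ℂ)‖ ≤ R
      rw [Complex.norm_real, Real.norm_eq_abs]
      linarith
  obtain ⟨C, hC0, hC⟩ := hr.exists_norm_sub_le hW hR
  have hval : ∀ ε t : ℝ, r.1 (dil (om k W) ε (pt t))
      = (red r).1 (dil (om k W) ε (pt t)) - ε ^ W * t := fun ε t => by
    have : (red r).1 (dil (om k W) ε (pt t)) = r.1 (dil (om k W) ε (pt t))
        + (1 / 2) * ((ε ^ W * t) + starRingEnd ℂ (ε ^ W * t)) := rfl
    rw [this, map_mul, map_pow, Complex.conj_ofReal, Complex.conj_ofReal]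
    ring
  have hroot : ∀ᶠ ε in 𝓝[>] (0 : ℝ), ∃ t ∈ Set.Icc (c - 1) (c + 1),
      r.1 (dil (om k W) ε (pt t)) = 0 := by
    have hsmall : ∀ᶠ ε in 𝓝[>] (0 : ℝ), ε < min 1 (1 / (C + 1)) :=
      (eventually_lt_nhds (by positivity)).filter_mono nhdsWithin_le_nhds
    filter_upwards [hsmall, self_mem_nhdsWithin] with ε h1 (hε : 0 < ε)
    have hε1 : ε ≤ 1 := (h1.trans_le (min_le_left _ _)).le
    have hCε : C * ε < 1 := by
      have := (lt_div_iff₀ (by positivity)).1 (h1.trans_le (min_le_right _ _))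
      linarith
    have hreal : ∀ x, r.1 x = ((r.1 x).re : ℂ) := fun x => by
      have : starRingEnd ℂ (r.1 x) = r.1 x := congrArg (fun g : SF 3 => g.1 x) hs
      exact (Complex.conj_eq_iff_re.1 this).symm
    have hpow : 0 < ε ^ W := by positivity
    have hb : ∀ t ∈ Set.Icc (c - 1) (c + 1),
        |(r.1 (dil (om k W) ε (pt t))).re - ε ^ W * (c - t)| < ε ^ W := fun t ht => by
      have e1 := hC _ (hptR t ht) ε hε.le hε1
      rw [hpt2, hFc] at e1
      have e2 := (Complex.abs_re_le_norm _).trans e1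
      have e3 : ((red r).1 (dil (om k W) ε (pt t)) - (ε : ℂ) ^ W * c).re
          = (r.1 (dil (om k W) ε (pt t))).re - ε ^ W * (c - t) := by
        rw [hval, Complex.sub_re, Complex.sub_re, ← Complex.ofReal_pow, ← Complex.ofReal_mul,
          ← Complex.ofReal_mul, Complex.ofReal_re, Complex.ofReal_re]
        ring
      rw [e3] at e2
      refine e2.trans_lt ?_
      rw [pow_succ]
      nlinarith
    have hcont : ContinuousOn (fun t : ℝ => (r.1 (dil (om k W) ε (pt t))).re)
        (Set.Icc (c - 1) (c + 1)) := by
      refine (Complex.continuous_re.comp (r.smooth.continuous.comp ?_)).continuousOn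
      refine continuous_pi fun j => ?_
      simp only [dil]
      refine continuous_const.mul ?_
      fin_cases j
      · exact continuous_const
      · exact continuous_const
      · exact Complex.continuous_ofReal
    have h0 := intermediate_value_Icc' (by linarith : c - 1 ≤ c + 1) hcont
    have b1 := hb (c - 1) ⟨le_rfl, by linarith⟩
    have b2 := hb (c + 1) ⟨by linarith, le_rfl⟩
    rw [abs_lt] at b1 b2
    obtain ⟨t, ht, htr⟩ := h0 (show (0 : ℝ) ∈ Set.Icc _ _ from ⟨by linarith [b2.2], by linarith [b1.1]⟩)
    exact ⟨t, ht, by rw [hreal]; exact_mod_cast htr⟩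
  classical
  have hch : ∀ ε : ℝ, ∃ t ∈ Set.Icc (c - 1) (c + 1), (∃ s ∈ Set.Icc (c - 1) (c + 1),
      r.1 (dil (om k W) ε (pt s)) = 0) → r.1 (dil (om k W) ε (pt t)) = 0 := fun ε => by
    by_cases h : ∃ s ∈ Set.Icc (c - 1) (c + 1), r.1 (dil (om k W) ε (pt s)) = 0
    · obtain ⟨s, hs, hs'⟩ := h
      exact ⟨s, hs, fun _ => hs'⟩
    · exact ⟨c, ⟨by linarith, by linarith⟩, fun h' => absurd h' h⟩
  choose τ hτ hτr using hch
  refine ⟨fun ε => dil (om k W) ε (pt (τ ε)), hroot.mono fun ε h => hτr ε h, fun m f P hf => ?_⟩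
  obtain ⟨D, hD0, hD⟩ := hf.exists_norm_sub_le hW hR
  rw [tendsto_iff_norm_sub_tendsto_zero]
  have hlim : Tendsto (fun ε : ℝ => D * ε) (𝓝[>] 0) (𝓝 0) := by
    have : Tendsto (fun ε : ℝ => D * ε) (𝓝 0) (𝓝 (D * 0)) := tendsto_id.const_mul D
    rw [mul_zero] at this
    exact this.mono_left nhdsWithin_le_nhds
  refine squeeze_zero' (Eventually.of_forall fun _ => norm_nonneg _) ?_ hlim
  have hsmall : ∀ᶠ ε in 𝓝[>] (0 : ℝ), ε < 1 :=
    (eventually_lt_nhds one_pos).filter_mono nhdsWithin_le_nhds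
  filter_upwards [hsmall, self_mem_nhdsWithin] with ε h1 (hε : 0 < ε)
  have := hD _ (hptR _ (hτ ε)) ε hε.le h1.le
  rw [hpt2] at this
  have hne : (ε : ℂ) ^ m ≠ 0 := pow_ne_zero _ (by exact_mod_cast hε.ne')
  have e : f.1 (dil (om k W) ε (pt (τ ε))) * ((ε : ℂ) ^ m)⁻¹ - evR y P
      = (f.1 (dil (om k W) ε (pt (τ ε))) - (ε : ℂ) ^ m * evR y P) * ((ε : ℂ) ^ m)⁻¹ := by
    field_simp
  rw [e, norm_mul, norm_inv, norm_pow, Complex.norm_real, Real.norm_of_nonneg hε.le,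
    ← div_eq_mul_inv, div_le_iff₀ (by positivity)]
  calc _ ≤ _ := this
    _ = _ := by ring

theorem Lead.tendsto {y : Fin 2 → ℂ} {q : ℝ → Cn 3}
    (hq : ∀ (m : ℕ) f P, Lead k W m f P →
        Tendsto (fun ε => f.1 (q ε) * ((ε : ℂ) ^ m)⁻¹) (𝓝[>] 0) (𝓝 (evR y P)))
    (hW : 0 < W) {m : ℤ} {f : SF 3} {P : R2} (h : Lead k W m f P) :
    Tendsto (fun ε => f.1 (q ε) * ((ε : ℂ) ^ m)⁻¹) (𝓝[>] 0) (𝓝 (evR y P)) := by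
  rcases le_or_gt 0 m with hm | hm
  · lift m to ℕ using hm
    simpa using hq m f P h
  have hω : ∀ i, 0 < om k W i := by intro i; fin_cases i <;> simp [om, hW]
  have h0 : Lead k W (0 : ℕ) f (C (_root_.evAt 0 f)) := by
    refine ⟨by simpa using ZHom.C _, ?_⟩
    rw [Nat.cast_zero, zero_add]
    refine mem_fil_one hω ?_
    rw [map_sub, evAt_zero_p3, constantCoeff_C, sub_self]
  have h1 := hq 0 f (C (_root_.evAt 0 f)) h0
  obtain ⟨n, rfl⟩ : ∃ n : ℕ, m = -((n + 1 : ℕ) : ℤ) := ⟨(-m - 1).toNat, by omega⟩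
  have h2 : Tendsto (fun ε : ℝ => (ε : ℂ) ^ (n + 1)) (𝓝[>] 0) (𝓝 0) := by
    have : Tendsto (fun ε : ℝ => (ε : ℂ) ^ (n + 1)) (𝓝 0) (𝓝 (((0 : ℝ) : ℂ) ^ (n + 1))) :=
      (Complex.continuous_ofReal.tendsto 0).pow _
    rw [Complex.ofReal_zero, zero_pow n.succ_ne_zero] at this
    exact this.mono_left nhdsWithin_le_nhds
  have h3 := h1.mul h2
  rw [mul_zero] at h3
  rw [h.1.eq_zero_of_neg hm, map_zero]
  refine h3.congr fun ε => ?_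
  rw [pow_zero, inv_one, mul_one, zpow_neg, inv_inv, zpow_natCast]

end Model

namespace Model

open MvPolynomial Filter

variable {k W : ℕ}

/-- A pseudoconvex hypersurface `r = 0` with a field `a` of type `(1, 0)` along it. -/
structure CRPair {n : ℕ} (r : SF n) (a : Fin n → SF n) : Prop where
  star_r : star r = r
  cr : ∀ x, r.1 x = 0 → ∑ j, (a j).1 x * (wD (Sum.inl j) r).1 x = 0
  psc : ∀ x, r.1 x = 0 → ∀ ξ : Fin n → ℂ, ∑ j, ξ j * (wD (Sum.inl j) r).1 x = 0 →
    0 ≤ (leviAt r x ξ).re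

/-- The normal form of a hypersurface `r = 0` and a `(1, 0)` field at the origin, relative to the
weights `1, k + 2, W`. -/
structure NF (k W : ℕ) (r : SF 3) (a : Fin 3 → SF 3) : Prop extends CRPair r a where
  le : k + 2 ≤ W
  red_mem : red r ∈ fil (om k W) W
  d_r : ∀ j, evAt 0 (wD (Sum.inl j) r) = if j = 2 then -1 / 2 else 0
  a_zero : evAt 0 (a 0) = 1
  a_one : a 1 ∈ fil (om k W) (k + 1)

theorem star_red {r : SF 3} (h : star r = r) : star (red r) = red r := by
  rw [red, star_add, star_smul, star_add, star_coord, star_coord, h]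
  simp [add_comm]

theorem wD_red_dm (r : SF 3) (e : Fin 2 ⊕ Fin 2) : wD (dm e) (red r) = wD (dm e) r := by
  rw [red, map_add, Derivation.map_smul, map_add, wD_coord, wD_coord]
  rcases e with i | i <;> fin_cases i <;> simp [dm]

theorem wD_inl_two_red (r : SF 3) :
    wD (Sum.inl 2) (red r) = wD (Sum.inl 2) r + algebraMap ℂ (SF 3) (1 / 2) := by
  rw [red, map_add, Derivation.map_smul, map_add, wD_coord, wD_coord]
  simp [Algebra.smul_def]

namespace NF

variable {r : SF 3} {a : Fin 3 → SF 3}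

theorem pos (h : NF k W r a) : 0 < W := by have := h.le; omega

theorem om_pos (h : NF k W r a) (i : Fin 3) : 0 < om k W i := by
  have := h.pos
  fin_cases i <;> simp [om, this]

theorem evAt_wD_red (h : NF k W r a) :
    evAt 0 (wD (Sum.inl 2) (red r)) = 0 ∧ evAt 0 (wD (Sum.inr 2) (red r)) = 0 := by
  have h1 : evAt 0 (wD (Sum.inl 2) (red r)) = 0 := by
    rw [wD_inl_two_red, map_add, h.d_r, AlgHomClass.commutes]
    norm_num
  refine ⟨h1, ?_⟩
  have h2 := wD_star (Sum.inr 2) (red r)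
  rw [star_red h.star_r] at h2
  rw [h2, map_star, Sum.swap_inr, h1, star_zero]

theorem exists_lead_red (h : NF k W r a) : ∃ F, Lead k W W (red r) F ∧ starR F = F := by
  obtain ⟨F, hF⟩ := exists_lead h.pos le_rfl h.red_mem fun _ => h.evAt_wD_red
  refine ⟨F, hF, ?_⟩
  have := hF.star
  rw [star_red h.star_r] at this
  exact this.unique hF

theorem wD_red_mem_one (h : NF k W r a) : wD (Sum.inl 2) (red r) ∈ fil (om k W) 1 :=
  mem_fil_one h.om_pos h.evAt_wD_red.1

theorem eq_zero_of_vanish (h : NF k W r a) {f : SF 3} (hf : ∀ x, r.1 x = 0 → f.1 x = 0) {m : ℤ}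
    {P : R2} (hP : Lead k W m f P) : P = 0 := by
  obtain ⟨F, hF, hs⟩ := h.exists_lead_red
  refine eq_zero_of_eventually (y₀ := 0) (Eventually.of_forall fun y => ?_)
  obtain ⟨q, hq, hlim⟩ := exists_curve h.pos hF h.star_r hs y
  refine tendsto_nhds_unique (Lead.tendsto hlim h.pos hP) ?_
  refine tendsto_const_nhds.congr' ?_
  filter_upwards [hq] with ε hε
  rw [hf _ hε, zero_mul]

theorem mem_of_vanish (h : NF k W r a) {f : SF 3} (hf : ∀ x, r.1 x = 0 → f.1 x = 0) :
    f ∈ fil (om k W) W := by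
  have H : ∀ n : ℕ, n ≤ W → f ∈ fil (om k W) n := fun n => by
    induction n with
    | zero => exact fun _ => mem_fil_of_nonpos (by simp) f
    | succ n ih =>
      intro hn
      obtain ⟨P, hP⟩ := exists_lead h.pos (n := n) (by omega) (ih (by omega)) fun e => by omega
      have := hP.2
      rw [h.eq_zero_of_vanish hf hP, map_zero, sub_zero] at this
      exact_mod_cast this
  exact H W le_rfl

theorem lead_zero (h : NF k W r a) : Lead k W 0 (a 0) 1 := by
  refine ⟨ZHom.C 1, ?_⟩
  rw [zero_add]
  refine mem_fil_one h.om_pos ?_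
  rw [map_sub, map_one, map_one, h.a_zero, sub_self]

theorem leadField (h : NF k W r a) {F : R2} (hF : Lead k W W (red r) F) {b : Fin (k + 1) → ℂ}
    (hb : Lead k W (k + 1) (a 1) (A0 b)) : LeadField k W b F a := by
  have hle := h.le
  set S : SF 3 := ∑ j, a j * wD (Sum.inl j) r with hS
  have hSm : S ∈ fil (om k W) W := h.mem_of_vanish fun x hx => by
    rw [← evAt_apply, hS, map_sum]
    simpa only [map_mul, evAt_apply] using h.cr x hx
  have e0 := hF.wD (Sum.inl 0)
  have e1 := hF.wD (Sum.inl 1)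
  rw [wD_red_dm] at e0 e1
  have hlead : Lead k W (W - 1) (a 0 * wD (dm (Sum.inl 0)) r + a 1 * wD (dm (Sum.inl 1)) r)
      (L0 b F) := by
    rw [L0_apply]
    refine Lead.add ?_ (hb.mul' e1 (by simp [w2]; ring))
    have := h.lead_zero.mul' e0 (l := (W : ℤ) - 1) (by simp [w2])
    rwa [one_mul] at this
  have key : a 2 = (2 : ℂ) • (a 0 * wD (dm (Sum.inl 0)) r + a 1 * wD (dm (Sum.inl 1)) r)
      + ((2 : ℂ) • (a 2 * wD (Sum.inl 2) (red r)) - (2 : ℂ) • S) := by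
    have : a 2 = (2 : ℂ) • (a 2 * algebraMap ℂ (SF 3) (1 / 2)) := by
      rw [mul_comm, ← Algebra.smul_def, smul_smul]; norm_num
    rw [hS, Fin.sum_univ_three, wD_inl_two_red, mul_add, smul_add (2 : ℂ) (a 2 * _), ← this]
    simp only [smul_add, dm, Sum.map_inl, Fin.castSucc_zero, Fin.castSucc_one]
    abel
  have H : ∀ n : ℕ, n + 1 ≤ W → a 2 ∈ fil (om k W) n := fun n => by
    induction n with
    | zero => exact fun _ => mem_fil_of_nonpos (by simp) _
    | succ n ih =>
      intro hn
      rw [key]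
      refine Submodule.add_mem _ (Submodule.smul_mem _ _ (fil_mono (by omega) hlead.mem))
        (Submodule.sub_mem _ (Submodule.smul_mem _ _ ?_)
          (Submodule.smul_mem _ _ (fil_mono (by omega) hSm)))
      exact mul_mem_fil' (ih (by omega)) h.wD_red_mem_one (by push_cast; rfl)
  refine ⟨h.lead_zero, hb, ?_⟩
  rw [key]
  refine Lead.add_mem ?_ (Submodule.sub_mem _ (Submodule.smul_mem _ _
    (mul_mem_fil' (H (W - 1) (by omega)) h.wD_red_mem_one (by omega)))
    (Submodule.smul_mem _ _ (fil_mono (by omega) hSm)))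
  have h2 : Lead k W 0 (algebraMap ℂ (SF 3) 2) (C 2) := by
    have := Lead.of_p3 (k := k) (W := W) (ZHom.C (w := w2 k) (2 : ℂ))
    rwa [show p3 (C 2) = algebraMap ℂ (SF 3) 2 from AlgHomClass.commutes p3 2] at this
  rw [Algebra.smul_def]
  exact h2.mul' hlead (by ring)

theorem pshR (h : NF k W r a) {F : R2} (hF : Lead k W W (red r) F) (hs : starR F = F) : PshR F := by
  have hle := h.le
  set H : Fin 3 → Fin 3 → R2 := fun i j =>
    Fin.lastCases 0 (fun i => Fin.lastCases 0 (fun j => hess F i j) j) i with hH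
  have hl : ∀ i j : Fin 3, Lead k W (W - om k W i - om k W j)
      (wD (Sum.inl i) (wD (Sum.inr j) r)) (H i j) := fun i j => by
    rw [← wD_wD_red]
    refine Fin.lastCases ?_ (fun i => ?_) i
    · have h1 := wD_mem_fil (Sum.inr j) hF.wD_inl_two
      rw [wD_comm] at h1
      simp only [hH, Fin.lastCases_last]
      refine Lead.of_mem (fil_mono ?_ h1)
      simp only [om, dwt, widx, Sum.elim_inr, Fin.reduceLast, id_eq, Matrix.cons_val]
      omega
    refine Fin.lastCases ?_ (fun j => ?_) j
    · have h1 := wD_mem_fil (Sum.inl i.castSucc) hF.wD_inr_two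
      simp only [hH, Fin.lastCases_last, Fin.lastCases_castSucc]
      refine Lead.of_mem (fil_mono ?_ h1)
      simp only [om, dwt, widx, Sum.elim_inl, Fin.reduceLast, id_eq, Matrix.cons_val]
      omega
    · have h1 := (hF.wD (Sum.inr j)).wD (Sum.inl i)
      simp only [dm, Sum.map_inl, Sum.map_inr] at h1
      rw [sub_right_comm] at h1
      simp only [hH, Fin.lastCases_castSucc]
      have e : ∀ i : Fin 2, om k W i.castSucc = w2 k (Sum.inl i) := by
        intro i; fin_cases i <;> rfl
      rw [e, e]
      exact h1
  intro y η
  obtain ⟨q, hq, hlim⟩ := exists_curve h.pos hF h.star_r hs y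
  have hT : ∀ {m : ℤ} {f P}, Lead k W m f P → Tendsto (fun ε => f.1 (q ε) * ((ε : ℂ) ^ m)⁻¹)
    (𝓝[>] 0) (𝓝 (evR y P)) := fun h' => Lead.tendsto hlim h.pos h'
  have hω : ∀ i : Fin 2, om k W i.castSucc = w2 k (Sum.inl i) := by
    intro i; fin_cases i <;> rfl
  set R : Fin 3 → ℝ → ℂ := fun j ε => (wD (Sum.inl j) r).1 (q ε) with hR
  set ξ : ℝ → Fin 3 → ℂ := fun ε => Fin.lastCases
    (2 * ∑ j : Fin 2, (ε : ℂ) ^ om k W j.castSucc * η j * R j.castSucc ε)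
    (fun j => -2 * R 2 ε * ((ε : ℂ) ^ om k W j.castSucc * η j)) with hξ
  have hξ2 : ∀ ε, ξ ε (Fin.last 2)
      = 2 * ∑ j : Fin 2, (ε : ℂ) ^ om k W j.castSucc * η j * R j.castSucc ε :=
    fun ε => by simp only [hξ, Fin.lastCases_last]
  have hξ1 : ∀ ε (j : Fin 2), ξ ε j.castSucc = -2 * R 2 ε * ((ε : ℂ) ^ om k W j.castSucc * η j) :=
    fun ε j => by simp only [hξ, Fin.lastCases_castSucc]
  have hne : ∀ᶠ ε : ℝ in 𝓝[>] 0, 0 < ε := self_mem_nhdsWithin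
  have hR2 : Tendsto (R 2) (𝓝[>] 0) (𝓝 (-1 / 2)) := by
    have h1 : Lead k W 0 (wD (Sum.inl 2) r) (C (-1 / 2)) := by
      refine ⟨ZHom.C _, ?_⟩
      rw [zero_add]
      refine mem_fil_one h.om_pos ?_
      rw [map_sub, evAt_zero_p3, constantCoeff_C, h.d_r]
      simp
    have h2 := hT h1
    simpa [evR, hR] using h2
  have hcoef : ∀ i, ∃ c : ℂ, Tendsto (fun ε : ℝ => ξ ε i * ((ε : ℂ) ^ om k W i)⁻¹) (𝓝[>] 0) (𝓝 c) ∧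
      ∀ i', i = Fin.castSucc i' → c = η i' := by
    refine Fin.lastCases ?_ fun j => ?_
    · refine ⟨2 * ∑ j : Fin 2, η j * evR y (pderiv (Sum.inl j) F), ?_,
        fun i' hi => absurd hi (Fin.castSucc_lt_last i').ne'⟩
      have h1 : ∀ j : Fin 2, Tendsto (fun ε : ℝ => η j * (R j.castSucc ε *
          ((ε : ℂ) ^ ((W : ℤ) - om k W j.castSucc))⁻¹)) (𝓝[>] 0)
          (𝓝 (η j * evR y (pderiv (Sum.inl j) F))) := fun j => by
        have h2 := hF.wD (Sum.inl j)
        rw [wD_red_dm, ← hω] at h2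
        exact (hT h2).const_mul _
      refine ((tendsto_finsetSum Finset.univ fun j _ => h1 j).const_mul 2).congr' ?_
      filter_upwards [hne] with ε hε
      have hε' : (ε : ℂ) ≠ 0 := by exact_mod_cast hε.ne'
      rw [hξ2, mul_assoc, Finset.sum_mul]
      congr 1
      refine Finset.sum_congr rfl fun j _ => ?_
      rw [zpow_sub₀ hε', zpow_natCast, zpow_natCast]
      simp only [Fin.reduceLast, show om k W 2 = W from rfl]
      field_simp
    · refine ⟨η j, ?_, fun i' hi => by rw [Fin.castSucc_injective _ hi]⟩
      have h1 : Tendsto (fun ε => -2 * R 2 ε * η j) (𝓝[>] 0) (𝓝 (-2 * (-1 / 2) * η j)) :=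
        (hR2.const_mul _).mul_const _
      rw [show (-2 * (-1 / 2) * η j : ℂ) = η j by ring] at h1
      refine h1.congr' ?_
      filter_upwards [hne] with ε hε
      have hε' : (ε : ℂ) ≠ 0 := by exact_mod_cast hε.ne'
      rw [hξ1]
      field_simp
  choose c hc hc' using hcoef
  have hsum : Tendsto (fun ε : ℝ => leviAt r (q ε) (ξ ε) * ((ε : ℂ) ^ W)⁻¹) (𝓝[>] 0)
      (𝓝 (∑ i, ∑ j, evR y (H i j) * c i * starRingEnd ℂ (c j))) := by
    have h1 := tendsto_finsetSum Finset.univ fun i _ => tendsto_finsetSum Finset.univ fun j _ =>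
      ((hT (hl i j)).mul (hc i)).mul ((Complex.continuous_conj.tendsto _).comp (hc j))
    refine h1.congr' ?_
    filter_upwards [hne] with ε hε
    have hε' : (ε : ℂ) ≠ 0 := by exact_mod_cast hε.ne'
    rw [leviAt, Finset.sum_mul]
    refine Finset.sum_congr rfl fun i _ => ?_
    rw [Finset.sum_mul]
    refine Finset.sum_congr rfl fun j _ => ?_
    rw [Function.comp_apply, map_mul, map_inv₀, map_pow, Complex.conj_ofReal, zpow_sub₀ hε',
      zpow_sub₀ hε', zpow_natCast, zpow_natCast, zpow_natCast, evAt_apply]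
    field_simp
  have hval : ∑ i, ∑ j, evR y (H i j) * c i * starRingEnd ℂ (c j)
      = ∑ i, ∑ j, evR y (hess F i j) * η i * starRingEnd ℂ (η j) := by
    simp only [Fin.sum_univ_castSucc (n := 2), hH, Fin.lastCases_castSucc, Fin.lastCases_last,
      map_zero, zero_mul, Finset.sum_const_zero, add_zero, hc' _ _ rfl]
  rw [← hval]
  refine ge_of_tendsto ((Complex.continuous_re.tendsto _).comp hsum) ?_
  filter_upwards [hne, hq] with ε hε hqε
  have e1 : leviAt r (q ε) (ξ ε) * ((ε : ℂ) ^ W)⁻¹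
      = (((ε ^ W)⁻¹ : ℝ) : ℂ) * leviAt r (q ε) (ξ ε) := by
    push_cast; ring
  rw [Function.comp_apply, e1, Complex.re_ofReal_mul]
  refine mul_nonneg (by positivity) (h.psc _ hqε _ ?_)
  rw [Fin.sum_univ_castSucc, hξ2]
  simp only [hξ1, hR, Fin.reduceLast]
  rw [mul_assoc, Finset.sum_mul, Finset.mul_sum, ← Finset.sum_add_distrib]
  refine Finset.sum_eq_zero fun j _ => ?_
  ring

end NF

end Model

theorem Model.CRPair.transf {n : ℕ} {r : SF n} {a : Fin n → SF n} (h : Model.CRPair r a) {Φ Ψ : Fin n → SF n}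
    (hΦ : Bihol Φ Ψ) : Model.CRPair (pull Φ r) (transfHol Φ Ψ a) := by
  refine ⟨by rw [← map_star, h.star_r], fun x hx => ?_, fun x hx ξ hξ => ?_⟩
  · have h1 : (holField (transfHol Φ Ψ a)).act (pull Φ r)
        = pull Φ ((holField a).act r) := by
      rw [← hΦ.transf_holField, hΦ.transf_act]
    rw [holField_act, holField_act] at h1
    have h2 := congrArg (evAt x) h1
    rw [map_sum] at h2
    simp only [map_mul, evAt_apply] at h2
    rw [h2, pull_coe, ← evAt_apply, map_sum]
    simpa only [map_mul, evAt_apply] using h.cr _ hx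
  · rw [leviAt_pull hΦ.hol]
    refine h.psc _ hx _ ?_
    have := sum_wD_pull hΦ.hol r x ξ
    simp only [evAt_apply] at this
    rw [← this, hξ]

theorem coord_mem_fil {n : ℕ} {ω : Fin n → ℕ} (d : Fin n ⊕ Fin n) :
    coord d ∈ fil ω (dwt ω d) := by
  refine mem_fil_iff.2 ⟨fun _ => ?_, fun e => ?_⟩
  · rcases d with j | j
    · rfl
    · exact map_zero (starRingEnd ℂ)
  · rw [wD_coord]
    split_ifs with hd
    · rw [hd, sub_self]; exact mem_fil_of_nonpos le_rfl _
    · exact Submodule.zero_mem _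

theorem pull_mem_fil_of_components {n : ℕ} {ω : Fin n → ℕ} (hω : ∀ i, 0 < ω i) {Φ : Fin n → SF n}
    (hΦ : ∀ i, Φ i ∈ fil ω (ω i)) {k : ℤ} {f : SF n} (hf : f ∈ fil ω k) :
    pull Φ f ∈ fil ω k := by
  refine pull_mem_fil (fun i => ?_) (fun d e => wD_mem_fil d ?_) hf
  · exact evAt_eq_zero_of_mem (hΦ i) (by exact_mod_cast hω i)
  · rcases e with i | i
    · exact hΦ i
    · exact star_mem_fil (hΦ i)

/-- The map adding the function `q` to the `i`-th coordinate. -/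
noncomputable def shear {n : ℕ} (i : Fin n) (q : SF n) : Fin n → SF n :=
  fun j => coord (Sum.inl j) + if j = i then q else 0

theorem shear_self {n : ℕ} (i : Fin n) (q : SF n) : shear i q i = coord (Sum.inl i) + q := by
  simp [shear]

theorem shear_of_ne {n : ℕ} {i j : Fin n} (h : j ≠ i) (q : SF n) :
    shear i q j = coord (Sum.inl j) := by
  simp [shear, h]

theorem bihol_shear {n : ℕ} {i : Fin n} {q : SF n} (hq : ∀ j, wD (Sum.inr j) q = 0)
    (h : pull (shear i q) q = q) (h' : pull (shear i (-q)) q = q) :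
    Bihol (shear i q) (shear i (-q)) := by
  have key : ∀ p : SF n, (∀ j, wD (Sum.inr j) p = 0) → ∀ l j, wD (Sum.inr j) (shear i p l) = 0 := by
    intro p hp l j
    rw [shear, map_add, wD_coord]
    split_ifs <;> simp_all
  refine ⟨key q hq, key (-q) fun j => by rw [map_neg, hq, neg_zero], fun l => ?_, fun l => ?_⟩
  · by_cases hl : l = i
    · subst hl
      rw [shear_self, map_add, map_neg, pull_coord, ext2, Sum.elim_inl, shear_self, h,
        add_neg_cancel_right]
    · rw [shear_of_ne hl, pull_coord, ext2, Sum.elim_inl, shear_of_ne hl]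
  · by_cases hl : l = i
    · subst hl
      rw [shear_self, map_add, pull_coord, ext2, Sum.elim_inl, shear_self, h',
        neg_add_cancel_right]
    · rw [shear_of_ne hl, pull_coord, ext2, Sum.elim_inl, shear_of_ne hl]

theorem toMap_zero_of_mem {n : ℕ} {ω : Fin n → ℕ} (hω : ∀ i, 0 < ω i) {Φ : Fin n → SF n}
    (hΦ : ∀ i, Φ i ∈ fil ω (ω i)) : toMap Φ 0 = 0 :=
  funext fun i => evAt_eq_zero_of_mem (hΦ i) (by exact_mod_cast hω i)

theorem shear_mem_fil {n : ℕ} {ω : Fin n → ℕ} {i : Fin n} {q : SF n}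
    (hq : q ∈ fil ω (ω i)) (j : Fin n) : shear i q j ∈ fil ω (ω j) := by
  have hc : coord (Sum.inl j) ∈ fil ω (ω j) := coord_mem_fil (Sum.inl j)
  by_cases hj : j = i
  · subst hj
    rw [shear_self]
    exact Submodule.add_mem _ hc hq
  · rwa [shear_of_ne hj]

theorem red_pull (r : SF 3) (q : SF 3) : Model.red (pull (shear 2 q) r)
    = pull (shear 2 q) (Model.red r) - (1 / 2 : ℂ) • (q + star q) := by
  rw [Model.red, Model.red, map_add, map_smul, map_add, pull_coord, pull_coord, ext2, Sum.elim_inl,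
    Sum.elim_inr, shear_self, star_add, star_coord, Sum.swap_inl, add_sub_assoc, ← smul_sub]
  congr 2
  abel

theorem red_pull_of_eq {Φ : Fin 3 → SF 3} (h : Φ 2 = coord (Sum.inl 2)) (r : SF 3) :
    Model.red (pull Φ r) = pull Φ (Model.red r) := by
  rw [Model.red, Model.red, map_add, map_smul, map_add, pull_coord, pull_coord, ext2, Sum.elim_inl,
    Sum.elim_inr, h, star_coord, Sum.swap_inl]

namespace Model

open MvPolynomial

variable {k W : ℕ}

theorem exists_eq_A0_add {A : R2} (hA : ZHom (w2 k) A (k + 1)) :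
    ∃ (b : Fin (k + 1) → ℂ) (c : ℂ), A = A0 b + C c * X (Sum.inl 0) ^ (k + 1) := by
  let Q : R2 → Prop := fun A => ∃ (b : Fin (k + 1) → ℂ) (c : ℂ),
    A = A0 b + C c * X (Sum.inl 0) ^ (k + 1)
  have h0 : Q 0 := ⟨0, 0, by simp [A0]⟩
  have hadd : ∀ A B, Q A → Q B → Q (A + B) := by
    rintro _ _ ⟨b, c, rfl⟩ ⟨b', c', rfl⟩
    refine ⟨b + b', c + c', ?_⟩
    have : A0 (b + b') = A0 b + A0 b' := by
      rw [A0, A0, A0, ← Finset.sum_add_distrib]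
      refine Finset.sum_congr rfl fun j _ => ?_
      rw [Pi.add_apply, add_mul, C_add, add_mul]
    rw [this, C_add]
    ring
  change Q A
  rw [← support_sum_monomial_coeff A]
  refine Finset.sum_induction _ Q hadd h0 fun d hd => ?_
  have h1 := hA (mem_support_iff.1 hd)
  rw [ZHom.weight_cast, Finsupp.weight_apply, Finsupp.sum_fintype _ _ (by simp)] at h1
  simp only [Fintype.sum_sum_type, Fin.sum_univ_two, w2, Sum.elim_inl, Sum.elim_inr, smul_eq_mul,
    Matrix.cons_val_zero, Matrix.cons_val_one, mul_one] at h1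
  norm_cast at h1
  have e1 : d (Sum.inl 1) = 0 := by
    by_contra h
    have := Nat.le_mul_of_pos_left (k + 2) (Nat.pos_of_ne_zero h)
    omega
  have e2 : d (Sum.inr 1) = 0 := by
    by_contra h
    have := Nat.le_mul_of_pos_left (k + 2) (Nat.pos_of_ne_zero h)
    omega
  rw [e1, e2, zero_mul, add_zero, add_zero] at h1
  have hm : monomial d (coeff d A) = C (coeff d A) *
      (X (Sum.inl 0) ^ d (Sum.inl 0) * X (Sum.inr 0) ^ d (Sum.inr 0)) := by
    rw [monomial_eq, Finsupp.prod_fintype _ _ (by simp), Fintype.prod_sum_type, Fin.prod_univ_two,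
      Fin.prod_univ_two, e1, e2, pow_zero, pow_zero, mul_one, mul_one]
  rw [hm]
  by_cases hr : d (Sum.inr 0) = 0
  · exact ⟨0, coeff d A, by
      rw [hr, add_zero] at h1
      rw [hr, h1]; simp [A0]⟩
  · have hlt : d (Sum.inl 0) < k + 1 := by omega
    refine ⟨Pi.single ⟨d (Sum.inl 0), hlt⟩ (coeff d A / (d (Sum.inl 0) + 1)), 0, ?_⟩
    have hne : ((d (Sum.inl 0) : ℂ) + 1) ≠ 0 := by exact Nat.cast_add_one_ne_zero _
    rw [A0, Finset.sum_eq_single ⟨d (Sum.inl 0), hlt⟩]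
    · rw [Pi.single_eq_same, div_mul_cancel₀ _ hne, C_0, zero_mul, add_zero,
        show k + 1 - d (Sum.inl 0) = d (Sum.inr 0) by omega]
    · intro j _ hj
      rw [Pi.single_eq_of_ne hj, zero_mul, C_0, zero_mul]
    · simp

end Model

namespace Model

open MvPolynomial

variable {k W : ℕ}

theorem p3_C (c : ℂ) : p3 (C c) = algebraMap ℂ (SF 3) c := AlgHomClass.commutes p3 c

theorem p3_X (d : Fin 2 ⊕ Fin 2) : p3 (X d) = coord (dm d) := aeval_X _ d

theorem pull_p3 {Φ : Fin 3 → SF 3} (h : ∀ i : Fin 2, Φ i.castSucc = coord (Sum.inl i.castSucc))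
    (P : R2) : pull Φ (p3 P) = p3 P := by
  refine (ringHom_aeval (pull Φ).toAlgHom _ P).trans ?_
  refine congrArg (fun g => aeval g P) (funext fun d => ?_)
  change pull Φ (coord _) = _
  rw [pull_coord]
  rcases d with i | i
  · exact h i
  · change star (Φ i.castSucc) = _
    rw [h, star_coord]
    rfl

theorem pull_p3_A0 {Φ : Fin 3 → SF 3} (h : Φ 0 = coord (Sum.inl 0)) (b : Fin (k + 1) → ℂ) :
    pull Φ (p3 (A0 b)) = p3 (A0 b) := by
  have h1 : pull Φ (p3 (X (Sum.inl 0))) = p3 (X (Sum.inl 0)) := by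
    rw [p3_X, dm, Sum.map_inl, pull_coord]; exact h
  have h2 : pull Φ (p3 (X (Sum.inr 0))) = p3 (X (Sum.inr 0)) := by
    rw [p3_X, dm, Sum.map_inr, pull_coord, ext2, Sum.elim_inr]
    change star (Φ 0) = _
    rw [h, star_coord]; rfl
  simp only [A0, map_sum, map_mul, map_pow, h1, h2, p3_C, AlgHomClass.commutes]

namespace NF

variable {r : SF 3} {a : Fin 3 → SF 3} {Φ Ψ : Fin 3 → SF 3}

theorem transf (h : NF k W r a) (hΦ : Bihol Φ Ψ) {k' W' : ℕ} (hle : k' + 2 ≤ W')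
    (h0 : toMap Φ 0 = 0) (hΨ : Ψ 0 = coord (Sum.inl 0))
    (hd : ∀ j, evAt 0 (wD (Sum.inl j) (Φ 2)) = if j = 2 then 1 else 0)
    (hred : red (pull Φ r) ∈ fil (om k' W') W')
    (ha : transfHol Φ Ψ a 1 ∈ fil (om k' W') (k' + 1)) :
    NF k' W' (pull Φ r) (transfHol Φ Ψ a) := by
  refine { h.toCRPair.transf hΦ with
    le := hle, red_mem := hred, d_r := fun j => ?_, a_zero := ?_, a_one := ha }
  · have := sum_wD_pull hΦ.hol r 0 (Pi.single j 1)
    simp only [h0, h.d_r, mul_ite, mul_zero, Finset.sum_ite_eq', Finset.mem_univ, if_true,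
      jac, Pi.single_apply, ite_mul, one_mul, zero_mul, hd, Finset.sum_ite_eq'] at this
    rw [this]
  · rw [transfHol, hΨ, VF.act_coord, evAt_apply, pull_coe, h0]
    exact h.a_zero

theorem succ_left (h : NF k W r a) (hle : k + 3 ≤ W) (ha : a 1 ∈ fil (om k W) (k + 2)) :
    NF (k + 1) W r a := by
  have hω : ∀ i, om k W i ≤ om (k + 1) W i := by
    intro i; fin_cases i <;> simp [om]
  refine { h.toCRPair with
    le := hle, red_mem := fil_mono_weight hω h.red_mem, d_r := h.d_r, a_zero := h.a_zero,
    a_one := ?_ }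
  refine fil_mono ?_ (fil_mono_weight hω ha)
  push_cast
  omega

/-- Removal of the pure term in the leading part of the second component of the field. -/
theorem exists_lead_A0 (h : NF k W r a) : ∃ Φ Ψ : Fin 3 → SF 3, Bihol Φ Ψ ∧ toMap Φ 0 = 0 ∧
    NF k W (pull Φ r) (transfHol Φ Ψ a) ∧
      ∃ b : Fin (k + 1) → ℂ, Lead k W (k + 1) (transfHol Φ Ψ a 1) (A0 b) := by
  have hle := h.le
  obtain ⟨A, hA⟩ := exists_lead h.pos (n := (k : ℤ) + 1) (by omega) h.a_one fun e => by omega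
  obtain ⟨b, c, rfl⟩ := exists_eq_A0_add hA.1
  have hk : ((k : ℂ) + 2) ≠ 0 := by exact_mod_cast (k + 1).succ_ne_zero
  set Q : R2 := C (c / (k + 2)) * X (Sum.inl 0) ^ (k + 2) with hQ
  have hQz : ZHom (w2 k) Q (k + 2) := by
    refine ZHom.C_mul _ ?_
    have := (ZHom.X (w := w2 k) (Sum.inl 0)).pow (k + 2)
    simpa [w2] using this
  have hQ0 : pderiv (Sum.inl 0) Q = C c * X (Sum.inl 0) ^ (k + 1) := by
    rw [hQ, Derivation.leibniz, pderiv_C, Derivation.leibniz_pow, pderiv_X_self]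
    simp only [smul_eq_mul, mul_one, mul_zero, add_zero, nsmul_eq_mul,
      show k + 2 - 1 = k + 1 from rfl]
    rw [← mul_assoc, show ((k + 2 : ℕ) : R2) = C ((k : ℂ) + 2) by
      rw [map_add, map_natCast, map_ofNat]; push_cast; rfl, ← C_mul,
      div_mul_cancel₀ _ hk]
  have hQd : ∀ d : Fin 2 ⊕ Fin 2, d ≠ Sum.inl 0 → pderiv d Q = 0 := fun d hd => by
    rw [hQ, Derivation.leibniz, pderiv_C, Derivation.leibniz_pow, pderiv_X_of_ne hd.symm]
    simp
  have hqm : p3 Q ∈ fil (om k W) (om k W 1) := by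
    have := p3_mem_fil (W := W) hQz
    exact this
  have hm := shear_mem_fil hqm
  have hinv : ∀ q, pull (shear 1 q) (p3 Q) = p3 Q := fun q => by
    have : pull (shear 1 q) (p3 (X (Sum.inl 0))) = p3 (X (Sum.inl 0)) := by
      rw [p3_X, dm, Sum.map_inl, pull_coord, ext2, Sum.elim_inl]
      exact shear_of_ne (by decide) q
    rw [hQ, map_mul, map_mul, map_pow, map_pow, this, p3_C, AlgHomClass.commutes]
  have hb : Bihol (shear 1 (p3 Q)) (shear 1 (-p3 Q)) := by
    refine bihol_shear (fun j => ?_) (hinv _) (hinv _)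
    refine Fin.lastCases (wD_inr_two_p3 Q) (fun j => ?_) j
    have := wD_p3 (Sum.inr j) Q
    rw [hQd _ (by simp), map_zero] at this
    exact this
  have h0 := toMap_zero_of_mem h.om_pos hm
  have hlead : Lead k W (k + 1) (transfHol (shear 1 (p3 Q)) (shear 1 (-p3 Q)) a 1) (A0 b) := by
    have e1 : (holField a).act (shear 1 (-p3 Q) 1) = a 1 - a 0 * p3 (C c * X (Sum.inl 0) ^ (k + 1)) := by
      have d0 := wD_p3 (Sum.inl 0) Q
      have d1 := wD_p3 (Sum.inl 1) Q
      rw [hQ0] at d0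
      rw [hQd _ (by simp), map_zero] at d1
      simp only [dm, Sum.map_inl, Fin.castSucc_zero, Fin.castSucc_one] at d0 d1
      rw [shear_self, map_add, map_neg, VF.act_coord, holField_act a (p3 Q), Fin.sum_univ_three,
        d0, d1, wD_inl_two_p3, mul_zero, mul_zero, add_zero, add_zero, ← sub_eq_add_neg]
      rfl
    have e2 : Lead k W (k + 1) ((holField a).act (shear 1 (-p3 Q) 1)) (A0 b) := by
      rw [e1]
      have hz : ZHom (w2 k) (C c * X (Sum.inl 0) ^ (k + 1)) ((k : ℤ) + 1) := by
        rw [← hQ0]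
        have := hQz.pderiv (Sum.inl 0)
        have e : ((k : ℤ) + 2) - (w2 k (Sum.inl 0) : ℕ) = k + 1 := by simp [w2]; ring
        rwa [e] at this
      have := hA.sub (h.lead_zero.mul' (Lead.of_p3 hz) (zero_add _))
      rwa [one_mul, add_sub_cancel_right] at this
    refine ⟨e2.1, ?_⟩
    have e3 := pull_mem_fil_of_components h.om_pos hm e2.2
    rwa [map_sub, pull_p3_A0 (shear_of_ne (by decide) _)] at e3
  refine ⟨_, _, hb, h0, ?_, b, hlead⟩
  refine h.transf hb hle h0 (shear_of_ne (by decide) _) (fun j => ?_) ?_ hlead.mem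
  · rw [shear_of_ne (by decide), wD_coord]
    simp only [Sum.inl.injEq]
    split_ifs <;> simp
  · rw [red_pull_of_eq (shear_of_ne (by decide) _)]
    exact pull_mem_fil_of_components h.om_pos hm h.red_mem

theorem constantCoeff_pderiv (h : NF k W r a) {F : R2} (hF : Lead k W W (red r) F) (i : Fin 2) :
    constantCoeff (pderiv (Sum.inl i) F) = 0 := by
  have hle := h.le
  have hne : i.castSucc ≠ (2 : Fin 3) := (Fin.castSucc_lt_last i).ne
  have h1 := wD_mem_fil (dm (Sum.inl i)) hF.2
  have h2 : 0 < (W : ℤ) + 1 - dwt (om k W) (dm (Sum.inl i)) := by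
    rw [dwt_dm]
    fin_cases i <;> simp [w2] <;> omega
  have h3 := evAt_eq_zero_of_mem h1 h2
  rwa [map_sub, map_sub, wD_p3, evAt_zero_p3, wD_red_dm, dm, Sum.map_inl, h.d_r,
    if_neg hne, zero_sub, neg_eq_zero] at h3

/-- Removal of a pluriharmonic leading part. -/
theorem exists_succ_right (h : NF k W r a) {F : R2} (hF : Lead k W W (red r) F) (hs : starR F = F)
    (hH : ∀ i j, hess F i j = 0) : ∃ Φ Ψ : Fin 3 → SF 3, Bihol Φ Ψ ∧ toMap Φ 0 = 0 ∧
      NF k (W + 1) (pull Φ r) (transfHol Φ Ψ a) := by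
  have hle := h.le
  have hne : ∀ i : Fin 2, i.castSucc ≠ (2 : Fin 3) := fun i => (Fin.castSucc_lt_last i).ne
  have hW : (W : ℂ) ≠ 0 := by exact_mod_cast h.pos.ne'
  set Q : R2 := C (2 / (W : ℂ)) * holEuler k F with hQ
  have hQz : ZHom (w2 k) Q W := (zhom_holEuler hF.1).C_mul _
  have hQs : Q + starR Q = C 2 * F := by
    have hc : starRingEnd ℂ (2 / (W : ℂ)) = 2 / W := by
      rw [map_div₀, map_ofNat (starRingEnd ℂ) 2, Complex.conj_natCast]
    rw [hQ, map_mul starR, starR_C, hc, ← mul_add, holEuler_add_starR hF.1 hs, ← mul_assoc,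
      ← C_mul, div_mul_cancel₀ _ hW]
  have hH' : ∀ i j : Fin 2, pderiv (Sum.inr j) (pderiv (Sum.inl i) F) = 0 := fun i j => by
    rw [pderiv_pderiv_comm]; exact hH i j
  have hQr : ∀ j, pderiv (Sum.inr j) Q = 0 := fun j => by
    rw [hQ, holEuler]
    simp [Derivation.leibniz, hH']
  have hQ0 : ∀ i : Fin 2, constantCoeff (pderiv (Sum.inl i) Q) = 0 := fun i => by
    rw [hQ, holEuler]
    fin_cases i <;> simp [Derivation.leibniz, h.constantCoeff_pderiv hF]
  have hqm : p3 Q ∈ fil (om k W) (om k W 2) := p3_mem_fil hQz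
  have hm := shear_mem_fil hqm
  have hinv : ∀ q, pull (shear 2 q) (p3 Q) = p3 Q := fun q =>
    pull_p3 (fun i => shear_of_ne (hne i) q) Q
  have hb : Bihol (shear 2 (p3 Q)) (shear 2 (-p3 Q)) := by
    refine bihol_shear (fun j => ?_) (hinv _) (hinv _)
    refine Fin.lastCases (wD_inr_two_p3 Q) (fun j => ?_) j
    have := wD_p3 (Sum.inr j) Q
    rw [hQr, map_zero] at this
    exact this
  have h0 := toMap_zero_of_mem h.om_pos hm
  have hω : ∀ i, om k W i ≤ om k (W + 1) i := by
    intro i; fin_cases i <;> simp [om]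
  refine ⟨_, _, hb, h0, h.transf hb (by omega) h0 (shear_of_ne (by decide) _) (fun j => ?_) ?_ ?_⟩
  · rw [shear_self, map_add, map_add, wD_coord]
    refine Fin.lastCases ?_ (fun j => ?_) j
    · change _ + evAt 0 (wD (Sum.inl (2 : Fin 3)) _) = _
      rw [wD_inl_two_p3]; simp
    · have h1 := wD_p3 (Sum.inl j) Q
      rw [dm, Sum.map_inl] at h1
      rw [h1, evAt_zero_p3, hQ0, if_neg (hne j), if_neg fun e => hne j (Sum.inl.inj e)]
      simp
  · have h1 : red (pull (shear 2 (p3 Q)) r) = pull (shear 2 (p3 Q)) (red r - p3 F) := by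
      have h2 : (1 / 2 : ℂ) • p3 (C 2 * F) = p3 F := by
        rw [map_mul, p3_C, ← Algebra.smul_def, smul_smul]
        norm_num
      rw [red_pull, pv_star, ← map_add, hQs, h2, map_sub,
        pull_p3 (fun i => shear_of_ne (hne i) _)]
    rw [h1]
    have := fil_mono_weight hω (pull_mem_fil_of_components h.om_pos hm hF.2)
    exact_mod_cast this
  · rw [transfHol, shear_of_ne (by decide), VF.act_coord]
    exact fil_mono_weight hω (pull_mem_fil_of_components h.om_pos hm h.a_one)

end NF

end Model

namespace Model

open MvPolynomial

variable {k W : ℕ}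

theorem word0_append_singleton (b : Fin (k + 1) → ℂ) (v : List Bool) (c : Bool) (p : R2) :
    word0 b (v ++ [c]) p = word0 b v (if c then L0 b p else Lb0 b p) := by
  simp [word0, List.foldr_append]

theorem word0_C_mul (b : Fin (k + 1) → ℂ) (v : List Bool) (c : ℂ) (p : R2) :
    word0 b v (C c * p) = C c * word0 b v p := by
  have h : ∀ (D : Derivation ℂ R2 R2) (q : R2), D (C c * q) = C c * D q := fun D q => by
    rw [← smul_eq_C_mul, D.map_smul, smul_eq_C_mul]
  induction v with
  | nil => rfl
  | cons e v ih =>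
    cases e
    · exact (congrArg (Lb0 b) ih).trans (h _ _)
    · exact (congrArg (L0 b) ih).trans (h _ _)

theorem eq_zero_of_word0 (b : Fin (k + 1) → ℂ) {n : ℕ} {G : R2} (hG : ZHom (w2 k) G n)
    (h1 : pderiv (Sum.inl 1) G = 0) (h2 : pderiv (Sum.inr 1) G = 0)
    (h : ∀ v : List Bool, v.length = n → constantCoeff (word0 b v G) = 0) : G = 0 := by
  induction n generalizing G with
  | zero =>
    have h3 := h [] rfl
    change constantCoeff G = 0 at h3
    rw [hG.eq_C w2_pos, h3, C_0]
  | succ n ih =>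
    have key : ∀ c : Bool, (if c then L0 b G else Lb0 b G) =
        pderiv (if c then Sum.inl 0 else Sum.inr 0) G := fun c => by
      cases c
      · simp [Lb0_apply, h2]
      · simp [L0_apply, h1]
    have hd : ∀ c : Bool, pderiv (if c then Sum.inl (0 : Fin 2) else Sum.inr (0 : Fin 2)) G = 0 := by
      intro c
      refine ih ?_ ?_ ?_ fun v hv => ?_
      · have := hG.pderiv (if c then Sum.inl (0 : Fin 2) else Sum.inr (0 : Fin 2))
        convert this using 1
        cases c <;> simp [w2]
      · rw [pderiv_pderiv_comm, h1, map_zero]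
      · rw [pderiv_pderiv_comm, h2, map_zero]
      · rw [← key, ← word0_append_singleton]
        exact h _ (by simp [hv])
    refine hG.eq_zero_of_pderiv (by positivity) ?_
    rintro (i | i) <;> fin_cases i
    · exact hd true
    · exact h1
    · exact hd false
    · exact h2

theorem mg2_eq_word0 (b : Fin (k + 1) → ℂ) {c : R2} (h1 : pderiv (Sum.inl 1) c = 0)
    (h2 : pderiv (Sum.inr 1) c = 0) (v : List Bool) : mg2 b c v = word0 b v (Lb0 b c) := by
  induction v with
  | nil => rfl
  | cons e v ih =>
    cases e
    · change Lb0 b (mg2 b c v) = Lb0 b (word0 b v _)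
      rw [ih]
    · change L0 b (mg2 b c v) - _ = L0 b (word0 b v _)
      rw [ih, h1, h2, mul_zero, mul_zero, add_zero, sub_zero]

namespace NF

variable {r : SF 3} {a : Fin 3 → SF 3}

theorem pderiv_one_eq_zero (h : NF k W r a) (hW : W = k + 2) {F : R2}
    (hF : Lead k W W (red r) F) (hs : starR F = F) :
    pderiv (Sum.inl 1) F = 0 ∧ pderiv (Sum.inr 1) F = 0 := by
  have h1 : pderiv (Sum.inl 1) F = 0 := by
    have := hF.1.pderiv (Sum.inl 1)
    have e : (W : ℤ) - (w2 k (Sum.inl 1) : ℕ) = 0 := by simp [w2, hW]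
    rw [e] at this
    rw [this.eq_C w2_pos, h.constantCoeff_pderiv hF, C_0]
  refine ⟨h1, ?_⟩
  rw [← hs, ← starR_pderiv, h1, map_zero]

/-- Vanishing of all commutators, or of all derivatives of the Levi form, of critical order implies
that the leading part of the hypersurface is pluriharmonic. -/
theorem hess_eq_zero_of_vanish (h : NF k W r a) {F : R2} (hF : Lead k W W (red r) F)
    (hs : starR F = F) {b : Fin (k + 1) → ℂ} (hb : Lead k W (k + 1) (a 1) (A0 b))
    (hW : W = k + 2 ∨ b ≠ 0) (hv : CommVanish r a 0 (W + 1) ∨ LeviVanish r a 0 (W + 1))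
    (i j : Fin 2) : hess F i j = 0 := by
  have hle := h.le
  have hL := h.leadField hF hb
  rcases hle.eq_or_lt with he | hlt
  · obtain ⟨h1, h2⟩ := h.pderiv_one_eq_zero he.symm hF hs
    have h01 : hess F 0 1 = 0 := by rw [hess, h2, map_zero]
    have h10 : hess F 1 0 = 0 := by rw [hess, pderiv_pderiv_comm, h1, map_zero]
    have h11 : hess F 1 1 = 0 := by rw [hess, h2, map_zero]
    have h00 : hess F 0 0 = 0 := by
      refine eq_zero_of_word0 b (n := k) ?_ ?_ ?_ fun v hl => ?_
      · have := (hF.1.pderiv (Sum.inr 0)).pderiv (Sum.inl 0)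
        have e : (W : ℤ) - (w2 k (Sum.inr 0) : ℕ) - (w2 k (Sum.inl 0) : ℕ) = k := by
          simp [w2, ← he]; ring
        rwa [e] at this
      · rw [hess, pderiv_pderiv_comm, pderiv_pderiv_comm _ _ F, h1, map_zero, map_zero]
      · rw [hess, pderiv_pderiv_comm, pderiv_pderiv_comm _ _ F, h2, map_zero, map_zero]
      · rcases hv with hv | hv
        · have h3 := constantCoeff_mg2 hL h.d_r hv v (by omega)
          have h4 : C 2 * L0 b F = C 2 * pderiv (Sum.inl 0) F := by
            rw [L0_apply, h1, mul_zero, add_zero]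
          have h5 : ∀ d, pderiv d F = 0 → pderiv d (C 2 * L0 b F) = 0 := fun d hd => by
            rw [h4, pderiv_C_mul, pderiv_pderiv_comm, hd, map_zero, mul_zero]
          rw [mg2_eq_word0 b (h5 _ h1) (h5 _ h2)] at h3
          have h6 : Lb0 b (C 2 * L0 b F) = C 2 * hess F 0 0 := by
            rw [Lb0_apply, h5 _ h2, mul_zero, add_zero, h4, pderiv_C_mul, pderiv_pderiv_comm, hess]
          rw [h6, word0_C_mul, map_mul, constantCoeff_C] at h3
          exact (mul_eq_zero.1 h3).resolve_left two_ne_zero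
        · have h3 := constantCoeff_word_lamR hL hF hv v (by omega)
          convert h3 using 3
          simp [lamR, h01, h10, h11]
    fin_cases i <;> fin_cases j
    exacts [h00, h01, h10, h11]
  · have hb0 : b ≠ 0 := hW.resolve_left (by omega)
    obtain ⟨P, hPz, hP, hPF⟩ : ∃ P : SR k, ZHom (sw k) P W ∧ Lb P = 0 ∧
        P + starS P = C 2 * toS b F := by
      rcases hv with hv | hv
      · exact exists_of_commutator b hle hF.1 hs fun v hl => constantCoeff_mg2 hL h.d_r hv v hl
      · exact exists_of_levi b (by omega) hF.1 hs (h.pshR hF hs) fun v hl =>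
          constantCoeff_word_lamR hL hF hv v hl
    exact hess_eq_zero hb0 hlt hF.1 hs (h.pshR hF hs) hPz hP hPF i j

theorem mem (h : NF k W r a) : r ∈ fil (om k W) W := by
  have hr : r = red r - (1 / 2 : ℂ) • (coord (Sum.inl 2) + coord (Sum.inr 2)) := by
    rw [red, add_sub_cancel_right]
  rw [hr]
  exact Submodule.sub_mem _ h.red_mem (Submodule.smul_mem _ _ (Submodule.add_mem _
    (coord_mem_fil (ω := om k W) (Sum.inl 2)) (coord_mem_fil (ω := om k W) (Sum.inr 2))))

theorem commVanish_iff_leviVanish (h : NF k W r a) (N : ℕ) :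
    CommVanish r a 0 N ↔ LeviVanish r a 0 N := by
  induction hm : 2 * N - (k + W) using Nat.strong_induction_on generalizing k W r a with
  | _ m ih =>
  subst hm
  obtain ⟨Φ, Ψ, hΦ, h0, h', b, hb⟩ := h.exists_lead_A0
  rw [← h0, ← hΦ.commVanish_iff, ← hΦ.leviVanish_iff]
  obtain ⟨F, hF, hs⟩ := h'.exists_lead_red
  have hL := h'.leadField hF hb
  have hle := h.le
  rcases le_or_gt N W with hN | hN
  · have hr := fil_mono (l := (N : ℤ)) (by exact_mod_cast hN) h'.mem
    exact iff_of_true (commVanish_of_mem hL.mem hr) (leviVanish_of_mem hL.mem hr)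
  by_cases hH : ∀ i j, hess F i j = 0
  · obtain ⟨Φ', Ψ', hΦ', h0', h''⟩ := h'.exists_succ_right hF hs hH
    have := ih _ (by omega) h'' rfl
    rwa [hΦ'.commVanish_iff, hΦ'.leviVanish_iff, h0'] at this
  by_cases hW : W = k + 2 ∨ b ≠ 0
  · refine iff_of_false (fun hv => hH ?_) (fun hv => hH ?_)
    · exact h'.hess_eq_zero_of_vanish hF hs hb hW (.inl fun μ hμ => hv μ (by omega))
    · exact h'.hess_eq_zero_of_vanish hF hs hb hW (.inr fun cs hcs => hv cs (by omega))
  · push Not at hW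
    refine ih _ (by omega) (h'.succ_left (by omega) ?_) rfl
    have h1 : A0 b = 0 := by simp [A0, hW.2]
    have := hb.2
    rw [h1, map_zero, sub_zero] at this
    exact fil_mono (by omega) this

end NF

end Model

open ComplexOrder in
theorem exists_matrix_of_dotProduct_eq_zero {α c : Fin 3 → ℂ} (hα : α ≠ 0) (hc : c ≠ 0)
    (h : ∑ i, α i * c i = 0) : ∃ B : Matrix (Fin 3) (Fin 3) ℂ, IsUnit B.det ∧ (∀ i, B i 0 = α i) ∧
      ∀ j, ∑ i, B i j * c i = if j = 2 then -1 / 2 else 0 := by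
  obtain ⟨w, hw⟩ : ∃ w : Fin 3 → ℂ, ∑ i, w i * c i = -1 / 2 := by
    obtain ⟨i, hi⟩ := Function.ne_iff.1 hc
    refine ⟨Pi.single i (-1 / 2 / c i), ?_⟩
    simp only [Pi.single_apply, ite_mul, zero_mul, Finset.sum_ite_eq', Finset.mem_univ, if_true]
    exact div_mul_cancel₀ _ hi
  have hs : ∑ i, α i * star (α i) ≠ 0 := fun e => hα (dotProduct_self_star_eq_zero.1 e)
  set β : Fin 3 → ℂ := fun i => star (α i)
  change ∑ i, α i * β i ≠ 0 at hs
  set v : Fin 3 → ℂ := ![β 1 * c 2 - β 2 * c 1, β 2 * c 0 - β 0 * c 2, β 0 * c 1 - β 1 * c 0]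
  refine ⟨Matrix.of fun i => ![α i, v i, w i], ?_, fun i => rfl, fun j => ?_⟩
  · have : (Matrix.of fun i => ![α i, v i, w i]).det = (∑ i, α i * β i) / 2 := by
      rw [Matrix.det_fin_three]
      simp only [Fin.sum_univ_three, v, Matrix.of_apply, Matrix.cons_val] at h hw ⊢
      linear_combination (-(α 0 * β 0 + α 1 * β 1 + α 2 * β 2)) * hw +
        (w 0 * β 0 + w 1 * β 1 + w 2 * β 2) * h
    rw [this]
    exact (div_ne_zero hs two_ne_zero).isUnit
  · fin_cases j
    · simpa using h
    · simp [Fin.sum_univ_three, v]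
      ring
    · simpa using hw

/-- The affine map `x ↦ B x + q`. -/
noncomputable def aff {n : ℕ} (B : Matrix (Fin n) (Fin n) ℂ) (q : Cn n) (i : Fin n) : SF n :=
  ∑ j, B i j • coord (Sum.inl j) + algebraMap ℂ (SF n) (q i)

section aff

variable {n : ℕ} (B : Matrix (Fin n) (Fin n) ℂ) (q : Cn n)

open Matrix in
theorem toMap_aff (x : Cn n) : toMap (aff B q) x = B *ᵥ x + q := by
  funext i
  change evAt x (aff B q i) = _
  rw [aff, map_add, map_sum, AlgHomClass.commutes]
  simp only [map_smul]
  rfl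

theorem wD_aff (d : Fin n ⊕ Fin n) (i : Fin n) :
    wD d (aff B q i) = Sum.elim (fun j => algebraMap ℂ (SF n) (B i j)) 0 d := by
  rw [aff, map_add, Derivation.map_algebraMap, add_zero, map_sum]
  simp only [Derivation.map_smul, wD_coord]
  rcases d with j | j
  · simp [Algebra.algebraMap_eq_smul_one]
  · simp

open Matrix in
theorem bihol_aff {B' : Matrix (Fin n) (Fin n) ℂ} (h : B * B' = 1) (h' : B' * B = 1) :
    Bihol (aff B q) (aff B' (-(B' *ᵥ q))) := by
  refine ⟨fun i j => by rw [wD_aff]; rfl, fun i j => by rw [wD_aff]; rfl,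
    fun i => SF.ext fun x => ?_, fun i => SF.ext fun x => ?_⟩
  · change toMap (aff B' _) (toMap (aff B q) x) i = x i
    rw [toMap_aff, toMap_aff, mulVec_add, mulVec_mulVec, h', one_mulVec, add_neg_cancel_right]
  · change toMap (aff B q) (toMap (aff B' _) x) i = x i
    rw [toMap_aff, toMap_aff, mulVec_add, mulVec_mulVec, h, one_mulVec, mulVec_neg,
      mulVec_mulVec, h, one_mulVec, neg_add_cancel_right]

end aff

namespace Model

variable {r : SF 3} {a : Fin 3 → SF 3}

theorem red_mem_fil_two (hs : star r = r) (h0 : evAt 0 r = 0)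
    (hd : ∀ j, evAt 0 (wD (Sum.inl j) r) = if j = 2 then -1 / 2 else 0) :
    red r ∈ fil (om 0 2) 2 := by
  have hω : ∀ i, 0 < om 0 2 i := fun i => by fin_cases i <;> simp [om]
  have hf0 : evAt 0 (wD (Sum.inl 0) (red r)) = 0 := by
    rw [show (Sum.inl 0 : Fin 3 ⊕ Fin 3) = dm (Sum.inl 0) from rfl, wD_red_dm]
    exact (hd 0).trans (if_neg (by decide))
  refine mem_fil_iff.2 ⟨fun _ => ?_, fun d => ?_⟩
  · rw [red, map_add, h0, map_smul, map_add]
    change 0 + (1 / 2 : ℂ) • ((0 : ℂ) + star (0 : ℂ)) = 0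
    simp
  · rcases d with i | i <;> fin_cases i
    · exact mem_fil_one hω hf0
    · exact mem_fil_of_nonpos (by simp [dwt, widx, om]) _
    · exact mem_fil_of_nonpos (by simp [dwt, widx, om]) _
    · refine mem_fil_one hω ?_
      have := wD_star (Sum.inr 0) (red r)
      rw [star_red hs] at this
      change evAt 0 (wD (Sum.inr 0) (red r)) = 0
      rw [this, map_star, Sum.swap_inr, hf0, star_zero]
    · exact mem_fil_of_nonpos (by simp [dwt, widx, om]) _
    · exact mem_fil_of_nonpos (by simp [dwt, widx, om]) _

/-- Affine normalization of a hypersurface and a field of type `(1, 0)`. -/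
theorem CRPair.exists_nf (h : CRPair r a) {p : Cn 3} (hp : evAt p r = 0)
    (hd : (fun j => evAt p (wD (Sum.inl j) r)) ≠ 0) (ha : (fun j => evAt p (a j)) ≠ 0) :
    ∃ Φ Ψ : Fin 3 → SF 3, Bihol Φ Ψ ∧ toMap Φ 0 = p ∧ NF 0 2 (pull Φ r) (transfHol Φ Ψ a) := by
  obtain ⟨B, hB, hBa, hBd⟩ := exists_matrix_of_dotProduct_eq_zero ha hd (h.cr p hp)
  have hB' := Matrix.nonsing_inv_mul B hB
  have hb := bihol_aff B p (Matrix.mul_nonsing_inv B hB) hB'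
  have h0 : toMap (aff B p) 0 = p := by rw [toMap_aff, Matrix.mulVec_zero, zero_add]
  have hT := h.transf hb
  have hd' : ∀ j, evAt 0 (wD (Sum.inl j) (pull (aff B p) r)) = if j = 2 then -1 / 2 else 0 := by
    intro j
    have := sum_wD_pull hb.hol r 0 (Pi.single j 1)
    simp only [Pi.single_apply, ite_mul, one_mul, zero_mul, Finset.sum_ite_eq', Finset.mem_univ,
      if_true, jac, wD_aff, Sum.elim_inl, AlgHomClass.commutes, h0] at this
    rw [this]
    exact hBd j
  have ha' : ∀ j, evAt 0 (transfHol (aff B p) (aff B⁻¹ (-(B⁻¹.mulVec p))) a j)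
      = (1 : Matrix (Fin 3) (Fin 3) ℂ) j 0 := by
    intro j
    rw [transfHol, evAt_apply, pull_coe, h0, ← evAt_apply, holField_act, map_sum, ← hB',
      Matrix.mul_apply]
    refine Finset.sum_congr rfl fun i _ => ?_
    rw [map_mul, wD_aff, Sum.elim_inl, AlgHomClass.commutes, hBa, mul_comm]
    rfl
  refine ⟨_, _, hb, h0, { hT with
    le := le_rfl
    red_mem := red_mem_fil_two hT.star_r ?_ hd'
    d_r := hd'
    a_zero := (ha' 0).trans (by simp)
    a_one := ?_ }⟩
  · rw [evAt_apply, pull_coe, h0]; exact hp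
  · have := mem_fil_one (ω := om 0 2) (fun i => by fin_cases i <;> simp [om])
      ((ha' 1).trans (by simp))
    exact_mod_cast this

end Model

/-- D'Angelo conjecture in ℂ³, Chen–Yin–Yuan / Huang–Yin. For a smooth
pseudoconvex real hypersurface `M ⊂ ℂ³`, `p ∈ M`, and a smooth CR vector field `L` along `M`
with `L(p) ≠ 0`, the commutator type and the Levi-form type of `L` at `p` coincide:
`t_L(M,p) = c_L(M,p)`. -/
theorem tType_eq_cType_dim3 (ρ : Cn 3 → ℝ) (hρ : ContDiff ℝ (⊤ : ℕ∞) ρ)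
    (M : Set (Cn 3)) (hM : M = {x | ρ x = 0}) (hreg : ∀ x ∈ M, fderiv ℝ ρ x ≠ 0)
    (hpsc : Pseudoconvex ρ M)
    (p : Cn 3) (hp : p ∈ M)
    (a : Fin 3 → Cn 3 → ℂ) (ha : IsCRField ρ M a) (hap : (fun j => a j p) ≠ 0) :
    tType ρ a p = cType ρ a p := by
  subst hM
  set r : SF 3 := SF.of (cx ρ) (Complex.ofRealCLM.contDiff.comp hρ)
  set A : Fin 3 → SF 3 := fun j => SF.of (a j) (ha.1 j)
  have hr0 : ∀ x, r.1 x = 0 → x ∈ {x | ρ x = 0} := fun x hx => Complex.ofReal_eq_zero.1 hx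
  have hstar : star r = r := SF.ext fun x => Complex.conj_ofReal (ρ x)
  have h : Model.CRPair r A := by
    refine ⟨hstar, fun x hx => ha.2 x (hr0 x hx), fun x hx ξ hξ => ?_⟩
    exact hpsc x (hr0 x hx) ξ hξ
  have hd : (fun j => evAt p (wD (Sum.inl j) r)) ≠ 0 := by
    intro hz
    have h1 : ∀ j, wz j (cx ρ) p = 0 := fun j => congrFun hz j
    have h2 : ∀ j, wzb j (cx ρ) p = 0 := fun j => by
      have := congrArg (evAt p) (wD_star (Sum.inr j) r)
      rw [hstar, map_star, Sum.swap_inr] at this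
      exact this.trans ((congrArg star (h1 j)).trans (star_zero ℂ))
    refine hreg p hp (ContinuousLinearMap.ext fun v => ?_)
    have h3 := fderiv_eq_sum_wirt (cx ρ) p v
    simp only [h1, h2, mul_zero, add_zero, Finset.sum_const_zero] at h3
    have h4 : fderiv ℝ (cx ρ) p = Complex.ofRealCLM.comp (fderiv ℝ ρ p) :=
      (Complex.ofRealCLM.hasFDerivAt.comp p (hρ.differentiable (by simp) p).hasFDerivAt).fderiv
    rw [h4] at h3
    exact Complex.ofReal_eq_zero.1 h3
  obtain ⟨Φ, Ψ, hΦ, h0, hN⟩ := h.exists_nf (p := p) (congrArg Complex.ofReal hp) hd hap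
  refine ENat.eq_of_forall_natCast_le_iff fun N => ?_
  refine (le_tType_iff ρ r rfl A p N).trans (Iff.trans ?_ (le_cType_iff ρ r rfl A p N).symm)
  rw [← h0, ← hΦ.commVanish_iff, ← hΦ.leviVanish_iff]
  exact hN.commVanish_iff_leviVanish N
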